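/- arXiv:math/0703682 — 7 statements merged into one kernel-verified Lean document; each statement's English description precedes it below -/
import Mathlib

section
/- For every integer δ ≥ 1, the lattice tetrahedron Ω with vertices v₀ = (0,0,0), v₁ = (1,0,0), v₂ = (δ−1,0,1), v₃ = (0,1,δ−1) satisfies: (i) |det(v₁−v₀, v₂−v₀, v₃−v₀)| = 1 (Ω is unimodular); (ii) all four vertices lie in Γ_δ; (iii) for each i ∈ {1,2,3,4}, at least two of the four vertices lie on the facet F_i of Γ_δ (so Ω has four exits). -/
noncomputable section

/-- Points of `ℝ³`. -/
abbrev V3 : Type := Fin 3 → ℝ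

/-- The simplex `Γ_δ = conv{(0,0,0), (δ,0,0), (0,δ,0), (0,0,δ)} ⊆ ℝ³`. -/
def Gamma (δ : ℝ) : Set V3 :=
  convexHull ℝ {![0, 0, 0], ![δ, 0, 0], ![0, δ, 0], ![0, 0, δ]}

/-- The four facets of `Γ_δ`: `F_i = {x ∈ Γ_δ : x_i = 0}` for `i = 1,2,3`, and
`F₄ = {x ∈ Γ_δ : x₁+x₂+x₃ = δ}`. -/
def Fface (δ : ℝ) : Fin 4 → Set V3 :=
  ![{x | x ∈ Gamma δ ∧ x 0 = 0},
    {x | x ∈ Gamma δ ∧ x 1 = 0},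
    {x | x ∈ Gamma δ ∧ x 2 = 0},
    {x | x ∈ Gamma δ ∧ x 0 + x 1 + x 2 = δ}]

/-- The vertices of the tetrahedron `Ω_δ`. -/
def OmegaVerts (δ : ℝ) : Set V3 :=
  {![0, 0, 0], ![1, 0, 0], ![δ - 1, 0, 1], ![0, 1, δ - 1]}

/-- Points with nonnegative coordinates of sum at most `δ` lie in `Γ_δ`. -/
lemma mem_Gamma_of_nonneg {d a b c : ℝ} (hd : 0 < d) (ha : 0 ≤ a) (hb : 0 ≤ b) (hc : 0 ≤ c)
    (h : a + b + c ≤ d) : (![a, b, c] : V3) ∈ Gamma d := by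
  have key := (convex_convexHull ℝ
    ({![0, 0, 0], ![d, 0, 0], ![0, d, 0], ![0, 0, d]} : Set V3)).sum_mem
    (t := Finset.univ) (w := ![(d - a - b - c) / d, a / d, b / d, c / d])
    (z := ![![0, 0, 0], ![d, 0, 0], ![0, d, 0], ![0, 0, d]])
    (by
      intro i _
      have h0 : 0 ≤ d - a - b - c := by linarith
      fin_cases i <;> simp <;> positivity)
    (by
      simp [Fin.sum_univ_four]
      field_simp
      ring)
    (by
      intro i _
      apply subset_convexHull
      fin_cases i <;> simp)
  unfold Gamma
  convert key using 1
  have hd' := hd.ne'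
  ext j
  fin_cases j <;> simp [Fin.sum_univ_four] <;> field_simp

/-- For every `δ ≥ 1`, the tetrahedron with vertices `(0,0,0), (1,0,0), (δ−1,0,1),
(0,1,δ−1)` is unimodular, lies in `Γ_δ`, and has four exits: each facet `F_i` of `Γ_δ`
contains at least two of its vertices. -/
theorem omega_tetrahedron_unimodular_four_exits (δ : ℕ) (hδ : 1 ≤ δ) :
    |Matrix.det !![(1 : ℤ), 0, 0; (δ : ℤ) - 1, 0, 1; 0, 1, (δ : ℤ) - 1]| = 1 ∧
    (∀ p ∈ OmegaVerts (δ : ℝ), p ∈ Gamma (δ : ℝ)) ∧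
    (∀ i : Fin 4, ∃ p q : V3, p ≠ q ∧ p ∈ OmegaVerts (δ : ℝ) ∧ q ∈ OmegaVerts (δ : ℝ) ∧
      p ∈ Fface (δ : ℝ) i ∧ q ∈ Fface (δ : ℝ) i) := by
  have h1 : (1 : ℝ) ≤ δ := by exact_mod_cast hδ
  have hd : (0 : ℝ) < δ := by linarith
  have g0 : (![0, 0, 0] : V3) ∈ Gamma (δ : ℝ) := by
    apply mem_Gamma_of_nonneg hd <;> linarith
  have g1 : (![1, 0, 0] : V3) ∈ Gamma (δ : ℝ) := by
    apply mem_Gamma_of_nonneg hd <;> linarith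
  have g2 : (![(δ : ℝ) - 1, 0, 1] : V3) ∈ Gamma (δ : ℝ) := by
    apply mem_Gamma_of_nonneg hd <;> linarith
  have g3 : (![0, 1, (δ : ℝ) - 1] : V3) ∈ Gamma (δ : ℝ) := by
    apply mem_Gamma_of_nonneg hd <;> linarith
  refine ⟨by simp [Matrix.det_fin_three], ?_, ?_⟩
  · rintro p (rfl | rfl | rfl | rfl) <;> assumption
  · intro i
    have n01 : (![0, 0, 0] : V3) ≠ ![1, 0, 0] := fun h => by simpa using congrFun h 0
    have n03 : (![0, 0, 0] : V3) ≠ ![0, 1, (δ : ℝ) - 1] := fun h => by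
      simpa using congrFun h 1
    have n23 : (![(δ : ℝ) - 1, 0, 1] : V3) ≠ ![0, 1, (δ : ℝ) - 1] := fun h => by
      simpa using congrFun h 1
    fin_cases i
    · exact ⟨_, _, n03, by simp [OmegaVerts], by simp [OmegaVerts], ⟨g0, by simp⟩, ⟨g3, by simp⟩⟩
    · exact ⟨_, _, n01, by simp [OmegaVerts], by simp [OmegaVerts], ⟨g0, by simp⟩, ⟨g1, by simp⟩⟩
    · exact ⟨_, _, n01, by simp [OmegaVerts], by simp [OmegaVerts], ⟨g0, by simp⟩, ⟨g1, by simp⟩⟩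
    · exact ⟨_, _, n23, by simp [OmegaVerts], by simp [OmegaVerts], ⟨g2, by simp⟩, ⟨g3, by simp⟩⟩
end
end

section
/- Let δ ≥ 2 be an integer and let u, v, w ∈ Γ_δ ∩ ℤ³ be affinely independent lattice points such that the triangle Δ = conv{u,v,w} is primitive, i.e., Δ ∩ ℤ³ = {u, v, w}. Then Δ has at most 3 exits: it is not the case that for every i ∈ {1,2,3,4} there exist two distinct points p ≠ q with p, q ∈ Δ ∩ F_i. -/
noncomputable section

/-- The canonical embedding of a lattice point of `ℤ³` into `ℝ³`. -/
def zToR (a : Fin 3 → ℤ) : V3 := fun i => (a i : ℝ)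

theorem hull3 {a b c p : V3} (hp : p ∈ convexHull ℝ ({a, b, c} : Set V3)) :
    ∃ α β γ : ℝ, 0 ≤ α ∧ 0 ≤ β ∧ 0 ≤ γ ∧ α + β + γ = 1 ∧
      ∀ k, p k = α * a k + β * b k + γ * c k := by
  rw [convexHull_insert (by simp), convexHull_pair, mem_convexJoin] at hp
  obtain ⟨x, hx, y, hy, hp⟩ := hp
  rw [Set.mem_singleton_iff] at hx
  subst hx
  obtain ⟨s, t, hs, ht, hst, rfl⟩ := hy
  obtain ⟨s', t', hs', ht', hst', rfl⟩ := hp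
  refine ⟨s', t' * s, t' * t, hs', by positivity, by positivity, ?_, ?_⟩
  · rw [add_assoc, ← mul_add, hst, mul_one, hst']
  · intro k
    simp only [Pi.add_apply, Pi.smul_apply, smul_eq_mul]
    ring

/-- The region cut out by the four facet inequalities. -/
theorem gamma_ineq {δ : ℝ} (hδ : 0 ≤ δ) {x : V3} (hx : x ∈ Gamma δ) :
    0 ≤ x 0 ∧ 0 ≤ x 1 ∧ 0 ≤ x 2 ∧ x 0 + x 1 + x 2 ≤ δ := by
  have hc : Convex ℝ {x : V3 | 0 ≤ x 0 ∧ 0 ≤ x 1 ∧ 0 ≤ x 2 ∧ x 0 + x 1 + x 2 ≤ δ} := by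
    rintro x ⟨h0, h1, h2, h3⟩ y ⟨g0, g1, g2, g3⟩ s t hs ht hst
    simp only [Set.mem_ofPred_eq, Pi.add_apply, Pi.smul_apply, smul_eq_mul]
    refine ⟨by positivity, by positivity, by positivity, ?_⟩
    have e : δ = s * δ + t * δ := by rw [← add_mul, hst, one_mul]
    have := mul_le_mul_of_nonneg_left h3 hs
    have := mul_le_mul_of_nonneg_left g3 ht
    linarith
  refine convexHull_min ?_ hc hx
  intro y hy
  simp only [Set.mem_insert_iff, Set.mem_singleton_iff] at hy
  rcases hy with rfl | rfl | rfl | rfl <;> simp [hδ]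

theorem third_of_pos {a b c p : V3} (d : ℝ) (e : Fin 3 → ℝ)
    (hp : p ∈ convexHull ℝ ({a, b, c} : Set V3))
    (ha : 0 < d + e 0 * a 0 + e 1 * a 1 + e 2 * a 2)
    (hb : 0 < d + e 0 * b 0 + e 1 * b 1 + e 2 * b 2)
    (hc : 0 ≤ d + e 0 * c 0 + e 1 * c 1 + e 2 * c 2)
    (h : d + e 0 * p 0 + e 1 * p 1 + e 2 * p 2 = 0) : p = c := by
  obtain ⟨α, β, γ, h1, h2, h3, hs, hk⟩ := hull3 hp
  have hγ : γ = 1 - α - β := by linarith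
  have key : α * (d + e 0 * a 0 + e 1 * a 1 + e 2 * a 2)
      + β * (d + e 0 * b 0 + e 1 * b 1 + e 2 * b 2)
      + γ * (d + e 0 * c 0 + e 1 * c 1 + e 2 * c 2) = 0 := by
    rw [← h, hk, hk, hk, hγ]; ring
  have k1 := mul_nonneg h1 ha.le
  have k2 := mul_nonneg h2 hb.le
  have k3 := mul_nonneg h3 hc
  have hα : α = 0 := by
    have : α * (d + e 0 * a 0 + e 1 * a 1 + e 2 * a 2) = 0 := by linarith
    exact (mul_eq_zero.1 this).resolve_right ha.ne'
  have hβ : β = 0 := by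
    have : β * (d + e 0 * b 0 + e 1 * b 1 + e 2 * b 2) = 0 := by linarith
    exact (mul_eq_zero.1 this).resolve_right hb.ne'
  funext k
  rw [hk, hγ, hα, hβ]; ring

theorem exit_zero {a b c p q : V3} (d : ℝ) (e : Fin 3 → ℝ) (hpq : p ≠ q)
    (hp : p ∈ convexHull ℝ ({a, b, c} : Set V3))
    (hq : q ∈ convexHull ℝ ({a, b, c} : Set V3))
    (ha : 0 ≤ d + e 0 * a 0 + e 1 * a 1 + e 2 * a 2)
    (hb : 0 ≤ d + e 0 * b 0 + e 1 * b 1 + e 2 * b 2)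
    (hc : 0 ≤ d + e 0 * c 0 + e 1 * c 1 + e 2 * c 2)
    (hp0 : d + e 0 * p 0 + e 1 * p 1 + e 2 * p 2 = 0)
    (hq0 : d + e 0 * q 0 + e 1 * q 1 + e 2 * q 2 = 0) :
    (d + e 0 * a 0 + e 1 * a 1 + e 2 * a 2 = 0 ∧ d + e 0 * b 0 + e 1 * b 1 + e 2 * b 2 = 0) ∨
    (d + e 0 * a 0 + e 1 * a 1 + e 2 * a 2 = 0 ∧ d + e 0 * c 0 + e 1 * c 1 + e 2 * c 2 = 0) ∨
    (d + e 0 * b 0 + e 1 * b 1 + e 2 * b 2 = 0 ∧ d + e 0 * c 0 + e 1 * c 1 + e 2 * c 2 = 0) := by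
  have r1 : ({a, b, c} : Set V3) = {a, c, b} := by
    rw [Set.pair_comm b c]
  have r2 : ({a, b, c} : Set V3) = {b, c, a} := by
    rw [Set.insert_comm a b, Set.pair_comm a c]
  rcases ha.eq_or_lt with ha' | ha'
  · rcases hb.eq_or_lt with hb' | hb'
    · exact Or.inl ⟨ha'.symm, hb'.symm⟩
    · rcases hc.eq_or_lt with hc' | hc'
      · exact Or.inr (Or.inl ⟨ha'.symm, hc'.symm⟩)
      · rw [r2] at hp hq
        exact absurd ((third_of_pos d e hp hb' hc' ha hp0).trans
          (third_of_pos d e hq hb' hc' ha hq0).symm) hpq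
  · rcases hb.eq_or_lt with hb' | hb'
    · rcases hc.eq_or_lt with hc' | hc'
      · exact Or.inr (Or.inr ⟨hb'.symm, hc'.symm⟩)
      · rw [r1] at hp hq
        exact absurd ((third_of_pos d e hp ha' hc' hb hp0).trans
          (third_of_pos d e hq ha' hc' hb hq0).symm) hpq
    · exact absurd ((third_of_pos d e hp ha' hb' hc hp0).trans
          (third_of_pos d e hq ha' hb' hc hq0).symm) hpq

/-- The combinatorial relation: at least two of three integers vanish. -/
def TwoZero (x y z : ℤ) : Prop := (x = 0 ∧ y = 0) ∨ (x = 0 ∧ z = 0) ∨ (y = 0 ∧ z = 0)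

/-- `u` is a vertex of the simplex. -/
def IsVert (δ : ℤ) (u : Fin 3 → ℤ) : Prop :=
  (u 0 = 0 ∧ u 1 = 0 ∧ u 2 = 0) ∨ (u 0 = δ ∧ u 1 = 0 ∧ u 2 = 0) ∨
  (u 0 = 0 ∧ u 1 = δ ∧ u 2 = 0) ∨ (u 0 = 0 ∧ u 1 = 0 ∧ u 2 = δ)

set_option maxHeartbeats 4000000 in
theorem two_verts {δ : ℤ} (hδ : 2 ≤ δ) {u v w : Fin 3 → ℤ}
    (h0 : TwoZero (u 0) (v 0) (w 0)) (h1 : TwoZero (u 1) (v 1) (w 1))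
    (h2 : TwoZero (u 2) (v 2) (w 2))
    (h3 : TwoZero (δ - u 0 - u 1 - u 2) (δ - v 0 - v 1 - v 2) (δ - w 0 - w 1 - w 2)) :
    (IsVert δ u ∧ IsVert δ v) ∨ (IsVert δ u ∧ IsVert δ w) ∨ (IsVert δ v ∧ IsVert δ w) := by
  unfold TwoZero at *
  unfold IsVert
  rcases h0 with ⟨a, b⟩ | ⟨a, b⟩ | ⟨a, b⟩ <;> rcases h1 with ⟨c, d⟩ | ⟨c, d⟩ | ⟨c, d⟩ <;>
  rcases h2 with ⟨e, f⟩ | ⟨e, f⟩ | ⟨e, f⟩ <;> rcases h3 with ⟨g, h⟩ | ⟨g, h⟩ | ⟨g, h⟩ <;>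
  simp only [a, b, c, d, e, f, true_and, and_true, true_or] at g h ⊢ <;> omega

theorem vert_div {δ : ℤ} {u : Fin 3 → ℤ} (h : IsVert δ u) : ∃ s : Fin 3 → ℤ, ∀ k, u k = δ * s k := by
  have : ∀ k, δ ∣ u k := by
    rcases h with h | h | h | h <;> obtain ⟨a, b, c⟩ := h <;> intro k <;>
    fin_cases k <;> simp [a, b, c]
  choose s hs using this
  exact ⟨s, hs⟩

theorem no_pair {δ : ℤ} (hδ : 2 ≤ δ) {u v w : Fin 3 → ℤ}
    (hprim : ∀ x : Fin 3 → ℤ, zToR x ∈ convexHull ℝ ({zToR u, zToR v, zToR w} : Set V3) →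
      x = u ∨ x = v ∨ x = w)
    (hu : IsVert δ u) (hv : IsVert δ v)
    (h0 : TwoZero (u 0) (v 0) (w 0)) (h1 : TwoZero (u 1) (v 1) (w 1))
    (h2 : TwoZero (u 2) (v 2) (w 2))
    (h3 : TwoZero (δ - u 0 - u 1 - u 2) (δ - v 0 - v 1 - v 2) (δ - w 0 - w 1 - w 2)) : False := by
  have main : ∀ (d : ℤ) (e : Fin 3 → ℤ), 0 < d + e 0 * u 0 + e 1 * u 1 + e 2 * u 2 →
      d + e 0 * v 0 + e 1 * v 1 + e 2 * v 2 = 0 →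
      d + e 0 * w 0 + e 1 * w 1 + e 2 * w 2 = 0 → False := by
    intro d e hU hV hW
    obtain ⟨s, hs⟩ := vert_div hu
    obtain ⟨t, ht⟩ := vert_div hv
    have hδR : (2 : ℝ) ≤ (δ : ℝ) := by exact_mod_cast hδ
    have hδ0 : (δ : ℝ) ≠ 0 := by positivity
    have hx : ∀ k, δ * (u k - s k + t k) = (δ - 1) * u k + v k := by
      intro k; rw [hs, ht]; ring
    have key : δ * (d + e 0 * (u 0 - s 0 + t 0) + e 1 * (u 1 - s 1 + t 1)
        + e 2 * (u 2 - s 2 + t 2)) = (δ - 1) * (d + e 0 * u 0 + e 1 * u 1 + e 2 * u 2) := by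
      linear_combination e 0 * hx 0 + e 1 * hx 1 + e 2 * hx 2 + hV
    have hmem : zToR (fun k => u k - s k + t k) ∈
        convexHull ℝ ({zToR u, zToR v, zToR w} : Set V3) := by
      have hseg : zToR (fun k => u k - s k + t k) ∈ segment ℝ (zToR u) (zToR v) := by
        refine ⟨1 - 1 / (δ : ℝ), 1 / (δ : ℝ), ?_, by positivity, by ring, ?_⟩
        · rw [sub_nonneg, div_le_one (by positivity)]; linarith
        · funext k
          have hk : (δ : ℝ) * (u k - s k + t k) = (δ - 1) * u k + v k := by exact_mod_cast hx k
          simp only [zToR, Pi.add_apply, Pi.smul_apply, smul_eq_mul]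
          push_cast
          field_simp
          linarith
      exact (convex_convexHull ℝ _).segment_subset (subset_convexHull ℝ _ (by simp))
        (subset_convexHull ℝ _ (by simp)) hseg
    rcases hprim (fun k => u k - s k + t k) hmem with h | h | h
    · have g0 := congrFun h 0
      have g1 := congrFun h 1
      have g2 := congrFun h 2
      rw [g0, g1, g2] at key
      nlinarith
    · have g0 := congrFun h 0
      have g1 := congrFun h 1
      have g2 := congrFun h 2
      rw [g0, g1, g2, hV] at key
      nlinarith
    · have g0 := congrFun h 0
      have g1 := congrFun h 1
      have g2 := congrFun h 2
      rw [g0, g1, g2, hW] at key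
      nlinarith
  unfold TwoZero at *
  rcases hu with ⟨a, b, c⟩ | ⟨a, b, c⟩ | ⟨a, b, c⟩ | ⟨a, b, c⟩
  · have : δ - v 0 - v 1 - v 2 = 0 ∧ δ - w 0 - w 1 - w 2 = 0 := by omega
    exact main δ ![-1, -1, -1] (by simp; omega) (by simp; omega) (by simp; omega)
  · have : v 0 = 0 ∧ w 0 = 0 := by omega
    exact main 0 ![1, 0, 0] (by simp; omega) (by simp; omega) (by simp; omega)
  · have : v 1 = 0 ∧ w 1 = 0 := by omega
    exact main 0 ![0, 1, 0] (by simp; omega) (by simp; omega) (by simp; omega)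
  · have : v 2 = 0 ∧ w 2 = 0 := by omega
    exact main 0 ![0, 0, 1] (by simp; omega) (by simp; omega) (by simp; omega)

/-- A primitive lattice triangle in `Γ_δ` (with `δ ≥ 2`) has at most 3 exits: it cannot
meet every facet `F_i` of `Γ_δ` in a set of dimension `≥ 1` (i.e. containing two distinct
points). -/
theorem primitive_triangle_at_most_three_exits (δ : ℕ) (hδ : 2 ≤ δ)
    (u v w : Fin 3 → ℤ)
    (hu : zToR u ∈ Gamma (δ : ℝ)) (hv : zToR v ∈ Gamma (δ : ℝ))
    (hw : zToR w ∈ Gamma (δ : ℝ))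
    (hind : AffineIndependent ℝ ![zToR u, zToR v, zToR w])
    (hprim : convexHull ℝ ({zToR u, zToR v, zToR w} : Set V3)
        ∩ {x : V3 | ∀ i, ∃ m : ℤ, x i = (m : ℝ)} = {zToR u, zToR v, zToR w}) :
    ¬ ∀ i : Fin 4, ∃ p q : V3, p ≠ q ∧
        p ∈ convexHull ℝ ({zToR u, zToR v, zToR w} : Set V3) ∩ Fface (δ : ℝ) i ∧
        q ∈ convexHull ℝ ({zToR u, zToR v, zToR w} : Set V3) ∩ Fface (δ : ℝ) i := by
  intro hex
  have hd0 : (0 : ℝ) ≤ (δ : ℝ) := by positivity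
  obtain ⟨u0, u1, u2, u3⟩ := gamma_ineq hd0 hu
  obtain ⟨v0, v1, v2, v3⟩ := gamma_ineq hd0 hv
  obtain ⟨w0, w1, w2, w3⟩ := gamma_ineq hd0 hw
  have hδ' : (2 : ℤ) ≤ (δ : ℤ) := by exact_mod_cast hδ
  have hinj : ∀ x y : Fin 3 → ℤ, zToR x = zToR y → x = y := by
    intro x y h
    funext k
    have := congrFun h k
    simpa [zToR] using this
  have P : ∀ x : Fin 3 → ℤ, zToR x ∈ convexHull ℝ ({zToR u, zToR v, zToR w} : Set V3) →
      x = u ∨ x = v ∨ x = w := by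
    intro x hx
    have : zToR x ∈ ({zToR u, zToR v, zToR w} : Set V3) := by
      rw [← hprim]
      exact ⟨hx, fun i => ⟨x i, rfl⟩⟩
    simp only [Set.mem_insert_iff, Set.mem_singleton_iff] at this
    exact this.imp (hinj _ _) (Or.imp (hinj _ _) (hinj _ _))
  have t0 : TwoZero (u 0) (v 0) (w 0) := by
    obtain ⟨p, q, hpq, ⟨hp, -, hp0⟩, ⟨hq, -, hq0⟩⟩ := hex 0
    have := exit_zero 0 ![1, 0, 0] hpq hp hq (by simpa using u0) (by simpa using v0)
      (by simpa using w0) (by simpa using hp0) (by simpa using hq0)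
    simpa [TwoZero, zToR] using this
  have t1 : TwoZero (u 1) (v 1) (w 1) := by
    obtain ⟨p, q, hpq, ⟨hp, -, hp0⟩, ⟨hq, -, hq0⟩⟩ := hex 1
    have := exit_zero 0 ![0, 1, 0] hpq hp hq (by simpa using u1) (by simpa using v1)
      (by simpa using w1) (by simpa using hp0) (by simpa using hq0)
    simpa [TwoZero, zToR] using this
  have t2 : TwoZero (u 2) (v 2) (w 2) := by
    obtain ⟨p, q, hpq, ⟨hp, -, hp0⟩, ⟨hq, -, hq0⟩⟩ := hex 2
    have := exit_zero 0 ![0, 0, 1] hpq hp hq (by simpa using u2) (by simpa using v2)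
      (by simpa using w2) (by simpa using hp0) (by simpa using hq0)
    simpa [TwoZero, zToR] using this
  have t3 : TwoZero ((δ : ℤ) - u 0 - u 1 - u 2) ((δ : ℤ) - v 0 - v 1 - v 2)
      ((δ : ℤ) - w 0 - w 1 - w 2) := by
    obtain ⟨p, q, hpq, ⟨hp, -, hp0⟩, ⟨hq, -, hq0⟩⟩ := hex 3
    have := exit_zero (δ : ℝ) ![-1, -1, -1] hpq hp hq (by simp; linarith) (by simp; linarith)
      (by simp; linarith) (by simp; linarith) (by simp; linarith)
    simp only [zToR, Matrix.cons_val, neg_mul, one_mul, ← sub_eq_add_neg] at this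
    unfold TwoZero
    exact_mod_cast this
  have s1 : ∀ {x y z : ℤ}, TwoZero x y z → TwoZero x z y := by
    unfold TwoZero; intros; omega
  have s2 : ∀ {x y z : ℤ}, TwoZero x y z → TwoZero y z x := by
    unfold TwoZero; intros; omega
  rcases two_verts hδ' t0 t1 t2 t3 with ⟨a, b⟩ | ⟨a, b⟩ | ⟨a, b⟩
  · exact no_pair hδ' P a b t0 t1 t2 t3
  · refine no_pair hδ' (w := v) ?_ a b (s1 t0) (s1 t1) (s1 t2) (s1 t3)
    intro x hx
    rw [Set.pair_comm] at hx
    have := P x hx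
    tauto
  · refine no_pair hδ' (w := u) ?_ a b (s2 t0) (s2 t1) (s2 t2) (s2 t3)
    intro x hx
    rw [Set.pair_comm (zToR w), Set.insert_comm] at hx
    have := P x hx
    tauto
end
end

section
/- Let P, Q ∈ ℝ³ be distinct points and set D = Q − P. The set of tropical lines (as subsets of ℝ³) containing both P and Q is infinite if and only if D has a zero coordinate (D₁ = 0 or D₂ = 0 or D₃ = 0) or two equal coordinates (D₁ = D₂ or D₁ = D₃ or D₂ = D₃). In all other cases (all coordinates of D nonzero and pairwise distinct), there is exactly one tropical line containing both P and Q. -/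
open scoped BigOperators

noncomputable section

/-- The pairing `⟨a, x⟩ = ∑ aᵢ xᵢ` of a lattice point `a ∈ ℤ³` with `x ∈ ℝ³`. -/
def dotZR (a : Fin 3 → ℤ) (x : V3) : ℝ := ∑ i, (a i : ℝ) * x i

/-- The lattice points of `Γ_δ`:
`A_δ = {a ∈ ℤ³ : a₁,a₂,a₃ ≥ 0, a₁+a₂+a₃ ≤ δ}`. -/
def Adelta (δ : ℕ) : Set (Fin 3 → ℤ) :=
  {a | (∀ i, 0 ≤ a i) ∧ a 0 + a 1 + a 2 ≤ (δ : ℤ)}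

/-- The argmax set `S_λ(x) = {a ∈ A_δ : λ(a) + ⟨a,x⟩ = max_{b ∈ A_δ} (λ(b) + ⟨b,x⟩)}`. -/
def Sarg (δ : ℕ) (lam : (Fin 3 → ℤ) → ℝ) (x : V3) : Set (Fin 3 → ℤ) :=
  {a | a ∈ Adelta δ ∧ ∀ b ∈ Adelta δ, lam b + dotZR b x ≤ lam a + dotZR a x}

/-- The tropical surface `V(λ) = {x ∈ ℝ³ : S_λ(x) has at least 2 elements}`. -/
def Vtrop (δ : ℕ) (lam : (Fin 3 → ℤ) → ℝ) : Set V3 :=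
  {x | ∃ a ∈ Sarg δ lam x, ∃ b ∈ Sarg δ lam x, a ≠ b}

/-- The determinant of the `3×3` integer matrix with rows `u, v, w`. -/
def detZ (u v w : Fin 3 → ℤ) : ℤ := Matrix.det (Matrix.of ![u, v, w])

/-- `λ` is smooth (tropically): for every `x ∈ ℝ³` the set `S_λ(x)` is affinely independent in `ℝ³`,
and whenever `S_λ(x)` has exactly 4 elements `a₀,a₁,a₂,a₃`, the tetrahedron they span is
unimodular: `|det(a₁−a₀, a₂−a₀, a₃−a₀)| = 1`. -/
def TropSmooth (δ : ℕ) (lam : (Fin 3 → ℤ) → ℝ) : Prop :=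
  ∀ x : V3,
    AffineIndependent ℝ (fun a : Sarg δ lam x => zToR a.1) ∧
    ∀ a₀ a₁ a₂ a₃ : Fin 3 → ℤ,
      Sarg δ lam x = {a₀, a₁, a₂, a₃} → (Sarg δ lam x).ncard = 4 →
      |detZ (a₁ - a₀) (a₂ - a₀) (a₃ - a₀)| = 1

/-- The four directions `ω₁ = −e₁`, `ω₂ = −e₂`, `ω₃ = −e₃`, `ω₄ = e₁+e₂+e₃`. -/
def ωdir : Fin 4 → V3 := ![![-1, 0, 0], ![0, -1, 0], ![0, 0, -1], ![1, 1, 1]]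

/-- The closed ray from `p` in direction `d`. -/
def ray (p d : V3) : Set V3 := {x | ∃ t : ℝ, 0 ≤ t ∧ x = p + t • d}

/-- The tropical line with vertices `v, w`, rays in directions `ω_i, ω_j` at `v` and
`ω_k, ω_l` at `w`. -/
def TLine (v w : V3) (i j k l : Fin 4) : Set V3 :=
  ray v (ωdir i) ∪ ray v (ωdir j) ∪ segment ℝ v w ∪ ray w (ωdir k) ∪ ray w (ωdir l)

/-- The data `(v, w, i, j, k, l)` describes a genuine tropical line: `{i,j,k,l} = {1,2,3,4}`
and `w = v + t·(ω_k + ω_l)` for some `t ≥ 0`. -/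
def IsTLineData (v w : V3) (i j k l : Fin 4) : Prop :=
  ({i, j, k, l} : Finset (Fin 4)) = Finset.univ ∧
  ∃ t : ℝ, 0 ≤ t ∧ w = v + t • (ωdir k + ωdir l)

/-- A subset `L ⊆ ℝ³` is a tropical line. -/
def IsTropicalLine (L : Set V3) : Prop :=
  ∃ v w i j k l, IsTLineData v w i j k l ∧ L = TLine v w i j k l

set_option linter.unusedSimpArgs false

/-- homogenised coordinates -/
def hh (x : V3) : Fin 4 → ℝ := ![x 0, x 1, x 2, 0]

lemma hh_add (x y : V3) (m : Fin 4) : hh (x + y) m = hh x m + hh y m := by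
  fin_cases m <;> simp [hh]

lemma hh_sub (x y : V3) (m : Fin 4) : hh (x - y) m = hh x m - hh y m := by
  fin_cases m <;> simp [hh]

lemma hh_smul (t : ℝ) (y : V3) (m : Fin 4) : hh (t • y) m = t * hh y m := by
  fin_cases m <;> simp [hh]

lemma hh_ω (a m : Fin 4) :
    hh (ωdir a) m = (if a = 3 then 1 else 0) - (if a = m then 1 else 0) := by
  fin_cases a <;> fin_cases m <;> simp [hh, ωdir]

lemma perm_ne (i j k l : Fin 4) (h : ({i, j, k, l} : Finset (Fin 4)) = Finset.univ) :
    i ≠ j ∧ i ≠ k ∧ i ≠ l ∧ j ≠ k ∧ j ≠ l ∧ k ≠ l := by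
  revert i j k l; decide

lemma perm_mem (i j k l : Fin 4) (h : ({i, j, k, l} : Finset (Fin 4)) = Finset.univ) (m : Fin 4) :
    m = i ∨ m = j ∨ m = k ∨ m = l := by
  have : m ∈ ({i, j, k, l} : Finset (Fin 4)) := by rw [h]; simp
  simpa using this

lemma perm_swap (i j k l : Fin 4) (h : ({i, j, k, l} : Finset (Fin 4)) = Finset.univ) :
    ({k, l, i, j} : Finset (Fin 4)) = Finset.univ ∧
    ({j, i, k, l} : Finset (Fin 4)) = Finset.univ ∧
    ({i, j, l, k} : Finset (Fin 4)) = Finset.univ ∧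
    ({l, k, j, i} : Finset (Fin 4)) = Finset.univ ∧
    ({j, k, i, l} : Finset (Fin 4)) = Finset.univ := by
  revert i j k l; decide

lemma perm_sum (i j k l : Fin 4) (h : ({i, j, k, l} : Finset (Fin 4)) = Finset.univ) :
    ωdir i + ωdir j + ωdir k + ωdir l = 0 := by
  obtain ⟨h1, h2, h3, h4, h5, h6⟩ := perm_ne i j k l h
  have h0 : ∑ m : Fin 4, ωdir m = 0 := by
    funext n; fin_cases n <;> simp [Fin.sum_univ_four, ωdir]
  rw [← h, Finset.sum_insert (by simp [*]), Finset.sum_insert (by simp [*]),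
    Finset.sum_insert (by simp [*]), Finset.sum_singleton] at h0
  rw [← h0]; abel

/-- every vector in terms of homogenised coordinates -/
lemma repr_ω (x : V3) (i j k l : Fin 4) (h : ({i, j, k, l} : Finset (Fin 4)) = Finset.univ) :
    x = -(hh x i • ωdir i + hh x j • ωdir j + hh x k • ωdir k + hh x l • ωdir l) := by
  obtain ⟨h1, h2, h3, h4, h5, h6⟩ := perm_ne i j k l h
  have h0 : x = - ∑ m : Fin 4, hh x m • ωdir m := by
    funext n; fin_cases n <;> simp [Fin.sum_univ_four, ωdir, hh]
  rw [← h, Finset.sum_insert (by simp [*]), Finset.sum_insert (by simp [*]),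
    Finset.sum_insert (by simp [*]), Finset.sum_singleton] at h0
  conv_lhs => rw [h0]
  abel

lemma TLine_swap (v w : V3) (i j k l : Fin 4) : TLine v w i j k l = TLine w v k l i j := by
  unfold TLine; rw [segment_symm]; ext x; simp only [Set.mem_union]; tauto

lemma TLine_swap1 (v w : V3) (i j k l : Fin 4) : TLine v w i j k l = TLine v w j i k l := by
  unfold TLine; ext x; simp only [Set.mem_union]; tauto

lemma TLine_swap2 (v w : V3) (i j k l : Fin 4) : TLine v w i j k l = TLine v w i j l k := by
  unfold TLine; ext x; simp only [Set.mem_union]; tauto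

lemma data_swap {v w : V3} {i j k l : Fin 4} (h : IsTLineData v w i j k l) :
    IsTLineData w v k l i j := by
  obtain ⟨h, t, ht, rfl⟩ := h
  refine ⟨(perm_swap i j k l h).1, t, ht, ?_⟩
  have e : ωdir l = -(ωdir i + ωdir j + ωdir k) := by
    rw [eq_neg_iff_add_eq_zero, ← perm_sum i j k l h]; abel
  rw [e]; module

lemma seg_mem {v w x u : V3} {t : ℝ} (hw : w = v + t • u) (ht : 0 ≤ t) :
    x ∈ segment ℝ v w ↔ ∃ s, 0 ≤ s ∧ s ≤ t ∧ x = v + s • u := by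
  subst hw
  rw [segment_eq_image']
  constructor
  · rintro ⟨θ, ⟨h0, h1⟩, rfl⟩
    refine ⟨θ * t, by positivity, by nlinarith, ?_⟩
    simp only; module
  · rintro ⟨s, h0, h1, rfl⟩
    rcases ht.eq_or_lt with rfl | ht
    · obtain rfl : s = 0 := le_antisymm h1 h0
      exact ⟨0, by simp, by simp⟩
    · refine ⟨s / t, ⟨by positivity, by rw [div_le_one ht]; exact h1⟩, ?_⟩
      have : s / t * t = s := by field_simp
      simp only [add_sub_cancel_left, smul_smul, this]

/-- extending the segment beyond `v` leaves the line -/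
lemma vertex_le {w : V3} {i j k l : Fin 4} (h : ({i, j, k, l} : Finset (Fin 4)) = Finset.univ)
    {t t' : ℝ} (ht : 0 ≤ t) (ht' : 0 ≤ t')
    (hm : w - t' • (ωdir k + ωdir l) ∈ TLine (w - t • (ωdir k + ωdir l)) w i j k l) : t' ≤ t := by
  obtain ⟨h1, h2, h3, h4, h5, h6⟩ := perm_ne i j k l h
  have key : ∀ x : V3, w - t' • (ωdir k + ωdir l) = x → ∀ m,
      hh (w - t' • (ωdir k + ωdir l)) m = hh x m := by rintro x rfl m; rfl
  rcases hm with (((hm | hm) | hm) | hm) | hm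
  · obtain ⟨r, hr, e⟩ := hm
    have a := key _ e
    have ai := a i; have aj := a j; have ak := a k; have al := a l
    simp only [hh_add, hh_sub, hh_smul, hh_ω, h1, h2, h3, h4, h5, h6, h1.symm, h2.symm, h3.symm,
      h4.symm, h5.symm, h6.symm, if_true, if_false] at ai aj ak al
    linarith
  · obtain ⟨r, hr, e⟩ := hm
    have a := key _ e
    have ai := a i; have aj := a j; have ak := a k; have al := a l
    simp only [hh_add, hh_sub, hh_smul, hh_ω, h1, h2, h3, h4, h5, h6, h1.symm, h2.symm, h3.symm,
      h4.symm, h5.symm, h6.symm, if_true, if_false] at ai aj ak al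
    linarith
  · obtain ⟨r, hr, hr', e⟩ := (seg_mem (u := ωdir k + ωdir l) (by module) ht).1 hm
    have a := key _ e
    have ai := a i; have aj := a j; have ak := a k; have al := a l
    simp only [hh_add, hh_sub, hh_smul, hh_ω, h1, h2, h3, h4, h5, h6, h1.symm, h2.symm, h3.symm,
      h4.symm, h5.symm, h6.symm, if_true, if_false] at ai aj ak al
    linarith
  · obtain ⟨r, hr, e⟩ := hm
    have a := key _ e
    have ai := a i; have aj := a j; have ak := a k; have al := a l
    simp only [hh_add, hh_sub, hh_smul, hh_ω, h1, h2, h3, h4, h5, h6, h1.symm, h2.symm, h3.symm,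
      h4.symm, h5.symm, h6.symm, if_true, if_false] at ai aj ak al
    linarith
  · obtain ⟨r, hr, e⟩ := hm
    have a := key _ e
    have ai := a i; have aj := a j; have ak := a k; have al := a l
    simp only [hh_add, hh_sub, hh_smul, hh_ω, h1, h2, h3, h4, h5, h6, h1.symm, h2.symm, h3.symm,
      h4.symm, h5.symm, h6.symm, if_true, if_false] at ai aj ak al
    linarith

lemma family_infinite (P Q w : V3) {i j k l : Fin 4}
    (h : ({i, j, k, l} : Finset (Fin 4)) = Finset.univ) {c : ℝ} (hc : 0 ≤ c)
    (hP : ∀ t, c ≤ t → P ∈ TLine (w - t • (ωdir k + ωdir l)) w i j k l)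
    (hQ : ∀ t, c ≤ t → Q ∈ TLine (w - t • (ωdir k + ωdir l)) w i j k l) :
    {L : Set V3 | IsTropicalLine L ∧ P ∈ L ∧ Q ∈ L}.Infinite := by
  have hinj : Set.InjOn (fun t : ℝ => TLine (w - t • (ωdir k + ωdir l)) w i j k l) (Set.Ici c) := by
    have aux : ∀ s t : ℝ, c ≤ s → c ≤ t → TLine (w - s • (ωdir k + ωdir l)) w i j k l =
        TLine (w - t • (ωdir k + ωdir l)) w i j k l → s ≤ t := by
      intro s t hs ht e
      apply vertex_le h (hc.trans ht) (hc.trans hs)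
      rw [← e]
      exact Or.inl (Or.inl (Or.inl (Or.inl ⟨0, le_rfl, by simp⟩)))
    intro s hs t ht e
    exact le_antisymm (aux s t hs ht e) (aux t s ht hs e.symm)
  refine ((Set.Ici_infinite c).image hinj).mono ?_
  rintro _ ⟨t, ht, rfl⟩
  exact ⟨⟨_, _, i, j, k, l, ⟨h, t, hc.trans ht, by module⟩, rfl⟩, hP t ht, hQ t ht⟩

lemma exists_sorted (d : Fin 4 → ℝ) : ∃ i j k l : Fin 4,
    ({i, j, k, l} : Finset (Fin 4)) = Finset.univ ∧ d j ≤ d i ∧ d k ≤ d j ∧ d l ≤ d k := by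
  have hm := Tuple.monotone_sort d
  refine ⟨Tuple.sort d 3, Tuple.sort d 2, Tuple.sort d 1, Tuple.sort d 0, ?_,
    hm (by decide), hm (by decide), hm (by decide)⟩
  ext m
  simp only [Finset.mem_insert, Finset.mem_singleton, Finset.mem_univ, iff_true]
  obtain ⟨n, rfl⟩ := (Tuple.sort d).surjective m
  fin_cases n <;> simp

/-- D in sorted steps -/
lemma step_eq {P Q : V3} {i j k l : Fin 4}
    (h : ({i, j, k, l} : Finset (Fin 4)) = Finset.univ) :
    Q = P - (hh (Q - P) i - hh (Q - P) j) • ωdir i +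
      (hh (Q - P) j - hh (Q - P) k) • (ωdir k + ωdir l) +
      (hh (Q - P) k - hh (Q - P) l) • ωdir l := by
  have e := repr_ω (Q - P) i j k l h
  have e' : Q = P + (Q - P) := by abel
  generalize hh (Q - P) = d at *
  have e2 : ωdir j = -(ωdir i + ωdir k + ωdir l) := by
    rw [eq_neg_iff_add_eq_zero, ← perm_sum i j k l h]; abel
  rw [e, e2] at e'
  rw [e']; module

lemma caseA (P Q : V3) {i j k l : Fin 4}
    (h : ({i, j, k, l} : Finset (Fin 4)) = Finset.univ)
    (h1 : hh (Q - P) i = hh (Q - P) j) (h2 : hh (Q - P) k ≤ hh (Q - P) j)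
    (h3 : hh (Q - P) l ≤ hh (Q - P) k) :
    {L : Set V3 | IsTropicalLine L ∧ P ∈ L ∧ Q ∈ L}.Infinite := by
  have e := step_eq (P := P) (Q := Q) h
  generalize hh (Q - P) = d at *
  refine family_infinite P Q (P + (d j - d k) • (ωdir k + ωdir l)) h (c := d j - d k)
    (by linarith) ?_ ?_
  · intro t ht
    refine Or.inl (Or.inl (Or.inr ?_))
    rw [seg_mem (t := t) (u := ωdir k + ωdir l) (by module) (by linarith)]
    exact ⟨t - (d j - d k), by linarith, by linarith, by module⟩
  · intro t ht
    refine Or.inr ⟨d k - d l, by linarith, ?_⟩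
    conv_lhs => rw [e, h1]
    module

lemma caseB (P Q : V3) {i j k l : Fin 4}
    (h : ({i, j, k, l} : Finset (Fin 4)) = Finset.univ)
    (h1 : hh (Q - P) j ≤ hh (Q - P) i) (h2 : hh (Q - P) j = hh (Q - P) k)
    (h3 : hh (Q - P) l ≤ hh (Q - P) k) :
    {L : Set V3 | IsTropicalLine L ∧ P ∈ L ∧ Q ∈ L}.Infinite := by
  have e := step_eq (P := P) (Q := Q) h
  generalize hh (Q - P) = d at *
  refine family_infinite P Q (P - (d i - d j) • ωdir i) (perm_swap i j k l h).2.2.2.2 (c := 0)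
    le_rfl ?_ ?_
  · intro t ht
    exact Or.inl (Or.inr ⟨d i - d j, by linarith, by module⟩)
  · intro t ht
    refine Or.inr ⟨d k - d l, by linarith, ?_⟩
    conv_lhs => rw [e]
    rw [h2]; module

lemma infinite_of_not_inj (P Q : V3) (hd : ¬ Function.Injective (hh (Q - P))) :
    {L : Set V3 | IsTropicalLine L ∧ P ∈ L ∧ Q ∈ L}.Infinite := by
  obtain ⟨i, j, k, l, h, h1, h2, h3⟩ := exists_sorted (hh (Q - P))
  rcases h1.eq_or_lt with e1 | l1
  · exact caseA P Q h e1.symm h2 h3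
  rcases h2.eq_or_lt with e2 | l2
  · exact caseB P Q h h1 e2.symm h3
  rcases h3.eq_or_lt with e3 | l3
  · have hneg : ∀ m, hh (P - Q) m = - hh (Q - P) m := by intro m; simp [hh_sub]
    have := caseA Q P (perm_swap i j k l h).2.2.2.1 (by simp only [hneg]; linarith)
      (by simp only [hneg]; linarith) (by simp only [hneg]; linarith)
    refine this.mono ?_
    rintro L ⟨a, b, c⟩
    exact ⟨a, c, b⟩
  · refine absurd ?_ hd
    intro m n hmn
    rcases perm_mem i j k l h m with rfl | rfl | rfl | rfl <;>
    rcases perm_mem _ _ _ _ h n with rfl | rfl | rfl | rfl <;>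
    first | rfl | (exfalso; linarith)

/-- the canonical line -/
def canon (P Q : V3) (i j k l : Fin 4) : Set V3 :=
  TLine (P - (hh (Q - P) i - hh (Q - P) j) • ωdir i)
    (P - (hh (Q - P) i - hh (Q - P) j) • ωdir i +
      (hh (Q - P) j - hh (Q - P) k) • (ωdir k + ωdir l)) i j k l

def Good (P Q : V3) (L : Set V3) : Prop :=
  ∃ i j k l : Fin 4, ({i, j, k, l} : Finset (Fin 4)) = Finset.univ ∧
    hh (Q - P) j < hh (Q - P) i ∧ hh (Q - P) k < hh (Q - P) j ∧ hh (Q - P) l < hh (Q - P) k ∧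
    L = canon P Q i j k l

lemma Good_unique {P Q : V3} (hd : Function.Injective (hh (Q - P))) {L L' : Set V3}
    (hL : Good P Q L) (hL' : Good P Q L') : L = L' := by
  obtain ⟨i, j, k, l, h, h1, h2, h3, rfl⟩ := hL
  obtain ⟨i', j', k', l', h', h1', h2', h3', rfl⟩ := hL'
  have m := perm_mem i j k l h
  have m' := perm_mem i' j' k' l' h'
  obtain ⟨n1, n2, n3, n4, n5, n6⟩ := perm_ne i j k l h
  obtain ⟨n1', n2', n3', n4', n5', n6'⟩ := perm_ne i' j' k' l' h'
  have ei : i = i' := by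
    apply hd; apply le_antisymm
    · rcases m' i with e | e | e | e <;> rw [e] <;> linarith
    · rcases m i' with e | e | e | e <;> rw [e] <;> linarith
  subst ei
  have ej : j = j' := by
    apply hd; apply le_antisymm
    · rcases m' j with e | e | e | e
      · exact absurd e n1.symm
      all_goals first | exact (congrArg _ e).le | (rw [e]; linarith)
    · rcases m j' with e | e | e | e
      · exact absurd e n1'.symm
      all_goals first | exact (congrArg _ e).le | (rw [e]; linarith)
  subst ej
  have ek : k = k' := by
    apply hd; apply le_antisymm
    · rcases m' k with e | e | e | e
      · exact absurd e n2.symm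
      · exact absurd e n4.symm
      all_goals first | exact (congrArg _ e).le | (rw [e]; linarith)
    · rcases m k' with e | e | e | e
      · exact absurd e n2'.symm
      · exact absurd e n4'.symm
      all_goals first | exact (congrArg _ e).le | (rw [e]; linarith)
  subst ek
  have el : l = l' := by
    rcases m l' with e | e | e | e
    · exact absurd e n3'.symm
    · exact absurd e n5'.symm
    · exact absurd e n6'.symm
    · exact e.symm
  rw [el]

lemma good_main {P Q v w : V3} {i j k l : Fin 4} (hd : Function.Injective (hh (Q - P)))
    (h : IsTLineData v w i j k l) (hP : P ∈ ray v (ωdir i)) (hQ : Q ∈ ray w (ωdir l)) :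
    Good P Q (TLine v w i j k l) := by
  obtain ⟨h, t, ht, rfl⟩ := h
  obtain ⟨a, ha, rfl⟩ := hP
  obtain ⟨b, hb, rfl⟩ := hQ
  obtain ⟨h1, h2, h3, h4, h5, h6⟩ := perm_ne i j k l h
  have n1 := hd.ne h1
  have n4 := hd.ne h4
  have n6 := hd.ne h6
  have key : ∀ m, hh (v + t • (ωdir k + ωdir l) + b • ωdir l - (v + a • ωdir i)) m =
    t * (hh (ωdir k) m + hh (ωdir l) m) + b * hh (ωdir l) m - a * hh (ωdir i) m := by
    intro m; simp only [hh_add, hh_sub, hh_smul]; ring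
  have ki := key i; have kj := key j; have kk := key k; have kl := key l
  refine ⟨i, j, k, l, h, ?_⟩
  unfold canon
  generalize hh (v + t • (ωdir k + ωdir l) + b • ωdir l - (v + a • ωdir i)) = d at *
  simp only [hh_ω, h1, h2, h3, h4, h5, h6, h1.symm, h2.symm, h3.symm,
      h4.symm, h5.symm, h6.symm, if_true, if_false] at ki kj kk kl
  have e1 : d i - d j = a := by rw [ki, kj]; ring
  have e2 : d j - d k = t := by rw [kj, kk]; ring
  have e3 : d k - d l = b := by rw [kl, kk]; ring
  refine ⟨lt_of_le_of_ne (by linarith) n1.symm, lt_of_le_of_ne (by linarith) n4.symm,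
    lt_of_le_of_ne (by linarith) n6.symm, ?_⟩
  rw [e1, e2]
  congr 1 <;> module

/-- `x - v` or `x - w` lies in the span of a ray; coordinates outside agree. -/
lemma same_side {P Q v w : V3} {i j k l : Fin 4} (h : IsTLineData v w i j k l)
    (hP : P ∈ ray v (ωdir i) ∪ ray v (ωdir j) ∪ segment ℝ v w)
    (hQ : Q ∈ ray v (ωdir i) ∪ ray v (ωdir j) ∪ segment ℝ v w) :
    hh (Q - P) k = hh (Q - P) l := by
  obtain ⟨h, t, ht, hw⟩ := h
  obtain ⟨h1, h2, h3, h4, h5, h6⟩ := perm_ne i j k l h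
  have aux : ∀ x, x ∈ ray v (ωdir i) ∪ ray v (ωdir j) ∪ segment ℝ v w →
      hh x k - hh v k = hh x l - hh v l := by
    rintro x ((⟨r, -, rfl⟩ | ⟨r, -, rfl⟩) | hx)
    · simp only [hh_add, hh_smul, hh_ω, h2, h3, if_false]; ring
    · simp only [hh_add, hh_smul, hh_ω, h4, h5, if_false]; ring
    · obtain ⟨s, -, -, rfl⟩ := (seg_mem hw ht).1 hx
      simp only [hh_add, hh_smul, hh_ω, h6, h6.symm, if_true, if_false]; ring
  have := aux P hP
  have := aux Q hQ
  simp only [hh_sub]; linarith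

lemma good_two {P Q v w : V3} {i j k l : Fin 4} (hd : Function.Injective (hh (Q - P)))
    (h : IsTLineData v w i j k l) (hP : P ∈ ray v (ωdir i) ∪ ray v (ωdir j))
    (hQ : Q ∈ ray w (ωdir k) ∪ ray w (ωdir l)) :
    Good P Q (TLine v w i j k l) := by
  have hs := perm_swap i j k l h.1
  have d1 : IsTLineData v w j i k l := ⟨hs.2.1, h.2⟩
  have d2 : IsTLineData v w i j l k := ⟨hs.2.2.1, by rw [add_comm (ωdir l)]; exact h.2⟩
  have d3 : IsTLineData v w j i l k :=
    ⟨(perm_swap _ _ _ _ d2.1).2.1, by rw [add_comm (ωdir l)]; exact h.2⟩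
  rcases hP with hP | hP <;> rcases hQ with hQ | hQ
  · rw [TLine_swap2]; exact good_main hd d2 hP hQ
  · exact good_main hd h hP hQ
  · rw [TLine_swap2, TLine_swap1]; exact good_main hd d3 hP hQ
  · rw [TLine_swap1]; exact good_main hd d1 hP hQ

lemma good_of_line {P Q : V3} (hd : Function.Injective (hh (Q - P))) {L : Set V3}
    (hL : IsTropicalLine L) (hP : P ∈ L) (hQ : Q ∈ L) : Good P Q L := by
  obtain ⟨v, w, i, j, k, l, h, rfl⟩ := hL
  obtain ⟨h1, h2, h3, h4, h5, h6⟩ := perm_ne i j k l h.1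
  have A := fun a b => h6 (hd (same_side (P := P) (Q := Q) h a b))
  have B := fun a b => h1 (hd (same_side (P := P) (Q := Q) (data_swap h) a b))
  rw [segment_symm] at B
  have T := good_two (P := P) (Q := Q) hd h
  have T' := good_two (P := P) (Q := Q) hd (data_swap h)
  rw [← TLine_swap] at T'
  rcases hP with (hP | hP) | hP
  · rcases hQ with (hQ | hQ) | hQ
    · exact (A hP hQ).elim
    · rcases hP with hP | hP
      · exact T hP (Or.inl hQ)
      · exact (B (Or.inr hP) (Or.inl (Or.inl hQ))).elim
    · rcases hP with hP | hP
      · exact T hP (Or.inr hQ)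
      · exact (B (Or.inr hP) (Or.inl (Or.inr hQ))).elim
  · rcases hQ with (hQ | hQ) | hQ
    · rcases hQ with hQ | hQ
      · exact T' (Or.inl hP) hQ
      · exact (B (Or.inl (Or.inl hP)) (Or.inr hQ)).elim
    · exact (B (Or.inl (Or.inl hP)) (Or.inl (Or.inl hQ))).elim
    · exact (B (Or.inl (Or.inl hP)) (Or.inl (Or.inr hQ))).elim
  · rcases hQ with (hQ | hQ) | hQ
    · rcases hQ with hQ | hQ
      · exact T' (Or.inr hP) hQ
      · exact (B (Or.inl (Or.inr hP)) (Or.inr hQ)).elim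
    · exact (B (Or.inl (Or.inr hP)) (Or.inl (Or.inl hQ))).elim
    · exact (B (Or.inl (Or.inr hP)) (Or.inl (Or.inr hQ))).elim

lemma inj_iff (x : V3) : ¬ Function.Injective (hh x) ↔
    (x 0 = 0 ∨ x 1 = 0 ∨ x 2 = 0 ∨ x 0 = x 1 ∨ x 0 = x 2 ∨ x 1 = x 2) := by
  constructor
  · intro h
    by_contra hc
    simp only [not_or] at hc
    obtain ⟨a, b, c, d, e, f⟩ := hc
    apply h
    intro m n hmn
    fin_cases m <;> fin_cases n <;> simp_all [hh, eq_comm]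
  · rintro (h | h | h | h | h | h) hi
    · exact absurd (hi (a₁ := 0) (a₂ := 3) (by simpa [hh] using h)) (by decide)
    · exact absurd (hi (a₁ := 1) (a₂ := 3) (by simpa [hh] using h)) (by decide)
    · exact absurd (hi (a₁ := 2) (a₂ := 3) (by simpa [hh] using h)) (by decide)
    · exact absurd (hi (a₁ := 0) (a₂ := 1) (by simpa [hh] using h)) (by decide)
    · exact absurd (hi (a₁ := 0) (a₂ := 2) (by simpa [hh] using h)) (by decide)
    · exact absurd (hi (a₁ := 1) (a₂ := 2) (by simpa [hh] using h)) (by decide)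

lemma exists_line (P Q : V3) : ∃ L, IsTropicalLine L ∧ P ∈ L ∧ Q ∈ L := by
  obtain ⟨i, j, k, l, h, h1, h2, h3⟩ := exists_sorted (hh (Q - P))
  refine ⟨canon P Q i j k l, ⟨_, _, i, j, k, l, ⟨h, _, ?_, rfl⟩, rfl⟩, ?_, ?_⟩
  · linarith
  · exact Or.inl (Or.inl (Or.inl (Or.inl ⟨hh (Q - P) i - hh (Q - P) j, by linarith, by module⟩)))
  · exact Or.inr ⟨hh (Q - P) k - hh (Q - P) l, by linarith, step_eq h⟩

/-- Two distinct points `P, Q ∈ ℝ³` lie on infinitely many tropical lines if and only if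
`D = Q − P` has a zero coordinate or two equal coordinates; otherwise they lie on a
unique tropical line. -/
theorem tropical_lines_through_two_points (P Q : V3) (hPQ : P ≠ Q) :
    ({L : Set V3 | IsTropicalLine L ∧ P ∈ L ∧ Q ∈ L}.Infinite ↔
      ((Q - P) 0 = 0 ∨ (Q - P) 1 = 0 ∨ (Q - P) 2 = 0 ∨
        (Q - P) 0 = (Q - P) 1 ∨ (Q - P) 0 = (Q - P) 2 ∨ (Q - P) 1 = (Q - P) 2)) ∧
    (¬((Q - P) 0 = 0 ∨ (Q - P) 1 = 0 ∨ (Q - P) 2 = 0 ∨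
        (Q - P) 0 = (Q - P) 1 ∨ (Q - P) 0 = (Q - P) 2 ∨ (Q - P) 1 = (Q - P) 2) →
      ∃! L : Set V3, IsTropicalLine L ∧ P ∈ L ∧ Q ∈ L) := by
  rw [← inj_iff, not_not]
  have U : Function.Injective (hh (Q - P)) → ∃! L : Set V3, IsTropicalLine L ∧ P ∈ L ∧ Q ∈ L := by
    intro hd
    obtain ⟨L, h1, h2, h3⟩ := exists_line P Q
    refine ⟨L, ⟨h1, h2, h3⟩, ?_⟩
    rintro L' ⟨h1', h2', h3'⟩
    exact Good_unique hd (good_of_line hd h1' h2' h3') (good_of_line hd h1 h2 h3)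
  refine ⟨⟨?_, infinite_of_not_inj P Q⟩, U⟩
  intro hinf hd
  obtain ⟨L, -, hu⟩ := U hd
  exact hinf ((Set.finite_singleton L).subset hu)
end
end

section
/- Let δ ≥ 3 be an integer, let λ : A_δ → ℝ be smooth, and let L be a tropical line with L ⊆ V(λ). Then L passes through a vertex of the tropical surface: there exists x ∈ L such that S_λ(x) has exactly 4 elements. -/
open scoped BigOperators

noncomputable section

/-! ### Helper material -/

/-- Homogeneous coordinates of a lattice point. -/
def hcoord (δ : ℕ) (a : Fin 3 → ℤ) : Fin 4 → ℤ := ![a 0, a 1, a 2, (δ : ℤ) - a 0 - a 1 - a 2]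

lemma dotZR_add_smul (a : Fin 3 → ℤ) (p d : V3) (t : ℝ) :
    dotZR a (p + t • d) = dotZR a p + t * dotZR a d := by
  simp only [dotZR, Fin.sum_univ_three, Pi.add_apply, Pi.smul_apply, smul_eq_mul]; ring

lemma dotZR_add (a : Fin 3 → ℤ) (p d : V3) :
    dotZR a (p + d) = dotZR a p + dotZR a d := by
  simp only [dotZR, Fin.sum_univ_three, Pi.add_apply]; ring

lemma dotZR_neg (a : Fin 3 → ℤ) (d : V3) : dotZR a (-d) = - dotZR a d := by
  simp only [dotZR, Fin.sum_univ_three, Pi.neg_apply]; ring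

lemma dotZR_omega (δ : ℕ) (a b : Fin 3 → ℤ) (i : Fin 4) :
    dotZR a (ωdir i) - dotZR b (ωdir i) = (hcoord δ b i : ℝ) - hcoord δ a i := by
  fin_cases i <;> simp [dotZR, Fin.sum_univ_three, ωdir, hcoord] <;> ring

lemma hcoord_nonneg {δ : ℕ} {a : Fin 3 → ℤ} (ha : a ∈ Adelta δ) (i : Fin 4) :
    0 ≤ hcoord δ a i := by
  obtain ⟨h1, h2⟩ := ha
  have := h1 0
  have := h1 1
  have := h1 2
  fin_cases i <;> simp [hcoord] <;> omega

lemma hcoord_sum (δ : ℕ) (a : Fin 3 → ℤ) : ∑ i, hcoord δ a i = δ := by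
  simp [Fin.sum_univ_four, hcoord]

lemma exists_hcoord_zero (δ : ℕ) (i : Fin 4) : ∃ b ∈ Adelta δ, hcoord δ b i = 0 := by
  by_cases h : i = 3
  · refine ⟨![(δ : ℤ), 0, 0], ⟨?_, ?_⟩, ?_⟩
    · intro j; fin_cases j <;> simp
    · simp
    · subst h; simp [hcoord]
  · refine ⟨0, ⟨?_, ?_⟩, ?_⟩
    · intro j; simp
    · simp
    · fin_cases i <;> simp_all [hcoord]

lemma Adelta_finite (δ : ℕ) : (Adelta δ).Finite := by
  apply (Set.finite_Icc (0 : Fin 3 → ℤ) (fun _ => (δ : ℤ))).subset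
  rintro a ⟨h1, h2⟩
  have := h1 0
  have := h1 1
  have := h1 2
  refine ⟨fun i => h1 i, fun i => ?_⟩
  fin_cases i <;> simp <;> omega

lemma Sarg_finite (δ : ℕ) (lam : (Fin 3 → ℤ) → ℝ) (x : V3) : (Sarg δ lam x).Finite :=
  (Adelta_finite δ).subset fun _ h => h.1

lemma Sarg_ncard_le {δ : ℕ} {lam : (Fin 3 → ℤ) → ℝ} (hsm : TropSmooth δ lam) (x : V3) :
    (Sarg δ lam x).ncard ≤ 4 := by
  have h := (hsm x).1
  have : Fintype (Sarg δ lam x) := (Sarg_finite δ lam x).fintype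
  have h2 := h.card_le_finrank_succ
  have h3 : Module.finrank ℝ (vectorSpan ℝ (Set.range fun a : Sarg δ lam x => zToR a.1)) ≤ 3 := by
    have := Submodule.finrank_le (vectorSpan ℝ (Set.range fun a : Sarg δ lam x => zToR a.1))
    simpa using this
  rw [← Nat.card_coe_set_eq, Nat.card_eq_fintype_card]
  omega

lemma continuous_dotZR (a : Fin 3 → ℤ) : Continuous (dotZR a) := by
  unfold dotZR; fun_prop

/-- Upper semicontinuity of the argmax set. -/
lemma Sarg_local (δ : ℕ) (lam : (Fin 3 → ℤ) → ℝ) (x : V3) :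
    ∀ᶠ y in nhds x, Sarg δ lam y ⊆ Sarg δ lam x := by
  have key : ∀ᶠ y in nhds x, ∀ a ∈ Adelta δ, ∀ b ∈ Adelta δ,
      lam a + dotZR a x < lam b + dotZR b x → lam a + dotZR a y < lam b + dotZR b y := by
    rw [(Adelta_finite δ).eventually_all]
    intro a _
    rw [(Adelta_finite δ).eventually_all]
    intro b _
    by_cases h : lam a + dotZR a x < lam b + dotZR b x
    · have c1 : Continuous fun y => lam a + dotZR a y := continuous_const.add (continuous_dotZR a)
      have c2 : Continuous fun y => lam b + dotZR b y := continuous_const.add (continuous_dotZR b)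
      filter_upwards [c1.continuousAt.eventually_lt c2.continuousAt h] with y hy _
      exact hy
    · exact Filter.Eventually.of_forall fun y h' => absurd h' h
  filter_upwards [key] with y hy a ha
  refine ⟨ha.1, fun b hb => ?_⟩
  by_contra hc
  push Not at hc
  have := hy a ha.1 b hb hc
  linarith [ha.2 b hb]

lemma Sarg_isClosed (δ : ℕ) (lam : (Fin 3 → ℤ) → ℝ) (p d : V3) (a : Fin 3 → ℤ) :
    IsClosed {t : ℝ | a ∈ Sarg δ lam (p + t • d)} := by
  have : {t : ℝ | a ∈ Sarg δ lam (p + t • d)} =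
      {t : ℝ | a ∈ Adelta δ} ∩ ⋂ b ∈ Adelta δ,
        {t : ℝ | lam b + dotZR b (p + t • d) ≤ lam a + dotZR a (p + t • d)} := by
    ext t; simp [Sarg]
  rw [this]
  refine IsClosed.inter isClosed_const (isClosed_biInter fun b _ => ?_)
  have := continuous_dotZR a
  have := continuous_dotZR b
  exact isClosed_le (by fun_prop) (by fun_prop)

lemma four_le_ncard {S : Set (Fin 3 → ℤ)} (hS : S.Finite) {a b c d : Fin 3 → ℤ}
    (ha : a ∈ S) (hb : b ∈ S) (hc : c ∈ S) (hd : d ∈ S)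
    (hab : a ≠ b) (hac : a ≠ c) (had : a ≠ d) (hbc : b ≠ c) (hbd : b ≠ d) (hcd : c ≠ d) :
    4 ≤ S.ncard := by
  have h1 : ({a, b, c, d} : Finset (Fin 3 → ℤ)).card = 4 := by
    rw [Finset.card_eq_succ]
    refine ⟨a, {b, c, d}, ?_, rfl, ?_⟩
    · simp [hab, hac, had]
    · exact Finset.card_eq_three.2 ⟨b, c, d, hbc, hbd, hcd, rfl⟩
  rw [← h1, ← Set.ncard_coe_finset]
  apply Set.ncard_le_ncard _ hS
  intro x hx
  simp at hx
  rcases hx with rfl | rfl | rfl | rfl <;> assumption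

lemma Sarg_mem_of_eq {δ : ℕ} {lam : (Fin 3 → ℤ) → ℝ} {x : V3} {a b : Fin 3 → ℤ}
    (ha : a ∈ Sarg δ lam x) (hb : b ∈ Adelta δ)
    (h : lam a + dotZR a x = lam b + dotZR b x) : b ∈ Sarg δ lam x :=
  ⟨hb, fun c hc => by rw [← h]; exact ha.2 c hc⟩

lemma Sarg_eq {δ : ℕ} {lam : (Fin 3 → ℤ) → ℝ} {x : V3} {a b : Fin 3 → ℤ}
    (ha : a ∈ Sarg δ lam x) (hb : b ∈ Sarg δ lam x) :
    lam a + dotZR a x = lam b + dotZR b x :=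
  le_antisymm (hb.2 a ha.1) (ha.2 b hb.1)

/-- A dual edge persists along a direction orthogonal to it, as long as no vertex is met. -/
lemma persist {δ : ℕ} {lam : (Fin 3 → ℤ) → ℝ} {p d : V3} {T : ℝ} (hT : 0 ≤ T)
    {a b : Fin 3 → ℤ} (hab : a ≠ b) (hd : dotZR a d = dotZR b d)
    (ha : a ∈ Sarg δ lam p) (hb : b ∈ Sarg δ lam p)
    (hV : ∀ t, 0 ≤ t → t ≤ T → p + t • d ∈ Vtrop δ lam)
    (hc : ∀ t, 0 ≤ t → t ≤ T → (Sarg δ lam (p + t • d)).ncard < 4) :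
    a ∈ Sarg δ lam (p + T • d) ∧ b ∈ Sarg δ lam (p + T • d) := by
  have hval : ∀ t : ℝ, lam a + dotZR a (p + t • d) = lam b + dotZR b (p + t • d) := by
    intro t
    rw [dotZR_add_smul, dotZR_add_smul, hd]
    linarith [Sarg_eq ha hb]
  have main : Set.Icc 0 T ⊆ {t : ℝ | a ∈ Sarg δ lam (p + t • d)} := by
    apply IsClosed.Icc_subset_of_forall_exists_gt
    · exact (Sarg_isClosed δ lam p d a).inter isClosed_Icc
    · simpa using ha
    · rintro x ⟨hx, hx0, hxT⟩ y hy
      have hy : x < y := hy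
      have hx : a ∈ Sarg δ lam (p + x • d) := hx
      have hloc : ∀ᶠ t in nhds x, Sarg δ lam (p + t • d) ⊆ Sarg δ lam (p + x • d) := by
        have hcont : Continuous fun t : ℝ => p + t • d := by fun_prop
        exact hcont.continuousAt.eventually (Sarg_local δ lam (p + x • d))
      have h1 : ∀ᶠ t in nhdsWithin x (Set.Ioi x), t ∈ Set.Ioc x (min y T) :=
        Ioc_mem_nhdsGT (lt_min hy hxT)
      obtain ⟨z, hz1, hz2⟩ := ((hloc.filter_mono nhdsWithin_le_nhds).and h1).exists
      have hzT : z ≤ T := hz2.2.trans (min_le_right _ _)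
      refine ⟨z, ?_, hz2.1, hz2.2.trans (min_le_left _ _)⟩
      by_contra hza
      have hza : a ∉ Sarg δ lam (p + z • d) := hza
      have hzb : b ∉ Sarg δ lam (p + z • d) := fun h =>
        hza (Sarg_mem_of_eq h ha.1 (hval z).symm)
      have hz0 : 0 ≤ z := hx0.trans hz2.1.le
      obtain ⟨c, hcS, e, heS, hce⟩ := hV z hz0 hzT
      have := four_le_ncard (Sarg_finite δ lam _) hx
        (Sarg_mem_of_eq hx hb.1 (hval x)) (hz1 hcS) (hz1 heS) hab
        (fun h => hza (h ▸ hcS)) (fun h => hza (h ▸ heS))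
        (fun h => hzb (h ▸ hcS)) (fun h => hzb (h ▸ heS)) hce
      have := hc x hx0 hxT.le
      omega
  have hTa : a ∈ Sarg δ lam (p + T • d) := main ⟨hT, le_refl _⟩
  exact ⟨hTa, Sarg_mem_of_eq hTa hb.1 (hval T)⟩

/-- The pair condition: two distinct elements of `S(x)` whose `i`-th coordinate vanishes. -/
def ZPair (δ : ℕ) (lam : (Fin 3 → ℤ) → ℝ) (x : V3) (i : Fin 4) : Prop :=
  ∃ a ∈ Sarg δ lam x, ∃ b ∈ Sarg δ lam x, a ≠ b ∧ hcoord δ a i = 0 ∧ hcoord δ b i = 0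

lemma far_zero (δ : ℕ) (lam : (Fin 3 → ℤ) → ℝ) (p : V3) (i : Fin 4) :
    ∃ T : ℝ, 0 ≤ T ∧ ∀ a ∈ Sarg δ lam (p + T • ωdir i), hcoord δ a i = 0 := by
  obtain ⟨b, hb, hb0⟩ := exists_hcoord_zero δ i
  obtain ⟨M, hM⟩ := ((Adelta_finite δ).image
    fun a => (lam a + dotZR a p) - (lam b + dotZR b p)).bddAbove
  refine ⟨max M 0 + 1, by positivity, fun a ha => ?_⟩
  have h0 := hcoord_nonneg ha.1 i
  by_contra hne
  have h1 : (1 : ℝ) ≤ hcoord δ a i := by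
    have : 1 ≤ hcoord δ a i := by omega
    exact_mod_cast this
  have h2 := ha.2 b hb
  rw [dotZR_add_smul, dotZR_add_smul] at h2
  have h3 := dotZR_omega δ a b i
  rw [hb0] at h3
  have h4 : (lam a + dotZR a p) - (lam b + dotZR b p) ≤ M := hM ⟨a, ha.1, rfl⟩
  have h5 := le_max_left M 0
  have h6 := le_max_right M 0
  have h7 : dotZR a (ωdir i) = dotZR b (ωdir i) - hcoord δ a i := by push_cast at h3; linarith
  rw [h7] at h2
  nlinarith

lemma ray_pair {δ : ℕ} {lam : (Fin 3 → ℤ) → ℝ} {p : V3} {i : Fin 4}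
    (hV : ray p (ωdir i) ⊆ Vtrop δ lam)
    (hc : ∀ x ∈ ray p (ωdir i), (Sarg δ lam x).ncard < 4) : ZPair δ lam p i := by
  obtain ⟨T, hT, hz⟩ := far_zero δ lam p i
  obtain ⟨a, ha, b, hb, hab⟩ := hV ⟨T, hT, rfl⟩
  have hrew : ∀ t : ℝ, p + T • ωdir i + t • (-ωdir i) = p + (T - t) • ωdir i := by
    intro t; module
  have hd : dotZR a (-ωdir i) = dotZR b (-ωdir i) := by
    have := dotZR_omega δ a b i
    rw [hz a ha, hz b hb] at this
    rw [dotZR_neg, dotZR_neg]; linarith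
  have := persist hT hab hd ha hb
    (fun t _ h1 => hV ⟨T - t, by linarith, hrew t⟩)
    (fun t _ h1 => hc _ ⟨T - t, by linarith, hrew t⟩)
  rw [hrew, sub_self, zero_smul, add_zero] at this
  exact ⟨a, this.1, b, this.2, hab, hz a ha, hz b hb⟩

lemma seg_pair {δ : ℕ} {lam : (Fin 3 → ℤ) → ℝ} {p d : V3} {T : ℝ} (hT : 0 < T)
    (hV : ∀ t, 0 ≤ t → t ≤ T → p + t • d ∈ Vtrop δ lam)
    (hc : ∀ t, 0 ≤ t → t ≤ T → (Sarg δ lam (p + t • d)).ncard < 4) :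
    ∃ a b, a ≠ b ∧ dotZR a d = dotZR b d ∧ a ∈ Sarg δ lam p ∧ b ∈ Sarg δ lam p ∧
      a ∈ Sarg δ lam (p + T • d) ∧ b ∈ Sarg δ lam (p + T • d) := by
  have hloc : ∀ᶠ t in nhds (0 : ℝ), Sarg δ lam (p + t • d) ⊆ Sarg δ lam p := by
    have hcont : Continuous fun t : ℝ => p + t • d := by fun_prop
    have h0 : Filter.Tendsto (fun t : ℝ => p + t • d) (nhds 0) (nhds p) := by
      simpa using hcont.tendsto 0
    exact h0.eventually (Sarg_local δ lam p)
  have h1 : ∀ᶠ t in nhdsWithin (0 : ℝ) (Set.Ioi 0), t ∈ Set.Ioc 0 T := Ioc_mem_nhdsGT hT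
  obtain ⟨z, hz1, hz2⟩ := ((hloc.filter_mono nhdsWithin_le_nhds).and h1).exists
  obtain ⟨a, ha, b, hb, hab⟩ := hV z hz2.1.le hz2.2
  have hd : dotZR a d = dotZR b d := by
    have e1 := Sarg_eq ha hb
    have e2 := Sarg_eq (hz1 ha) (hz1 hb)
    rw [dotZR_add_smul, dotZR_add_smul] at e1
    have : z * dotZR a d = z * dotZR b d := by linarith
    exact mul_left_cancel₀ hz2.1.ne' this
  have := persist hT.le hab hd (hz1 ha) (hz1 hb) hV hc
  exact ⟨a, b, hab, hd, hz1 ha, hz1 hb, this.1, this.2⟩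

lemma exists_dir_increase {δ : ℕ} (hδ : 1 ≤ δ) (a : Fin 3 → ℤ) {d : V3} (hd : d ≠ 0) :
    ∃ b ∈ Adelta δ, dotZR b d ≠ dotZR a d := by
  by_contra hcon
  push Not at hcon
  apply hd
  have h0 := hcon 0 ⟨fun i => by simp, by simp⟩
  have hz : dotZR 0 d = 0 := by simp [dotZR]
  have hδ' : (1 : ℤ) ≤ δ := by exact_mod_cast hδ
  funext i
  have h1 := hcon (Pi.single i 1) ⟨fun j => by
    by_cases h : j = i
    · subst h; simp
    · simp [h], by fin_cases i <;> simp [Pi.single_apply] <;> omega⟩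
  have h2 : dotZR (Pi.single i 1) d = d i := by
    fin_cases i <;> simp [dotZR, Fin.sum_univ_three, Pi.single_apply]
  rw [Pi.zero_apply]; linarith

lemma exists_orth (u v : V3) : ∃ d : V3, d ≠ 0 ∧ u ⬝ᵥ d = 0 ∧ v ⬝ᵥ d = 0 := by
  let f : V3 →ₗ[ℝ] (Fin 2 → ℝ) := Matrix.mulVecLin (Matrix.of ![u, v])
  have hk : LinearMap.ker f ≠ ⊥ := LinearMap.ker_ne_bot_of_finrank_lt (by simp)
  obtain ⟨d, hd, hd0⟩ := Submodule.exists_mem_ne_zero_of_ne_bot hk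
  have hd : f d = 0 := hd
  refine ⟨d, hd0, ?_, ?_⟩
  · have := congrFun hd 0
    simpa [f, Matrix.mulVec] using this
  · have := congrFun hd 1
    simpa [f, Matrix.mulVec] using this

/-- A dual triangle extends to a dual tetrahedron. -/
lemma extend_triangle {δ : ℕ} (hδ : 1 ≤ δ) {lam : (Fin 3 → ℤ) → ℝ} {x : V3}
    {a b c : Fin 3 → ℤ}
    (ha : a ∈ Sarg δ lam x) (hb : b ∈ Sarg δ lam x) (hc : c ∈ Sarg δ lam x) :
    ∃ y e, a ∈ Sarg δ lam y ∧ b ∈ Sarg δ lam y ∧ c ∈ Sarg δ lam y ∧ e ∈ Sarg δ lam y ∧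
      e ≠ a ∧ e ≠ b ∧ e ≠ c := by
  obtain ⟨d0, hd0, h1, h2⟩ := exists_orth (zToR b - zToR a) (zToR c - zToR a)
  have conv : ∀ u : Fin 3 → ℤ, (zToR u - zToR a) ⬝ᵥ d0 = dotZR u d0 - dotZR a d0 := by
    intro u; rw [sub_dotProduct]; rfl
  rw [conv] at h1 h2
  obtain ⟨d, hdb, hdc, g, hg, hgd⟩ : ∃ d : V3, dotZR b d = dotZR a d ∧ dotZR c d = dotZR a d ∧
      ∃ g ∈ Adelta δ, dotZR a d < dotZR g d := by
    obtain ⟨g, hg, hne⟩ := exists_dir_increase hδ a hd0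
    rcases lt_or_gt_of_ne hne with h | h
    · refine ⟨-d0, ?_, ?_, g, hg, ?_⟩ <;> simp only [dotZR_neg] <;> linarith
    · exact ⟨d0, by linarith, by linarith, g, hg, h⟩
  let B : Set (Fin 3 → ℤ) := {e | e ∈ Adelta δ ∧ dotZR a d < dotZR e d}
  have hBf : B.Finite := (Adelta_finite δ).subset fun _ h => h.1
  let r : (Fin 3 → ℤ) → ℝ := fun e =>
    ((lam a + dotZR a x) - (lam e + dotZR e x)) / (dotZR e d - dotZR a d)
  obtain ⟨e, he, hmin⟩ := hBf.exists_minimalFor r B ⟨g, hg, hgd⟩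
  have hmin' : ∀ u ∈ B, r e ≤ r u := by
    intro u hu
    rcases le_total (r e) (r u) with h | h
    · exact h
    · exact hmin hu h
  have hpos : 0 < dotZR e d - dotZR a d := sub_pos.2 he.2
  have hre : r e * (dotZR e d - dotZR a d) = (lam a + dotZR a x) - (lam e + dotZR e x) :=
    div_mul_cancel₀ _ hpos.ne'
  have hr0 : 0 ≤ r e := div_nonneg (sub_nonneg.2 (ha.2 e he.1)) hpos.le
  have hay : a ∈ Sarg δ lam (x + r e • d) := by
    refine ⟨ha.1, fun u hu => ?_⟩
    rw [dotZR_add_smul, dotZR_add_smul]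
    by_cases h : dotZR a d < dotZR u d
    · have hpu : 0 < dotZR u d - dotZR a d := sub_pos.2 h
      have hru : r u * (dotZR u d - dotZR a d) = (lam a + dotZR a x) - (lam u + dotZR u x) :=
        div_mul_cancel₀ _ hpu.ne'
      have := mul_le_mul_of_nonneg_right (hmin' u ⟨hu, h⟩) hpu.le
      nlinarith
    · push Not at h
      have := mul_le_mul_of_nonneg_left h hr0
      linarith [ha.2 u hu]
  refine ⟨x + r e • d, e, hay, ?_, ?_, ?_, ?_, ?_, ?_⟩
  · apply Sarg_mem_of_eq hay hb.1
    rw [dotZR_add_smul, dotZR_add_smul, hdb]; linarith [Sarg_eq ha hb]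
  · apply Sarg_mem_of_eq hay hc.1
    rw [dotZR_add_smul, dotZR_add_smul, hdc]; linarith [Sarg_eq ha hc]
  · apply Sarg_mem_of_eq hay he.1
    rw [dotZR_add_smul, dotZR_add_smul]; linarith
  · rintro rfl; exact lt_irrefl _ he.2
  · rintro rfl; have := he.2; linarith
  · rintro rfl; have := he.2; linarith

lemma dvd_det {m : ℤ} {δ : ℕ} {a b c e : Fin 3 → ℤ} {p q : Fin 4} (hpq : p ≠ q)
    (ha1 : m ∣ hcoord δ a p) (ha2 : m ∣ hcoord δ a q)
    (hb1 : m ∣ hcoord δ b p) (hb2 : m ∣ hcoord δ b q)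
    (hc1 : m ∣ hcoord δ c p) (hc2 : m ∣ hcoord δ c q) :
    m ∣ detZ (b - a) (c - a) (e - a) := by
  have k1 := dvd_sub hb1 ha1
  have k2 := dvd_sub hb2 ha2
  have k3 := dvd_sub hc1 ha1
  have k4 := dvd_sub hc2 ha2
  have key : ∀ p q : Fin 4, p < q → m ∣ hcoord δ b p - hcoord δ a p →
      m ∣ hcoord δ b q - hcoord δ a q → m ∣ hcoord δ c p - hcoord δ a p →
      m ∣ hcoord δ c q - hcoord δ a q → m ∣ detZ (b - a) (c - a) (e - a) := by
    clear hpq ha1 ha2 hb1 hb2 hc1 hc2 k1 k2 k3 k4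
    rintro p q hpq ⟨x1, h1⟩ ⟨x2, h2⟩ ⟨x3, h3⟩ ⟨x4, h4⟩
    have hdet : detZ (b - a) (c - a) (e - a) =
        (b 0 - a 0) * ((c 1 - a 1) * (e 2 - a 2) - (c 2 - a 2) * (e 1 - a 1))
        - (b 1 - a 1) * ((c 0 - a 0) * (e 2 - a 2) - (c 2 - a 2) * (e 0 - a 0))
        + (b 2 - a 2) * ((c 0 - a 0) * (e 1 - a 1) - (c 1 - a 1) * (e 0 - a 0)) := by
      simp [detZ, Matrix.det_fin_three]; ring
    rw [hdet]
    have dd : ∀ u0 u1 u2 v0 v1 v2 w0 w1 w2 y1 y2 y3 y4 : ℤ, u0 = m * y1 → u1 = m * y2 →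
        v0 = m * y3 → v1 = m * y4 →
        m ∣ u0 * (v1 * w2 - v2 * w1) - u1 * (v0 * w2 - v2 * w0) + u2 * (v0 * w1 - v1 * w0) := by
      rintro u0 u1 u2 v0 v1 v2 w0 w1 w2 y1 y2 y3 y4 rfl rfl rfl rfl
      exact ⟨y1 * (m * y4 * w2 - v2 * w1) - y2 * (m * y3 * w2 - v2 * w0)
        + u2 * (y3 * w1 - y4 * w0), by ring⟩
    have dd' := fun c0 c1 c2 : Fin 3 => dd (b c0 - a c0) (b c1 - a c1) (b c2 - a c2)
      (c c0 - a c0) (c c1 - a c1) (c c2 - a c2) (e c0 - a c0) (e c1 - a c1) (e c2 - a c2)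
    have ds := fun c0 c2 : Fin 3 => dd (b c0 - a c0) (b 0 - a 0 + (b 1 - a 1) + (b 2 - a 2))
      (b c2 - a c2) (c c0 - a c0) (c 0 - a 0 + (c 1 - a 1) + (c 2 - a 2)) (c c2 - a c2)
      (e c0 - a c0) (e 0 - a 0 + (e 1 - a 1) + (e 2 - a 2)) (e c2 - a c2)
    fin_cases p <;> fin_cases q <;> first | exact absurd hpq (by decide) | skip
    all_goals simp [hcoord] at h1 h2 h3 h4
    · obtain ⟨y, hy⟩ := dd' 0 1 2 x1 x2 x3 x4 h1 h2 h3 h4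
      exact ⟨y, by linear_combination hy⟩
    · obtain ⟨y, hy⟩ := dd' 0 2 1 x1 x2 x3 x4 h1 h2 h3 h4
      exact ⟨-y, by linear_combination -hy⟩
    · obtain ⟨y, hy⟩ := ds 0 2 x1 (-x2) x3 (-x4) h1 (by linarith) h3 (by linarith)
      exact ⟨y, by linear_combination hy⟩
    · obtain ⟨y, hy⟩ := dd' 1 2 0 x1 x2 x3 x4 h1 h2 h3 h4
      exact ⟨y, by linear_combination hy⟩
    · obtain ⟨y, hy⟩ := ds 1 2 x1 (-x2) x3 (-x4) h1 (by linarith) h3 (by linarith)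
      exact ⟨-y, by linear_combination -hy⟩
    · obtain ⟨y, hy⟩ := ds 2 0 x1 (-x2) x3 (-x4) h1 (by linarith) h3 (by linarith)
      exact ⟨-y, by linear_combination -hy⟩
  rcases lt_or_gt_of_ne hpq with h | h
  · exact key p q h k1 k2 k3 k4
  · exact key q p h k2 k1 k4 k3

lemma tri_unit {δ : ℕ} (hδ : 1 ≤ δ) {lam : (Fin 3 → ℤ) → ℝ} (hsm : TropSmooth δ lam) {x : V3}
    {a b c : Fin 3 → ℤ} {m : ℤ} {p q : Fin 4} (hpq : p ≠ q)
    (ha : a ∈ Sarg δ lam x) (hb : b ∈ Sarg δ lam x) (hc : c ∈ Sarg δ lam x)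
    (hab : a ≠ b) (hac : a ≠ c) (hbc : b ≠ c)
    (ha1 : m ∣ hcoord δ a p) (ha2 : m ∣ hcoord δ a q)
    (hb1 : m ∣ hcoord δ b p) (hb2 : m ∣ hcoord δ b q)
    (hc1 : m ∣ hcoord δ c p) (hc2 : m ∣ hcoord δ c q) : m ∣ 1 := by
  obtain ⟨y, e, hay, hby, hcy, hey, hea, heb, hec⟩ := extend_triangle hδ ha hb hc
  have hfin := Sarg_finite δ lam y
  have h4 := four_le_ncard hfin hay hby hcy hey hab hac hea.symm hbc heb.symm hec.symm
  have h4' := Sarg_ncard_le hsm y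
  have hsub : ({a, b, c, e} : Set (Fin 3 → ℤ)) ⊆ Sarg δ lam y := by
    rintro z (rfl | rfl | rfl | rfl) <;> assumption
  have hcard : 4 ≤ ({a, b, c, e} : Set (Fin 3 → ℤ)).ncard :=
    four_le_ncard (Set.toFinite _) (by simp) (by simp) (by simp) (by simp)
      hab hac hea.symm hbc heb.symm hec.symm
  have heq := Set.eq_of_subset_of_ncard_le hsub (by omega) hfin
  have hdet := (hsm y).2 a b c e heq.symm (by omega)
  have hd := dvd_det (e := e) hpq ha1 ha2 hb1 hb2 hc1 hc2
  rw [← hdet]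
  exact (dvd_abs _ _).2 hd

lemma core {δ : ℕ} (hδ : 1 ≤ δ) {lam : (Fin 3 → ℤ) → ℝ} (hsm : TropSmooth δ lam) {x : V3}
    (hcard : (Sarg δ lam x).ncard < 4) {p q : Fin 4} (hpq : p ≠ q)
    (hp : ZPair δ lam x p) (hq : ZPair δ lam x q) {a b : Fin 3 → ℤ} (hab : a ≠ b)
    (ha : a ∈ Sarg δ lam x) (hb : b ∈ Sarg δ lam x)
    (hs : hcoord δ a p + hcoord δ a q = hcoord δ b p + hcoord δ b q) :
    hcoord δ a p + hcoord δ a q ≤ 1 := by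
  by_contra hm
  push Not at hm
  have hfin := Sarg_finite δ lam x
  -- any `c` different from `a` and `b` exhausts the set
  have ex : ∀ c ∈ Sarg δ lam x, c ≠ a → c ≠ b → ∀ z ∈ Sarg δ lam x, z = a ∨ z = b ∨ z = c := by
    intro c hc hca hcb z hz
    by_contra hcon
    push Not at hcon
    have := four_le_ncard hfin ha hb hc hz hab hca.symm hcon.1.symm hcb.symm hcon.2.1.symm
      hcon.2.2.symm
    omega
  obtain ⟨x1, hx1, y1, hy1, hxy1, zx1, zy1⟩ := hp
  obtain ⟨x2, hx2, y2, hy2, hxy2, zx2, zy2⟩ := hq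
  obtain ⟨c, hc, hcp, hcq⟩ : ∃ c ∈ Sarg δ lam x, hcoord δ c p = 0 ∧ hcoord δ c q = 0 := by
    by_cases e1 : x1 = x2
    · exact ⟨x1, hx1, zx1, e1 ▸ zx2⟩
    by_cases e2 : x1 = y2
    · exact ⟨x1, hx1, zx1, e2 ▸ zy2⟩
    by_cases e3 : y1 = x2
    · exact ⟨y1, hy1, zy1, e3 ▸ zx2⟩
    by_cases e4 : y1 = y2
    · exact ⟨y1, hy1, zy1, e4 ▸ zy2⟩
    have := four_le_ncard hfin hx1 hy1 hx2 hy2 hxy1 e1 e2 e3 e4 hxy2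
    omega
  have hca : c ≠ a := by rintro rfl; omega
  have hcb : c ≠ b := by rintro rfl; omega
  have hP : hcoord δ a p = 0 ∨ hcoord δ b p = 0 := by
    rcases ex c hc hca hcb x1 hx1 with h | h | h
    · left; rw [← h]; exact zx1
    · right; rw [← h]; exact zx1
    rcases ex c hc hca hcb y1 hy1 with h' | h' | h'
    · left; rw [← h']; exact zy1
    · right; rw [← h']; exact zy1
    exact absurd (h.trans h'.symm) hxy1
  have hQ : hcoord δ a q = 0 ∨ hcoord δ b q = 0 := by
    rcases ex c hc hca hcb x2 hx2 with h | h | h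
    · left; rw [← h]; exact zx2
    · right; rw [← h]; exact zx2
    rcases ex c hc hca hcb y2 hy2 with h' | h' | h'
    · left; rw [← h']; exact zy2
    · right; rw [← h']; exact zy2
    exact absurd (h.trans h'.symm) hxy2
  have hall : ∀ u v m : ℤ, u + v = m → (u = 0 ∨ v = 0) → m ∣ u ∧ m ∣ v := by
    rintro u v m rfl (h | h) <;> subst h <;> simp
  have hA : hcoord δ a p = 0 ∨ hcoord δ a q = 0 := by omega
  have hB : hcoord δ b p = 0 ∨ hcoord δ b q = 0 := by omega
  obtain ⟨d1, d2⟩ := hall _ _ _ rfl hA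
  obtain ⟨d3, d4⟩ := hall _ _ _ hs.symm hB
  have := tri_unit hδ hsm hpq ha hb hc hab hca.symm hcb.symm d1 d2 d3 d4
    (by rw [hcp]; exact dvd_zero _) (by rw [hcq]; exact dvd_zero _)
  have := Int.le_of_dvd one_pos this
  omega

lemma hcoord_sum4 (δ : ℕ) (a : Fin 3 → ℤ) {i j k l : Fin 4}
    (h : ({i, j, k, l} : Finset (Fin 4)) = Finset.univ) :
    hcoord δ a i + hcoord δ a j + (hcoord δ a k + hcoord δ a l) = δ := by
  have hsum := hcoord_sum δ a
  rw [Fin.sum_univ_four] at hsum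
  revert h
  generalize hcoord δ a = f at *
  fin_cases i <;> fin_cases j <;> fin_cases k <;> fin_cases l <;>
    first
    | (intro h; exact absurd h (by decide))
    | (intro _; simp; linarith)

lemma distinct4 {i j k l : Fin 4} (h : ({i, j, k, l} : Finset (Fin 4)) = Finset.univ) :
    i ≠ j ∧ k ≠ l := by
  revert i j k l; decide

lemma complete4 {p q : Fin 4} (h : p ≠ q) :
    ∃ r s : Fin 4, ({p, q, r, s} : Finset (Fin 4)) = Finset.univ := by
  revert p q; decide

lemma degenerate {δ : ℕ} (hδ : 3 ≤ δ) {lam : (Fin 3 → ℤ) → ℝ} (hsm : TropSmooth δ lam) {x : V3}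
    (hcard : (Sarg δ lam x).ncard < 4) (hZ : ∀ i, ZPair δ lam x i) : False := by
  choose a ha b hb hab hza hzb using hZ
  have hfin := Sarg_finite δ lam x
  have hc : hfin.toFinset.card ≤ 3 := by
    rw [← Set.ncard_eq_toFinset_card _ hfin]; omega
  have hch : (hfin.toFinset.powersetCard 2).card < (Finset.univ : Finset (Fin 4)).card := by
    rw [Finset.card_powersetCard]
    have : hfin.toFinset.card.choose 2 ≤ Nat.choose 3 2 := Nat.choose_le_choose 2 hc
    have h3 : Nat.choose 3 2 = 3 := by decide
    simp; omega
  obtain ⟨p, _, q, _, hpq, hEq⟩ := Finset.exists_ne_map_eq_of_card_lt_of_maps_to hch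
    (f := fun i => ({a i, b i} : Finset (Fin 3 → ℤ))) (by
      intro i _
      simp only [Finset.mem_coe, Finset.mem_powersetCard]
      refine ⟨?_, Finset.card_pair (hab i)⟩
      intro z hz
      simp at hz
      rcases hz with rfl | rfl
      · simpa using ha i
      · simpa using hb i)
  have hEq : ({a p, b p} : Finset (Fin 3 → ℤ)) = {a q, b q} := hEq
  have hq : ∀ z ∈ ({a p, b p} : Finset (Fin 3 → ℤ)), hcoord δ z q = 0 := by
    rw [hEq]; intro z hz
    simp at hz
    rcases hz with rfl | rfl
    · exact hza q
    · exact hzb q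
  have h1 := hq (a p) (by simp)
  have h2 := hq (b p) (by simp)
  have h3 := hza p
  have h4 := hzb p
  obtain ⟨r, s, hrs⟩ := complete4 hpq
  have s1 := hcoord_sum4 δ (a p) hrs
  have s2 := hcoord_sum4 δ (b p) hrs
  have := core (by omega) hsm hcard (distinct4 hrs).2 ⟨_, ha r, _, hb r, hab r, hza r, hzb r⟩
    ⟨_, ha s, _, hb s, hab s, hza s, hzb s⟩ (hab p) (ha p) (hb p) (by omega)
  omega

/-- Any tropical line contained in a smooth tropical surface of degree `δ ≥ 3` passes
through a vertex of the surface: a point `x` with `card S_λ(x) = 4`. -/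
theorem tropical_line_passes_through_vertex (δ : ℕ) (hδ : 3 ≤ δ)
    (lam : (Fin 3 → ℤ) → ℝ) (hsm : TropSmooth δ lam)
    (L : Set V3) (hL : IsTropicalLine L) (hLV : L ⊆ Vtrop δ lam) :
    ∃ x ∈ L, (Sarg δ lam x).ncard = 4 := by
  obtain ⟨v, w, i, j, k, l, ⟨huniv, t, ht, rfl⟩, rfl⟩ := hL
  by_contra hcon
  push Not at hcon
  have hlt : ∀ x ∈ TLine v (v + t • (ωdir k + ωdir l)) i j k l, (Sarg δ lam x).ncard < 4 :=
    fun x hx => lt_of_le_of_ne (Sarg_ncard_le hsm x) (hcon x hx)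
  have si : ray v (ωdir i) ⊆ TLine v (v + t • (ωdir k + ωdir l)) i j k l :=
    fun x hx => Or.inl (Or.inl (Or.inl (Or.inl hx)))
  have sj : ray v (ωdir j) ⊆ TLine v (v + t • (ωdir k + ωdir l)) i j k l :=
    fun x hx => Or.inl (Or.inl (Or.inl (Or.inr hx)))
  have ss : segment ℝ v (v + t • (ωdir k + ωdir l)) ⊆
      TLine v (v + t • (ωdir k + ωdir l)) i j k l :=
    fun x hx => Or.inl (Or.inl (Or.inr hx))
  have sk : ray (v + t • (ωdir k + ωdir l)) (ωdir k) ⊆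
      TLine v (v + t • (ωdir k + ωdir l)) i j k l :=
    fun x hx => Or.inl (Or.inr hx)
  have sl : ray (v + t • (ωdir k + ωdir l)) (ωdir l) ⊆
      TLine v (v + t • (ωdir k + ωdir l)) i j k l :=
    fun x hx => Or.inr hx
  have zi := ray_pair (si.trans hLV) fun x hx => hlt x (si hx)
  have zj := ray_pair (sj.trans hLV) fun x hx => hlt x (sj hx)
  have zk := ray_pair (sk.trans hLV) fun x hx => hlt x (sk hx)
  have zl := ray_pair (sl.trans hLV) fun x hx => hlt x (sl hx)
  have hv := hlt v (ss (left_mem_segment ℝ _ _))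
  have hw := hlt _ (ss (right_mem_segment ℝ _ _))
  obtain ⟨hij, hkl⟩ := distinct4 huniv
  rcases ht.eq_or_lt with rfl | ht
  · rw [zero_smul, add_zero] at zk zl
    refine degenerate hδ hsm hv fun n => ?_
    have hn : n ∈ ({i, j, k, l} : Finset (Fin 4)) := by rw [huniv]; exact Finset.mem_univ n
    simp only [Finset.mem_insert, Finset.mem_singleton] at hn
    rcases hn with rfl | rfl | rfl | rfl <;> assumption
  · have hseg : ∀ u : ℝ, 0 ≤ u → u ≤ t → v + u • (ωdir k + ωdir l) ∈
        segment ℝ v (v + t • (ωdir k + ωdir l)) := by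
      intro u hu hut
      rw [segment_eq_image']
      refine ⟨u / t, ⟨by positivity, (div_le_one ht).2 hut⟩, ?_⟩
      simp only [add_sub_cancel_left, smul_smul]
      rw [div_mul_cancel₀ _ ht.ne']
    obtain ⟨a, b, hab, hd, hav, hbv, haw, hbw⟩ := seg_pair ht
      (fun u h1 h2 => hLV (ss (hseg u h1 h2))) (fun u h1 h2 => hlt _ (ss (hseg u h1 h2)))
    rw [dotZR_add, dotZR_add] at hd
    have e1 := dotZR_omega δ a b k
    have e2 := dotZR_omega δ a b l
    have e3 : hcoord δ a k + hcoord δ a l = hcoord δ b k + hcoord δ b l := by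
      have : (hcoord δ a k : ℝ) + hcoord δ a l = hcoord δ b k + hcoord δ b l := by linarith
      exact_mod_cast this
    have s1 := hcoord_sum4 δ a huniv
    have s2 := hcoord_sum4 δ b huniv
    have c1 := core (by omega) hsm hv hij zi zj hab hav hbv (by omega)
    have c2 := core (by omega) hsm hw hkl zk zl hab haw hbw e3
    omega
end
end

section
/- Let λ : A₂ → ℝ be smooth (degree δ = 2). Among the three diagonal pairs of Γ₂, namely {(1,0,0),(0,1,1)}, {(1,0,1),(0,1,0)}, {(0,0,1),(1,1,0)}, there is exactly one pair {P,P'} for which there exists x ∈ ℝ³ with {P,P'} ⊆ S_λ(x); moreover for this pair the set C = {x ∈ ℝ³ : {P,P'} ⊆ S_λ(x)} is a nonempty compact set (the unique compact 2-cell of the quadric surface). -/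
open scoped BigOperators

noncomputable section

/-- The three diagonal pairs of `Γ₂`. -/
def diag : Fin 3 → (Fin 3 → ℤ) × (Fin 3 → ℤ) :=
  ![(![1, 0, 0], ![0, 1, 1]), (![1, 0, 1], ![0, 1, 0]), (![0, 0, 1], ![1, 1, 0])]

lemma hq_dot (a : Fin 3 → ℤ) (x : V3) :
    dotZR a x = (a 0 : ℝ) * x 0 + a 1 * x 1 + a 2 * x 2 := by
  simp [dotZR, Fin.sum_univ_three]

/-- the affine function `λ(a) + ⟨a - c, x⟩` with `c` the center of `Γ₂` -/
def hqH (lam : (Fin 3 → ℤ) → ℝ) (a : Fin 3 → ℤ) (x : V3) : ℝ :=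
  lam a + dotZR a x - (x 0 + x 1 + x 2) / 2

lemma hqH_cont (lam : (Fin 3 → ℤ) → ℝ) (a : Fin 3 → ℤ) : Continuous (hqH lam a) := by
  unfold hqH dotZR; fun_prop

lemma hqA_fin : (Adelta 2).Finite := by
  apply (Set.Finite.pi' (fun _ : Fin 3 => Set.finite_Icc (0 : ℤ) 2)).subset
  intro a ha
  obtain ⟨h1, h2⟩ := ha
  have h0 := h1 0
  have h3 := h1 1
  have h4 := h1 2
  push_cast at h2
  intro i
  fin_cases i <;> simp [Set.mem_Icc] <;> omega

lemma hq_bdd (lam : (Fin 3 → ℤ) → ℝ) (G : ℝ) :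
    ∃ R : ℝ, ∀ x : V3, (∀ a ∈ Adelta 2, hqH lam a x ≤ G) → x ∈ Metric.closedBall (0 : V3) R := by
  obtain ⟨g, hg⟩ : ∃ g : ℝ, 0 ≤ g ∧ G - lam ![0,0,0] ≤ g ∧ G - lam ![2,0,0] ≤ g ∧
      G - lam ![0,2,0] ≤ g ∧ G - lam ![0,0,2] ≤ g := by
    refine ⟨|G - lam ![0,0,0]| + |G - lam ![2,0,0]| + |G - lam ![0,2,0]| + |G - lam ![0,0,2]|,
      ?_, ?_, ?_, ?_, ?_⟩
    · positivity
    all_goals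
      have h1 := abs_nonneg (G - lam ![0,0,0])
      have h2 := abs_nonneg (G - lam ![2,0,0])
      have h3 := abs_nonneg (G - lam ![0,2,0])
      have h4 := abs_nonneg (G - lam ![0,0,2])
      have h1' := le_abs_self (G - lam ![0,0,0])
      have h2' := le_abs_self (G - lam ![2,0,0])
      have h3' := le_abs_self (G - lam ![0,2,0])
      have h4' := le_abs_self (G - lam ![0,0,2])
      linarith
  obtain ⟨g0, g1, g2, g3, g4⟩ := hg
  refine ⟨10 * g, fun x hx => ?_⟩
  have k1 := hx ![0,0,0] ⟨by intro i; fin_cases i <;> simp, by simp⟩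
  have k2 := hx ![2,0,0] ⟨by intro i; fin_cases i <;> simp, by simp⟩
  have k3 := hx ![0,2,0] ⟨by intro i; fin_cases i <;> simp, by simp⟩
  have k4 := hx ![0,0,2] ⟨by intro i; fin_cases i <;> simp, by simp⟩
  simp [hqH, hq_dot] at k1 k2 k3 k4
  rw [mem_closedBall_zero_iff, pi_norm_le_iff_of_nonneg (by linarith)]
  intro i
  rw [Real.norm_eq_abs, abs_le]
  fin_cases i <;> simp <;> constructor <;> linarith

lemma hq_mem_iff (lam : (Fin 3 → ℤ) → ℝ) (a : Fin 3 → ℤ) (x : V3) :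
    a ∈ Sarg 2 lam x ↔ a ∈ Adelta 2 ∧ ∀ b ∈ Adelta 2, hqH lam b x ≤ hqH lam a x := by
  simp [Sarg, hqH]

lemma hq_diag_mem (k : Fin 3) : (diag k).1 ∈ Adelta 2 ∧ (diag k).2 ∈ Adelta 2 := by
  fin_cases k <;> simp [diag, Adelta, Fin.forall_fin_succ]

lemma hq_diag_sum (lam : (Fin 3 → ℤ) → ℝ) (k : Fin 3) (x : V3) :
    hqH lam (diag k).1 x + hqH lam (diag k).2 x = lam (diag k).1 + lam (diag k).2 := by
  fin_cases k <;> simp [diag, hqH, hq_dot] <;> ring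

lemma hq_compact (lam : (Fin 3 → ℤ) → ℝ) (k : Fin 3) :
    IsCompact {x : V3 | (diag k).1 ∈ Sarg 2 lam x ∧ (diag k).2 ∈ Sarg 2 lam x} := by
  obtain ⟨R, hR⟩ := hq_bdd lam ((lam (diag k).1 + lam (diag k).2) / 2)
  refine (isCompact_closedBall (0 : V3) R).of_isClosed_subset ?_ ?_
  · have : {x : V3 | (diag k).1 ∈ Sarg 2 lam x ∧ (diag k).2 ∈ Sarg 2 lam x} =
      ⋂ b ∈ Adelta 2, ({x | hqH lam b x ≤ hqH lam (diag k).1 x} ∩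
        {x | hqH lam b x ≤ hqH lam (diag k).2 x}) := by
      ext x
      simp only [hq_mem_iff, hq_diag_mem, true_and, Set.mem_ofPred_eq, Set.mem_iInter,
        Set.mem_inter_iff]
      exact ⟨fun h b hb => ⟨h.1 b hb, h.2 b hb⟩,
        fun h => ⟨fun b hb => (h b hb).1, fun b hb => (h b hb).2⟩⟩
    rw [this]
    exact isClosed_biInter fun b _ =>
      (isClosed_le (hqH_cont lam b) (hqH_cont lam _)).inter
        (isClosed_le (hqH_cont lam b) (hqH_cont lam _))
  · rintro x ⟨h1, h2⟩
    rw [hq_mem_iff] at h1 h2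
    apply hR
    intro a ha
    have := hq_diag_sum lam k x
    linarith [h1.2 a ha, h2.2 a ha]

lemma hq_diag_inj : ∀ k l : Fin 3, k ≠ l → ∀ i j : Fin 4,
    ![(diag k).1, (diag k).2, (diag l).1, (diag l).2] i =
      ![(diag k).1, (diag k).2, (diag l).1, (diag l).2] j → i = j := by
  decide

/-- two different diagonals cannot both lie in one argmax set of a smooth `λ` -/
lemma hq_not_both (lam : (Fin 3 → ℤ) → ℝ) (hsm : TropSmooth 2 lam) (x : V3) (k l : Fin 3)
    (hkl : k ≠ l) (h1 : (diag k).1 ∈ Sarg 2 lam x) (h2 : (diag k).2 ∈ Sarg 2 lam x)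
    (h3 : (diag l).1 ∈ Sarg 2 lam x) (h4 : (diag l).2 ∈ Sarg 2 lam x) : False := by
  have hA := (hsm x).1
  let p : Fin 4 → Sarg 2 lam x := ![⟨_, h1⟩, ⟨_, h2⟩, ⟨_, h3⟩, ⟨_, h4⟩]
  have hp : Function.Injective p := by
    intro i j hij
    have e : ∀ i, (p i).1 = ![(diag k).1, (diag k).2, (diag l).1, (diag l).2] i := by
      intro i; fin_cases i <;> rfl
    apply hq_diag_inj k l hkl
    rw [← e, ← e, hij]
  have hB := hA.comp_embedding ⟨p, hp⟩
  rw [affineIndependent_iff] at hB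
  have := hB Finset.univ ![1, 1, -1, -1] (by simp [Fin.sum_univ_four]) (by
    ext i
    clear hB hA
    simp [Fin.sum_univ_four, p, zToR]
    fin_cases k <;> fin_cases l <;> fin_cases i <;> simp [diag]) 0 (by simp)
  simp at this

lemma hq_unique (lam : (Fin 3 → ℤ) → ℝ) (hsm : TropSmooth 2 lam) (k l : Fin 3) (x y : V3)
    (h1 : (diag k).1 ∈ Sarg 2 lam x) (h2 : (diag k).2 ∈ Sarg 2 lam x)
    (h3 : (diag l).1 ∈ Sarg 2 lam y) (h4 : (diag l).2 ∈ Sarg 2 lam y) : k = l := by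
  by_contra hkl
  have g1 := (hq_mem_iff ..).1 h1
  have g2 := (hq_mem_iff ..).1 h2
  have g3 := (hq_mem_iff ..).1 h3
  have g4 := (hq_mem_iff ..).1 h4
  have s1 := hq_diag_sum lam k x
  have s2 := hq_diag_sum lam k y
  have s3 := hq_diag_sum lam l x
  have s4 := hq_diag_sum lam l y
  have a1 := g1.2 _ g3.1
  have a2 := g2.2 _ g4.1
  have a1' := g1.2 _ g4.1
  have a2' := g2.2 _ g3.1
  have b1 := g3.2 _ g1.1
  have b2 := g4.2 _ g2.1
  refine hq_not_both lam hsm x k l hkl h1 h2 ?_ ?_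
  · rw [hq_mem_iff]
    refine ⟨g3.1, fun b hb => ?_⟩
    linarith [g1.2 b hb]
  · rw [hq_mem_iff]
    refine ⟨g4.1, fun b hb => ?_⟩
    linarith [g1.2 b hb]

lemma hq_pair (p q : Fin 3 → ℤ) (hp : p ∈ Adelta 2) (hq : q ∈ Adelta 2)
    (h : ∀ i, p i + q i = 1) : ∃ k, (p = (diag k).1 ∧ q = (diag k).2) ∨
      (q = (diag k).1 ∧ p = (diag k).2) := by
  obtain ⟨p0, p1⟩ := hp
  obtain ⟨q0, q1⟩ := hq
  push_cast at p1 q1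
  have a0 := p0 0
  have a1 := p0 1
  have a2 := p0 2
  have b0 := q0 0
  have b1 := q0 1
  have b2 := q0 2
  have c0 := h 0
  have c1 := h 1
  have c2 := h 2
  simp only [Fin.exists_fin_succ, diag, funext_iff, Fin.forall_fin_succ]
  simp
  omega

lemma hq_cases (n0 n1 n2 n3 : ℤ) (p0 : 0 ≤ n0) (p1 : 0 ≤ n1) (p2 : 0 ≤ n2) (p3 : 0 ≤ n3)
    (hn0 : n0 = 2 - n1 - n2 - n3) :
    (n0 = 2 ∧ n1 = 0 ∧ n2 = 0 ∧ n3 = 0) ∨ (n0 = 0 ∧ n1 = 2 ∧ n2 = 0 ∧ n3 = 0) ∨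
      (n0 = 0 ∧ n1 = 0 ∧ n2 = 2 ∧ n3 = 0) ∨ (n0 = 0 ∧ n1 = 0 ∧ n2 = 0 ∧ n3 = 2) ∨
      (n0 = 1 ∧ n1 = 1 ∧ n2 = 0 ∧ n3 = 0) ∨ (n0 = 1 ∧ n1 = 0 ∧ n2 = 1 ∧ n3 = 0) ∨
      (n0 = 1 ∧ n1 = 0 ∧ n2 = 0 ∧ n3 = 1) ∨ (n0 = 0 ∧ n1 = 1 ∧ n2 = 1 ∧ n3 = 0) ∨
      (n0 = 0 ∧ n1 = 1 ∧ n2 = 0 ∧ n3 = 1) ∨ (n0 = 0 ∧ n1 = 0 ∧ n2 = 1 ∧ n3 = 1) := by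
  have b1 : n1 ≤ 2 := by omega
  have b2 : n2 ≤ 2 := by omega
  have b3 : n3 ≤ 2 := by omega
  interval_cases n1 <;> interval_cases n2 <;> interval_cases n3 <;> simp at hn0 ⊢ <;> omega

/-- arithmetic core: a unimodular lattice tetrahedron containing the center has an edge whose
midpoint is the center -/
lemma hq_tetra (a : Fin 4 → Fin 3 → ℤ) (t : Fin 4 → ℝ) (ht : ∀ i, 0 ≤ t i)
    (hs : t 0 + t 1 + t 2 + t 3 = 1)
    (hc : ∀ i, t 0 * a 0 i + t 1 * a 1 i + t 2 * a 2 i + t 3 * a 3 i = 1 / 2)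
    (hd : |detZ (a 1 - a 0) (a 2 - a 0) (a 3 - a 0)| = 1) :
    ∃ i j, ∀ m, a i m + a j m = 1 := by
  set d := detZ (a 1 - a 0) (a 2 - a 0) (a 3 - a 0) with hdd
  have hd2 : d * d = 1 := by rw [← abs_mul_abs_self, hd]; rfl
  have hd2R : (d : ℝ) * d = 1 := by exact_mod_cast hd2
  let r : Fin 3 → ℤ := fun m => 1 - 2 * a 0 m
  have hdR : (d : ℝ) = ((detZ (a 1 - a 0) (a 2 - a 0) (a 3 - a 0) : ℤ) : ℝ) := rfl
  have e0 := hc 0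
  have e1 := hc 1
  have e2 := hc 2
  have ht0 : t 0 = 1 - t 1 - t 2 - t 3 := by linarith
  rw [ht0] at e0 e1 e2
  have n1 : ∃ n : ℤ, 2 * t 1 = n := by
    refine ⟨d * detZ r (a 2 - a 0) (a 3 - a 0), ?_⟩
    have : 2 * t 1 * d = detZ r (a 2 - a 0) (a 3 - a 0) := by
      rw [hdR]
      simp [detZ, Matrix.det_fin_three, r]
      linear_combination 2 * (((a 2 1 : ℝ) - a 0 1) * ((a 3 2 : ℝ) - a 0 2) - ((a 2 2 : ℝ) - a 0 2) * ((a 3 1 : ℝ) - a 0 1)) * e0 +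
        2 * (((a 2 2 : ℝ) - a 0 2) * ((a 3 0 : ℝ) - a 0 0) - ((a 2 0 : ℝ) - a 0 0) * ((a 3 2 : ℝ) - a 0 2)) * e1 +
        2 * (((a 2 0 : ℝ) - a 0 0) * ((a 3 1 : ℝ) - a 0 1) - ((a 2 1 : ℝ) - a 0 1) * ((a 3 0 : ℝ) - a 0 0)) * e2
    push_cast
    rw [← this]
    linear_combination (-2 * t 1) * hd2R
  have n2 : ∃ n : ℤ, 2 * t 2 = n := by
    refine ⟨d * detZ (a 1 - a 0) r (a 3 - a 0), ?_⟩
    have : 2 * t 2 * d = detZ (a 1 - a 0) r (a 3 - a 0) := by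
      rw [hdR]
      simp [detZ, Matrix.det_fin_three, r]
      linear_combination 2 * (((a 3 1 : ℝ) - a 0 1) * ((a 1 2 : ℝ) - a 0 2) - ((a 3 2 : ℝ) - a 0 2) * ((a 1 1 : ℝ) - a 0 1)) * e0 +
        2 * (((a 3 2 : ℝ) - a 0 2) * ((a 1 0 : ℝ) - a 0 0) - ((a 3 0 : ℝ) - a 0 0) * ((a 1 2 : ℝ) - a 0 2)) * e1 +
        2 * (((a 3 0 : ℝ) - a 0 0) * ((a 1 1 : ℝ) - a 0 1) - ((a 3 1 : ℝ) - a 0 1) * ((a 1 0 : ℝ) - a 0 0)) * e2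
    push_cast
    rw [← this]
    linear_combination (-2 * t 2) * hd2R
  have n3 : ∃ n : ℤ, 2 * t 3 = n := by
    refine ⟨d * detZ (a 1 - a 0) (a 2 - a 0) r, ?_⟩
    have : 2 * t 3 * d = detZ (a 1 - a 0) (a 2 - a 0) r := by
      rw [hdR]
      simp [detZ, Matrix.det_fin_three, r]
      linear_combination 2 * (((a 1 1 : ℝ) - a 0 1) * ((a 2 2 : ℝ) - a 0 2) - ((a 1 2 : ℝ) - a 0 2) * ((a 2 1 : ℝ) - a 0 1)) * e0 +
        2 * (((a 1 2 : ℝ) - a 0 2) * ((a 2 0 : ℝ) - a 0 0) - ((a 1 0 : ℝ) - a 0 0) * ((a 2 2 : ℝ) - a 0 2)) * e1 +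
        2 * (((a 1 0 : ℝ) - a 0 0) * ((a 2 1 : ℝ) - a 0 1) - ((a 1 1 : ℝ) - a 0 1) * ((a 2 0 : ℝ) - a 0 0)) * e2
    push_cast
    rw [← this]
    linear_combination (-2 * t 3) * hd2R
  obtain ⟨n1, h1⟩ := n1
  obtain ⟨n2, h2⟩ := n2
  obtain ⟨n3, h3⟩ := n3
  have h0 : 2 * t 0 = ((2 - n1 - n2 - n3 : ℤ) : ℝ) := by push_cast; linarith
  obtain ⟨n0, hn0⟩ : ∃ n0, n0 = 2 - n1 - n2 - n3 := ⟨_, rfl⟩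
  rw [← hn0] at h0
  have p0 : 0 ≤ n0 := by have := ht 0; exact_mod_cast (by linarith : (0 : ℝ) ≤ n0)
  have p1 : 0 ≤ n1 := by have := ht 1; exact_mod_cast (by linarith : (0 : ℝ) ≤ n1)
  have p2 : 0 ≤ n2 := by have := ht 2; exact_mod_cast (by linarith : (0 : ℝ) ≤ n2)
  have p3 : 0 ≤ n3 := by have := ht 3; exact_mod_cast (by linarith : (0 : ℝ) ≤ n3)
  have hcZ : ∀ m, n0 * a 0 m + n1 * a 1 m + n2 * a 2 m + n3 * a 3 m = 1 := by
    intro m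
    have := hc m
    have : (n0 : ℝ) * a 0 m + n1 * a 1 m + n2 * a 2 m + n3 * a 3 m = 1 := by
      rw [← h0, ← h1, ← h2, ← h3]; linarith
    exact_mod_cast this
  have hcases := hq_cases n0 n1 n2 n3 p0 p1 p2 p3 hn0
  clear h0 h1 h2 h3
  rcases hcases with h | h | h | h | h | h | h | h | h | h <;>
    obtain ⟨rfl, rfl, rfl, rfl⟩ := h
  · have := hcZ 0; omega
  · have := hcZ 0; omega
  · have := hcZ 0; omega
  · have := hcZ 0; omega
  · exact ⟨0, 1, fun m => by have := hcZ m; omega⟩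
  · exact ⟨0, 2, fun m => by have := hcZ m; omega⟩
  · exact ⟨0, 3, fun m => by have := hcZ m; omega⟩
  · exact ⟨1, 2, fun m => by have := hcZ m; omega⟩
  · exact ⟨1, 3, fun m => by have := hcZ m; omega⟩
  · exact ⟨2, 3, fun m => by have := hcZ m; omega⟩

lemma hqH_add (lam : (Fin 3 → ℤ) → ℝ) (a : Fin 3 → ℤ) (x v : V3) (e : ℝ) :
    hqH lam a (x + e • v) = hqH lam a x + e * (dotZR a v - (v 0 + v 1 + v 2) / 2) := by
  simp [hqH, hq_dot]; ring

lemma hq_fun (φ : V3 →ₗ[ℝ] ℝ) : ∃ v : V3, ∀ y : V3, φ y = y 0 * v 0 + y 1 * v 1 + y 2 * v 2 := by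
  refine ⟨fun i => φ (fun j => if i = j then 1 else 0), fun y => ?_⟩
  rw [LinearMap.pi_apply_eq_sum_univ φ y, Fin.sum_univ_three]
  simp

lemma hq_min (lam : (Fin 3 → ℤ) → ℝ) : ∃ (x : V3) (m : ℝ),
    (∀ a ∈ Adelta 2, hqH lam a x ≤ m) ∧
    (∀ y : V3, ¬ ∀ a ∈ Adelta 2, hqH lam a y < m) ∧
    (∀ v : V3, (∀ a ∈ Adelta 2, hqH lam a (x + v) ≤ m) → (∀ a ∈ Adelta 2, hqH lam a (x - v) ≤ m) →
      v = 0) := by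
  classical
  let A := hqA_fin.toFinset
  have hA : A.Nonempty := ⟨0, by simp [A, Adelta]⟩
  let g : V3 → ℝ := fun x => A.sup' hA (fun a => hqH lam a x)
  have hgle : ∀ x m, g x ≤ m ↔ ∀ a ∈ Adelta 2, hqH lam a x ≤ m := by
    intro x m; simp [g, A, Finset.sup'_le_iff]
  have hglt : ∀ x m, g x < m ↔ ∀ a ∈ Adelta 2, hqH lam a x < m := by
    intro x m; simp [g, A, Finset.sup'_lt_iff]
  have hgc : Continuous g := by
    apply Continuous.finset_sup'_apply
    exact fun a _ => hqH_cont lam a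
  obtain ⟨R, hR⟩ := hq_bdd lam (g 0)
  have hcomp : IsCompact {x | g x ≤ g 0} :=
    (isCompact_closedBall (0 : V3) R).of_isClosed_subset (isClosed_le hgc continuous_const)
      (fun x hx => hR x ((hgle _ _).1 hx))
  obtain ⟨x0, hx0, hmin⟩ := hcomp.exists_isMinOn ⟨0, le_refl (g 0)⟩ hgc.continuousOn
  have hmin' : ∀ y, g x0 ≤ g y := by
    intro y
    by_cases hy : g y ≤ g 0
    · exact hmin hy
    · exact le_trans hx0 (not_le.1 hy).le
  have hcomp2 : IsCompact {x | g x ≤ g x0} :=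
    hcomp.of_isClosed_subset (isClosed_le hgc continuous_const)
      (fun x (hx : g x ≤ g x0) => (le_trans hx hx0 : g x ≤ g 0))
  obtain ⟨x, hx⟩ := hcomp2.extremePoints_nonempty ⟨x0, le_refl (g x0)⟩
  refine ⟨x, g x0, (hgle _ _).1 hx.1, fun y hy => ?_, fun v h1 h2 => ?_⟩
  · exact absurd ((hglt _ _).2 hy) (not_lt.2 (hmin' y))
  · have := hx.2 ((hgle _ _).2 h1) ((hgle _ _).2 h2) ⟨1/2, 1/2, by norm_num, by norm_num, by norm_num, by
      ext i; simp; ring⟩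
    simpa using this

lemma hq_exists (lam : (Fin 3 → ℤ) → ℝ) (hsm : TropSmooth 2 lam) :
    ∃ k : Fin 3, ∃ x : V3, (diag k).1 ∈ Sarg 2 lam x ∧ (diag k).2 ∈ Sarg 2 lam x := by
  obtain ⟨x, m, hle, hnlt, hext⟩ := hq_min lam
  have hS : ∀ a, a ∈ Sarg 2 lam x ↔ a ∈ Adelta 2 ∧ hqH lam a x = m := by
    intro a
    rw [hq_mem_iff]
    constructor
    · rintro ⟨h1, h2⟩
      refine ⟨h1, le_antisymm (hle a h1) ?_⟩
      by_contra hlt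
      exact hnlt x fun b hb => lt_of_le_of_lt (h2 b hb) (not_le.1 hlt)
    · rintro ⟨h1, h2⟩
      exact ⟨h1, fun b hb => h2 ▸ hle b hb⟩
  have hSfin : (Sarg 2 lam x).Finite := hqA_fin.subset fun a ha => ha.1
  have hstrict : ∀ a ∈ Adelta 2, a ∉ Sarg 2 lam x → hqH lam a x < m := by
    intro a ha hn
    refine lt_of_le_of_ne (hle a ha) fun h => hn ((hS a).2 ⟨ha, h⟩)
  have hev : ∀ v : V3, ∀ a ∈ Adelta 2, a ∉ Sarg 2 lam x →
      ∀ᶠ e : ℝ in nhds 0, hqH lam a (x + e • v) < m := by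
    intro v a ha hn
    have hc : Continuous fun e : ℝ => hqH lam a (x + e • v) :=
      (hqH_cont lam a).comp (by fun_prop)
    exact hc.continuousAt.eventually_lt continuousAt_const (by simpa using hstrict a ha hn)
  let c : V3 := fun _ => 1 / 2
  have hc : c ∈ convexHull ℝ (zToR '' Sarg 2 lam x) := by
    by_contra hcn
    obtain ⟨φ, u, h1, h2⟩ := geometric_hahn_banach_closed_point (convex_convexHull ℝ _)
      ((hSfin.image zToR).isCompact_convexHull (𝕜 := ℝ)).isClosed hcn
    obtain ⟨v, hv⟩ := hq_fun φ.toLinearMap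
    have hvc : u < (v 0 + v 1 + v 2) / 2 := by
      have := hv c
      simp only [ContinuousLinearMap.coe_coe, c] at this h2
      linarith
    have key : ∀ᶠ e : ℝ in nhdsWithin 0 (Set.Ioi 0), ∀ a ∈ Adelta 2, hqH lam a (x + e • v) < m := by
      rw [Filter.eventually_all_finite hqA_fin]
      intro a ha
      by_cases haS : a ∈ Sarg 2 lam x
      · filter_upwards [self_mem_nhdsWithin] with e he
        have he : 0 < e := he
        have h3 := h1 _ (subset_convexHull ℝ _ (Set.mem_image_of_mem zToR haS))
        have h4 := hv (zToR a)
        simp only [ContinuousLinearMap.coe_coe] at h4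
        rw [hqH_add, ((hS a).1 haS).2, hq_dot]
        simp only [zToR] at h4
        have : e * ((a 0 : ℝ) * v 0 + a 1 * v 1 + a 2 * v 2 - (v 0 + v 1 + v 2) / 2) < 0 :=
          mul_neg_of_pos_of_neg he (by
            rw [← h4]
            have h3 : φ (fun i => (a i : ℝ)) < u := h3
            linarith)
        linarith
      · exact nhdsWithin_le_nhds (hev v a ha haS)
    obtain ⟨e, he⟩ := key.exists
    exact hnlt _ he
  have hcard : (Sarg 2 lam x).ncard = 4 := by
    have hne : (Sarg 2 lam x).Nonempty := by
      have : (convexHull ℝ (zToR '' Sarg 2 lam x)).Nonempty := ⟨c, hc⟩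
      rw [convexHull_nonempty_iff] at this
      exact Set.image_nonempty.1 this
    have := hSfin.fintype
    have hpos : 0 < (Sarg 2 lam x).ncard := (Set.ncard_pos hSfin).2 hne
    have hfr := (hsm x).1.finrank_vectorSpan (n := (Sarg 2 lam x).ncard - 1) (by
      rw [← Nat.card_eq_fintype_card, Nat.card_coe_set_eq]; omega)
    have hrange : Set.range (fun a : Sarg 2 lam x => zToR a.1) = zToR '' Sarg 2 lam x := by
      rw [Set.image_eq_range]
    rw [hrange] at hfr
    have hle3 := Submodule.finrank_le (vectorSpan ℝ (zToR '' Sarg 2 lam x))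
    have h3 : Module.finrank ℝ V3 = 3 := by simp
    rw [h3] at hle3
    by_contra hn4
    have hlt : vectorSpan ℝ (zToR '' Sarg 2 lam x) < ⊤ := by
      rw [lt_top_iff_ne_top]
      intro htop
      rw [htop, finrank_top, h3] at hfr
      omega
    obtain ⟨φ, hφ0, hφ⟩ := Submodule.exists_le_ker_of_lt_top _ hlt
    obtain ⟨v, hv⟩ := hq_fun φ
    have hzero : ∀ a ∈ Sarg 2 lam x, dotZR a v - (v 0 + v 1 + v 2) / 2 = 0 := by
      intro a ha
      have m1 : zToR a ∈ affineSpan ℝ (zToR '' Sarg 2 lam x) :=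
        subset_affineSpan ℝ _ (Set.mem_image_of_mem zToR ha)
      have m2 : c ∈ affineSpan ℝ (zToR '' Sarg 2 lam x) := convexHull_subset_affineSpan _ hc
      have m3 := AffineSubspace.vsub_mem_direction m1 m2
      rw [direction_affineSpan] at m3
      have m4 : φ (zToR a - c) = 0 := hφ m3
      rw [hv] at m4
      simp only [Pi.sub_apply, zToR, c] at m4
      rw [hq_dot]
      linarith
    have key : ∀ w : V3, (∀ a ∈ Sarg 2 lam x, dotZR a w - (w 0 + w 1 + w 2) / 2 = 0) →
        ∀ᶠ e : ℝ in nhdsWithin 0 (Set.Ioi 0), ∀ a ∈ Adelta 2, hqH lam a (x + e • w) ≤ m := by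
      intro w hw
      rw [Filter.eventually_all_finite hqA_fin]
      intro a ha
      by_cases haS : a ∈ Sarg 2 lam x
      · refine Filter.Eventually.of_forall fun e => ?_
        rw [hqH_add, hw a haS, ((hS a).1 haS).2]; simp
      · exact nhdsWithin_le_nhds ((hev w a ha haS).mono fun e he => le_of_lt he)
    have k1 := key v hzero
    have k2 := key (-v) (by
      intro a ha
      have := hzero a ha
      rw [hq_dot] at this ⊢
      simp only [Pi.neg_apply]
      linarith)
    obtain ⟨e, ⟨⟨e1, e2⟩, e3⟩⟩ := ((k1.and k2).and self_mem_nhdsWithin).exists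
    have e3 : 0 < e := e3
    have hz := hext (e • v) e1 (by
      intro a ha
      have := e2 a ha
      rwa [smul_neg, ← sub_eq_add_neg] at this)
    have hv0 : v = 0 := (smul_eq_zero.1 hz).resolve_left e3.ne'
    apply hφ0
    ext i
    simp [hv, hv0]
  obtain ⟨a, ha⟩ : ∃ a : Fin 4 → Fin 3 → ℤ, Set.range a = Sarg 2 lam x := by
    have hnc : Nat.card (Sarg 2 lam x) = 4 := by rw [Nat.card_coe_set_eq, hcard]
    have : Finite (Sarg 2 lam x) := hSfin
    let eq := (Finite.equivFinOfCardEq hnc).symm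
    refine ⟨fun i => (eq i).1, ?_⟩
    ext y
    constructor
    · rintro ⟨i, rfl⟩; exact (eq i).2
    · intro hy; exact ⟨eq.symm ⟨y, hy⟩, by simp⟩
  have haS : ∀ i, a i ∈ Sarg 2 lam x := fun i => ha ▸ Set.mem_range_self i
  have hdet := (hsm x).2 (a 0) (a 1) (a 2) (a 3) (by
    rw [← ha]; ext y; simp [Fin.exists_fin_succ, eq_comm]) hcard
  have himg : zToR '' Sarg 2 lam x = {zToR (a 0), zToR (a 1), zToR (a 2), zToR (a 3)} := by
    rw [← ha]; ext y; simp [Fin.exists_fin_succ, eq_comm]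
  rw [himg] at hc
  obtain ⟨t, ht, hs, hct⟩ : ∃ t : Fin 4 → ℝ, (∀ i, 0 ≤ t i) ∧ t 0 + t 1 + t 2 + t 3 = 1 ∧
      ∀ i, t 0 * a 0 i + t 1 * a 1 i + t 2 * a 2 i + t 3 * a 3 i = 1 / 2 := by
    rw [convexHull_insert (by simp), convexHull_insert (by simp), convexHull_pair] at hc
    simp only [mem_convexJoin, Set.mem_singleton_iff, exists_eq_left, segment, Set.mem_ofPred_eq] at hc
    obtain ⟨y, ⟨z, ⟨p1, q1, hp1, hq1, hpq1, rfl⟩, p2, q2, hp2, hq2, hpq2, rfl⟩, p3, q3, hp3, hq3,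
      hpq3, hh⟩ := hc
    refine ⟨![p3, q3 * p2, q3 * (q2 * p1), q3 * (q2 * q1)], ?_, ?_, ?_⟩
    · intro i; fin_cases i <;> simp <;> positivity
    · simp
      linear_combination q3 * q2 * hpq1 + q3 * hpq2 + hpq3
    · intro i
      have := congrFun hh i
      simp [zToR, c] at this ⊢
      linear_combination this
  obtain ⟨i, j, hij⟩ := hq_tetra a t ht hs hct hdet
  obtain ⟨k, hk | hk⟩ := hq_pair (a i) (a j) (haS i).1 (haS j).1 hij
  · exact ⟨k, x, hk.1 ▸ haS i, hk.2 ▸ haS j⟩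
  · exact ⟨k, x, hk.1 ▸ haS j, hk.2 ▸ haS i⟩

/-- For a smooth tropical quadric surface, exactly one of the three diagonal pairs
`{P,P'}` of `Γ₂` arises as a subset of some argmax set `S_λ(x)`, and for this pair the
dual cell `C = {x : {P,P'} ⊆ S_λ(x)}` is nonempty and compact (the unique compact
2-cell of the quadric). -/
theorem quadric_unique_compact_cell (lam : (Fin 3 → ℤ) → ℝ) (hsm : TropSmooth 2 lam) :
    (∃! k : Fin 3, ∃ x : V3, (diag k).1 ∈ Sarg 2 lam x ∧ (diag k).2 ∈ Sarg 2 lam x) ∧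
    ∀ k : Fin 3, (∃ x : V3, (diag k).1 ∈ Sarg 2 lam x ∧ (diag k).2 ∈ Sarg 2 lam x) →
      ({x : V3 | (diag k).1 ∈ Sarg 2 lam x ∧ (diag k).2 ∈ Sarg 2 lam x}.Nonempty ∧
        IsCompact {x : V3 | (diag k).1 ∈ Sarg 2 lam x ∧ (diag k).2 ∈ Sarg 2 lam x}) := by
  obtain ⟨k, x, h1, h2⟩ := hq_exists lam hsm
  refine ⟨⟨k, ⟨x, h1, h2⟩, ?_⟩, fun k hk => ⟨hk, hq_compact lam k⟩⟩
  rintro l ⟨y, h3, h4⟩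
  exact hq_unique lam hsm l k y x h3 h4 h1 h2
end
end

section
/- Let λ : A₂ → ℝ be smooth (degree δ = 2), let {P,P'} be one of the three diagonal pairs {(1,0,0),(0,1,1)}, {(1,0,1),(0,1,0)}, {(0,0,1),(1,1,0)} of Γ₂, and suppose there exists x₀ ∈ ℝ³ with {P,P'} ⊆ S_λ(x₀). Let C = {x ∈ ℝ³ : {P,P'} ⊆ S_λ(x)}. Then for every point p ∈ C there exist two distinct tropical lines L₁ ≠ L₂ with L₁ ⊆ V(λ), L₂ ⊆ V(λ), and p ∈ L₁ ∩ L₂. -/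
open scoped BigOperators

noncomputable section

/-- Unit vectors, with the fourth one equal to zero. -/
def Evec : Fin 4 → (Fin 3 → ℤ) := ![![1, 0, 0], ![0, 1, 0], ![0, 0, 1], ![0, 0, 0]]

/-- Homogeneous coordinates. -/
def Yc (a : Fin 4) (x : V3) : ℝ := dotZR (Evec a) x

/-- Value of the monomial indexed by `a, b`. -/
def Wv (lam : (Fin 3 → ℤ) → ℝ) (a b : Fin 4) (x : V3) : ℝ :=
  lam (Evec a + Evec b) + Yc a x + Yc b x

/-- The monomial indexed by `a, b` is maximal at `x`. -/
def Mx (lam : (Fin 3 → ℤ) → ℝ) (a b : Fin 4) (x : V3) : Prop :=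
  ∀ c d, Wv lam c d x ≤ Wv lam a b x

/-- `i, j, k, l` is a permutation of the four indices. -/
def Pm (i j k l : Fin 4) : Prop := ({i, j, k, l} : Finset (Fin 4)) = Finset.univ

instance (i j k l : Fin 4) : Decidable (Pm i j k l) := by unfold Pm; infer_instance

set_option linter.unusedSimpArgs false

lemma Pm.ne {i j k l : Fin 4} : Pm i j k l →
    (i ≠ j ∧ i ≠ k ∧ i ≠ l ∧ j ≠ k ∧ j ≠ l ∧ k ≠ l) := by
  revert i j k l; decide

lemma Pm.cover {i j k l : Fin 4} (h : Pm i j k l) (c : Fin 4) :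
    c = i ∨ c = j ∨ c = k ∨ c = l := by
  have : c ∈ ({i, j, k, l} : Finset (Fin 4)) := by rw [h]; simp
  simpa using this

lemma Evec_inj : ∀ a b c d : Fin 4, Evec a + Evec b = Evec c + Evec d →
    (a = c ∧ b = d) ∨ (a = d ∧ b = c) := by
  unfold Evec; decide

lemma mem_Adelta_E (a b : Fin 4) : Evec a + Evec b ∈ Adelta 2 := by
  unfold Adelta
  simp only [Set.mem_ofPred_eq]
  revert a b; unfold Evec; decide

lemma Adelta_exists {x : Fin 3 → ℤ} (hx : x ∈ Adelta 2) : ∃ a b, x = Evec a + Evec b := by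
  obtain ⟨h, hs⟩ := hx
  have h0 := h 0
  have h1 := h 1
  have h2 := h 2
  push_cast at hs
  have key : ∀ a b, (x 0 = (Evec a + Evec b) 0 ∧ x 1 = (Evec a + Evec b) 1 ∧
      x 2 = (Evec a + Evec b) 2) → ∃ a b, x = Evec a + Evec b := by
    rintro a b ⟨u, v, w⟩
    refine ⟨a, b, ?_⟩
    funext i
    fin_cases i
    · exact u
    · exact v
    · exact w
  have : (x 0 = 0 ∧ x 1 = 0 ∧ x 2 = 0) ∨ (x 0 = 1 ∧ x 1 = 0 ∧ x 2 = 0) ∨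
      (x 0 = 0 ∧ x 1 = 1 ∧ x 2 = 0) ∨ (x 0 = 0 ∧ x 1 = 0 ∧ x 2 = 1) ∨
      (x 0 = 2 ∧ x 1 = 0 ∧ x 2 = 0) ∨ (x 0 = 0 ∧ x 1 = 2 ∧ x 2 = 0) ∨
      (x 0 = 0 ∧ x 1 = 0 ∧ x 2 = 2) ∨ (x 0 = 1 ∧ x 1 = 1 ∧ x 2 = 0) ∨
      (x 0 = 1 ∧ x 1 = 0 ∧ x 2 = 1) ∨ (x 0 = 0 ∧ x 1 = 1 ∧ x 2 = 1) := by omega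
  rcases this with t | t | t | t | t | t | t | t | t | t
  · exact key 3 3 (by simpa [Evec] using t)
  · exact key 0 3 (by simpa [Evec] using t)
  · exact key 1 3 (by simpa [Evec] using t)
  · exact key 2 3 (by simpa [Evec] using t)
  · exact key 0 0 (by simpa [Evec] using t)
  · exact key 1 1 (by simpa [Evec] using t)
  · exact key 2 2 (by simpa [Evec] using t)
  · exact key 0 1 (by simpa [Evec] using t)
  · exact key 0 2 (by simpa [Evec] using t)
  · exact key 1 2 (by simpa [Evec] using t)

lemma dot_E (a b : Fin 4) (x : V3) : dotZR (Evec a + Evec b) x = Yc a x + Yc b x := by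
  simp only [Yc, dotZR, ← Finset.sum_add_distrib]
  refine Finset.sum_congr rfl fun i _ => ?_
  simp only [Pi.add_apply]; push_cast; ring

lemma Mx_iff (lam : (Fin 3 → ℤ) → ℝ) (a b : Fin 4) (x : V3) :
    Evec a + Evec b ∈ Sarg 2 lam x ↔ Mx lam a b x := by
  constructor
  · rintro ⟨_, h⟩ c d
    have := h _ (mem_Adelta_E c d)
    rw [dot_E, dot_E] at this
    unfold Wv; linarith
  · intro h
    refine ⟨mem_Adelta_E a b, fun c hc => ?_⟩
    obtain ⟨c, d, rfl⟩ := Adelta_exists hc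
    have := h c d
    unfold Wv at this
    rw [dot_E, dot_E]; linarith

lemma Wv_comm (lam : (Fin 3 → ℤ) → ℝ) (a b : Fin 4) (x : V3) : Wv lam a b x = Wv lam b a x := by
  unfold Wv; rw [add_comm (Evec a)]; ring

lemma Mx.symm {lam : (Fin 3 → ℤ) → ℝ} {a b : Fin 4} {x : V3} (h : Mx lam a b x) :
    Mx lam b a x := by
  intro c d; rw [Wv_comm lam b a]; exact h c d

lemma Yc_add (a : Fin 4) (x y : V3) : Yc a (x + y) = Yc a x + Yc a y := by
  simp only [Yc, dotZR, ← Finset.sum_add_distrib, Pi.add_apply, mul_add]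

lemma Yc_smul (a : Fin 4) (t : ℝ) (x : V3) : Yc a (t • x) = t * Yc a x := by
  simp only [Yc, dotZR, Finset.mul_sum, Pi.smul_apply, smul_eq_mul]
  exact Finset.sum_congr rfl fun i _ => by ring

/-- Common shift of the homogeneous coordinates. -/
def tau (m : Fin 4) : ℝ := if m = 3 then 1 else 0

lemma Yc_ω (a m : Fin 4) : Yc a (ωdir m) = tau m - if a = m then 1 else 0 := by
  fin_cases a <;> fin_cases m <;> simp [Yc, dotZR, Evec, ωdir, tau, Fin.sum_univ_three]

lemma ω_sum {i j k l : Fin 4} (h : Pm i j k l) : ωdir i + ωdir j + ωdir k + ωdir l = 0 := by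
  have h0 : ∑ m, ωdir m = 0 := by
    funext r
    fin_cases r <;> simp [Fin.sum_univ_four, ωdir]
  obtain ⟨h1, h2, h3, h4, h5, h6⟩ := h.ne
  unfold Pm at h
  rw [← h, Finset.sum_insert (by simp [*]), Finset.sum_insert (by simp [*]),
    Finset.sum_insert (by simp [*]), Finset.sum_singleton] at h0
  rw [← h0]; abel

/-- Moving away along `ω_m` keeps a maximal monomial not involving `m` maximal. -/
lemma Mx.ray {lam : (Fin 3 → ℤ) → ℝ} {a b m : Fin 4} {v : V3} (h : Mx lam a b v)
    (ha : a ≠ m) (hb : b ≠ m) {t : ℝ} (ht : 0 ≤ t) : Mx lam a b (v + t • ωdir m) := by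
  intro c d
  have := h c d
  simp only [Wv, Yc_add, Yc_smul, Yc_ω, ha, hb, if_false] at this ⊢
  split_ifs <;> linarith

lemma Mx.seg {lam : (Fin 3 → ℤ) → ℝ} {a b : Fin 4} {v w x : V3} (hv : Mx lam a b v)
    (hw : Mx lam a b w) (hx : x ∈ segment ℝ v w) : Mx lam a b x := by
  obtain ⟨r, s, hr, hs, hrs, rfl⟩ := hx
  intro c d
  have h1 := mul_le_mul_of_nonneg_left (hv c d) hr
  have h2 := mul_le_mul_of_nonneg_left (hw c d) hs
  simp only [Wv, Yc_add, Yc_smul] at h1 h2 ⊢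
  have e1 : lam (Evec c + Evec d) = r * lam (Evec c + Evec d) + s * lam (Evec c + Evec d) := by
    rw [← add_mul, hrs, one_mul]
  have e2 : lam (Evec a + Evec b) = r * lam (Evec a + Evec b) + s * lam (Evec a + Evec b) := by
    rw [← add_mul, hrs, one_mul]
  linarith

lemma Mx.two {lam : (Fin 3 → ℤ) → ℝ} {a b c d : Fin 4} {x : V3} (h : Mx lam a b x)
    (h' : Mx lam c d x) (h1 : a ≠ c) (h2 : a ≠ d) : x ∈ Vtrop 2 lam := by
  refine ⟨_, (Mx_iff lam a b x).2 h, _, (Mx_iff lam c d x).2 h', fun e => ?_⟩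
  rcases Evec_inj _ _ _ _ e with e | e
  · exact h1 e.1
  · exact h2 e.1

/-- The index pairs supported on `{j, l}`. -/
def Prs (j l : Fin 4) : Finset (Fin 4 × Fin 4) := {(j, l), (j, j), (l, l)}

lemma half {lam : (Fin 3 → ℤ) → ℝ} {i j k l : Fin 4} {p : V3} (hP : Pm i j k l)
    (h1 : Mx lam i j p) (h2 : Mx lam k l p) :
    ∃ s : ℝ, 0 ≤ s ∧ Mx lam i j (p + s • (ωdir i + ωdir k)) ∧
      Mx lam k l (p + s • (ωdir i + ωdir k)) ∧
      ∃ q ∈ Prs j l, Mx lam q.1 q.2 (p + s • (ωdir i + ωdir k)) := by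
  obtain ⟨n1, n2, n3, n4, n5, n6⟩ := hP.ne
  have hg : Wv lam i j p = Wv lam k l p := le_antisymm (h2 _ _) (h1 _ _)
  obtain ⟨q, hq, hmax⟩ := Finset.exists_max_image (Prs j l) (fun q => Wv lam q.1 q.2 p)
    ⟨(j, l), by simp [Prs]⟩
  have m1 := hmax (j, l) (by simp [Prs])
  have m2 := hmax (j, j) (by simp [Prs])
  have m3 := hmax (l, l) (by simp [Prs])
  have m4 := Wv_comm lam l j p
  simp only at m1 m2 m3
  have hs : 0 ≤ Wv lam i j p - Wv lam q.1 q.2 p := sub_nonneg.2 (h1 _ _)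
  set s := Wv lam i j p - Wv lam q.1 q.2 p with hsdef
  have hW : ∀ a b, Wv lam a b (p + s • (ωdir i + ωdir k)) = Wv lam a b p
      + 2 * s * (tau i + tau k) - s * ((if a = i then 1 else 0) + (if a = k then 1 else 0)
        + (if b = i then 1 else 0) + (if b = k then 1 else 0)) := by
    intro a b
    simp only [Wv, Yc_add, Yc_smul, Yc_ω]; ring
  have hub : ∀ a b, Wv lam a b (p + s • (ωdir i + ωdir k)) ≤
      Wv lam i j p + 2 * s * (tau i + tau k) - s := by
    intro a b
    have hab := h1 a b
    rw [hW]
    rcases hP.cover a with rfl | rfl | rfl | rfl <;> rcases hP.cover b with rfl | rfl | rfl | rfl <;>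
      simp [*, Ne.symm, n1.symm, n2.symm, n3.symm, n4.symm, n5.symm, n6.symm, -tsub_le_iff_right] <;>
      linarith
  refine ⟨s, hs, fun c d => (hub c d).trans ?_, fun c d => (hub c d).trans ?_, q, hq,
    fun c d => (hub c d).trans ?_⟩
  · rw [hW]; simp [n1, n2, n1.symm, n4]
  · rw [hW]; simp [n2.symm, n3.symm, n6.symm, hg]
  · rw [hW]
    simp only [Prs, Finset.mem_insert, Finset.mem_singleton] at hq
    rcases hq with e | e | e <;>
      simp [e, n1.symm, n3.symm, n4, n6.symm] <;> simp [e] at hsdef <;> linarith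

lemma rays_sub {lam : (Fin 3 → ℤ) → ℝ} {i j k l : Fin 4} {v : V3} (hP : Pm i j k l)
    (h1 : Mx lam i j v) (h2 : Mx lam k l v) {q : Fin 4 × Fin 4} (hq : q ∈ Prs j l)
    (h3 : Mx lam q.1 q.2 v) : ray v (ωdir i) ⊆ Vtrop 2 lam ∧ ray v (ωdir k) ⊆ Vtrop 2 lam := by
  obtain ⟨n1, n2, n3, n4, n5, n6⟩ := hP.ne
  obtain ⟨q1, q2⟩ := q
  have hq1 : q1 ≠ i ∧ q1 ≠ k ∧ q2 ≠ i ∧ q2 ≠ k := by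
    simp only [Prs, Finset.mem_insert, Finset.mem_singleton, Prod.mk.injEq] at hq
    rcases hq with ⟨rfl, rfl⟩ | ⟨rfl, rfl⟩ | ⟨rfl, rfl⟩ <;>
      refine ⟨?_, ?_, ?_, ?_⟩ <;> first | assumption | (apply Ne.symm; assumption)
  obtain ⟨a1, a2, a3, a4⟩ := hq1
  constructor
  · rintro x ⟨t, ht, rfl⟩
    exact (h2.ray n2.symm n3.symm ht).two (h3.ray a1 a3 ht) a2.symm a4.symm
  · rintro x ⟨t, ht, rfl⟩
    exact (h1.ray n2 n4 ht).two (h3.ray a2 a4 ht) a1.symm a3.symm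

lemma Pm.swap {i j k l : Fin 4} : Pm i j k l → Pm j i l k := by revert i j k l; decide
lemma Pm.swap2 {i j k l : Fin 4} : Pm i j k l → Pm i j l k := by revert i j k l; decide
lemma Pm.mid {i j k l : Fin 4} : Pm i j k l → Pm i k j l := by revert i j k l; decide

lemma w_eq {i j k l : Fin 4} (hP : Pm i j k l) (p : V3) (s s' : ℝ) :
    p + s' • (ωdir j + ωdir l) =
      p + s • (ωdir i + ωdir k) + (s + s') • (ωdir j + ωdir l) := by
  have h := ω_sum hP
  have h' : ωdir i + ωdir k = -(ωdir j + ωdir l) := by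
    rw [eq_neg_iff_add_eq_zero, ← h]; abel
  rw [h', smul_neg, add_smul]; abel

lemma line {lam : (Fin 3 → ℤ) → ℝ} {i j k l : Fin 4} {p : V3} (hP : Pm i j k l)
    (h1 : Mx lam i j p) (h2 : Mx lam k l p) :
    ∃ s s' : ℝ, 0 ≤ s ∧ 0 ≤ s' ∧
      IsTropicalLine (TLine (p + s • (ωdir i + ωdir k)) (p + s' • (ωdir j + ωdir l)) i k j l) ∧
      TLine (p + s • (ωdir i + ωdir k)) (p + s' • (ωdir j + ωdir l)) i k j l ⊆ Vtrop 2 lam ∧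
      p ∈ TLine (p + s • (ωdir i + ωdir k)) (p + s' • (ωdir j + ωdir l)) i k j l ∧
      (∃ q ∈ Prs j l, Mx lam q.1 q.2 (p + s • (ωdir i + ωdir k))) ∧
      (∃ q ∈ Prs i k, Mx lam q.1 q.2 (p + s' • (ωdir j + ωdir l))) := by
  obtain ⟨s, hs, a1, a2, q, hq, a3⟩ := half hP h1 h2
  obtain ⟨s', hs', b1, b2, q', hq', b3⟩ := half hP.swap h1.symm h2.symm
  obtain ⟨n1, n2, n3, n4, n5, n6⟩ := hP.ne
  refine ⟨s, s', hs, hs', ⟨_, _, _, _, _, _, ⟨hP.mid, s + s', by positivity, w_eq hP p s s'⟩, rfl⟩,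
    ?_, ?_, ⟨q, hq, a3⟩, ⟨q', hq', b3⟩⟩
  · obtain ⟨r1, r2⟩ := rays_sub hP a1 a2 hq a3
    obtain ⟨r3, r4⟩ := rays_sub hP.swap b1 b2 hq' b3
    unfold TLine
    refine Set.union_subset (Set.union_subset (Set.union_subset (Set.union_subset r1 r2) ?_) r3) r4
    intro x hx
    exact (a1.seg b1.symm hx).two (a2.seg b2.symm hx) n2 n3
  · unfold TLine
    left; left; right
    rw [mem_segment_iff_sameRay]
    have h := ω_sum hP
    have h' : ωdir j + ωdir l = -(ωdir i + ωdir k) := by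
      rw [eq_neg_iff_add_eq_zero, ← h]; abel
    have e1 : p - (p + s • (ωdir i + ωdir k)) = s • (ωdir j + ωdir l) := by
      rw [h', smul_neg]; abel
    have e2 : p + s' • (ωdir j + ωdir l) - p = s' • (ωdir j + ωdir l) := by abel
    rw [e1, e2]
    exact (SameRay.sameRay_nonneg_smul_left _ hs).trans
      (SameRay.sameRay_nonneg_smul_right _ hs') (by
        intro hz
        left
        rw [hz, smul_zero])

/-- Points of a line through `p` satisfy one of two linear equations. -/
lemma line_eqs {i j k l : Fin 4} {p x : V3} (hP : Pm i j k l) {s s' : ℝ}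
    (hx : x ∈ TLine (p + s • (ωdir i + ωdir k)) (p + s' • (ωdir j + ωdir l)) i k j l) :
    Yc j x - Yc l x = Yc j p - Yc l p ∨ Yc i x - Yc k x = Yc i p - Yc k p := by
  obtain ⟨n1, n2, n3, n4, n5, n6⟩ := hP.ne
  rcases hx with (((hx | hx) | hx) | hx) | hx
  · obtain ⟨t, ht, rfl⟩ := hx
    left
    simp only [Yc_add, Yc_smul, Yc_ω, n1.symm, n4, n3.symm, n6.symm, if_false]; ring
  · obtain ⟨t, ht, rfl⟩ := hx
    left
    simp only [Yc_add, Yc_smul, Yc_ω, n1.symm, n4, n3.symm, n6.symm, if_false]; ring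
  · obtain ⟨a, b, ha, hb, hab, rfl⟩ := hx
    left
    have : b = 1 - a := by linarith
    subst this
    simp only [Yc_add, Yc_smul, Yc_ω, n1.symm, n4, n3.symm, n6.symm, n5, n5.symm, if_false, if_true]
    ring
  · obtain ⟨t, ht, rfl⟩ := hx
    right
    simp only [Yc_add, Yc_smul, Yc_ω, n1, n3, n4.symm, n6, if_false]; ring
  · obtain ⟨t, ht, rfl⟩ := hx
    right
    simp only [Yc_add, Yc_smul, Yc_ω, n1, n3, n4.symm, n6, if_false]; ring

lemma left_mem {v w : V3} {i j k l : Fin 4} : v ∈ TLine v w i j k l := by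
  unfold TLine; left; left; right; exact left_mem_segment ℝ v w

lemma right_mem {v w : V3} {i j k l : Fin 4} : w ∈ TLine v w i j k l := by
  unfold TLine; left; left; right; exact right_mem_segment ℝ v w

/-- If the two lines agree then the first is degenerate. -/
lemma degen {i j k l : Fin 4} {p : V3} (hP : Pm i j k l) {s s' r r' : ℝ}
    (h : TLine (p + s • (ωdir i + ωdir k)) (p + s' • (ωdir j + ωdir l)) i k j l =
      TLine (p + r • (ωdir i + ωdir l)) (p + r' • (ωdir j + ωdir k)) i l j k) :
    s = 0 ∧ s' = 0 := by
  obtain ⟨n1, n2, n3, n4, n5, n6⟩ := hP.ne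
  constructor
  · have hm := line_eqs hP.swap2 (h ▸ left_mem)
    simp only [Yc_add, Yc_smul, Yc_ω, n1, n1.symm, n2, n2.symm, n3, n3.symm, n4, n4.symm, n5,
      n5.symm, n6, n6.symm, if_false, if_true] at hm
    rcases hm with hm | hm <;> linarith
  · have hm := line_eqs hP.swap2 (h ▸ right_mem)
    simp only [Yc_add, Yc_smul, Yc_ω, n1, n1.symm, n2, n2.symm, n3, n3.symm, n4, n4.symm, n5,
      n5.symm, n6, n6.symm, if_false, if_true] at hm
    rcases hm with hm | hm <;> linarith

lemma comb0 : ∀ a ∈ Prs 1 3, ∀ b ∈ Prs 0 2, ∀ c ∈ Prs 1 2, ∀ d ∈ Prs 0 3,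
    5 ≤ ({(0, 1), (2, 3), a, b, c, d} : Finset (Fin 4 × Fin 4)).card ∨
    ((0, 0) ∈ ({a, b, c, d} : Finset (Fin 4 × Fin 4)) ∧
      (1, 1) ∈ ({a, b, c, d} : Finset (Fin 4 × Fin 4))) ∨
    ((2, 2) ∈ ({a, b, c, d} : Finset (Fin 4 × Fin 4)) ∧
      (3, 3) ∈ ({a, b, c, d} : Finset (Fin 4 × Fin 4))) := by
  intro a ha b hb c hc d hd
  simp only [Prs, Finset.mem_insert, Finset.mem_singleton] at ha hb hc hd
  have h4 : ({(0, 1), (2, 3), a, b} : Finset (Fin 4 × Fin 4)).card = 4 := by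
    rcases ha with rfl | rfl | rfl <;> rcases hb with rfl | rfl | rfl <;> decide
  have key : ∀ e : Fin 4 × Fin 4, e ∉ ({(0, 1), (2, 3), a, b} : Finset (Fin 4 × Fin 4)) →
      e = c ∨ e = d →
      5 ≤ ({(0, 1), (2, 3), a, b, c, d} : Finset (Fin 4 × Fin 4)).card := by
    intro e he hcd
    have h5 := Finset.card_insert_of_notMem he
    rw [h4] at h5
    refine le_trans (le_of_eq h5.symm) (Finset.card_le_card ?_)
    clear h5 he h4 ha hb hc hd
    intro x hx
    simp only [Finset.mem_insert, Finset.mem_singleton] at hx ⊢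
    rcases hx with h | h | h | h | h
    · rcases hcd with h' | h' <;> simp [h, h']
    all_goals simp [h]
  by_cases h1 : c ∈ ({(0, 1), (2, 3), a, b} : Finset (Fin 4 × Fin 4))
  · by_cases h2 : d ∈ ({(0, 1), (2, 3), a, b} : Finset (Fin 4 × Fin 4))
    · right
      clear key h4
      simp only [Finset.mem_insert, Finset.mem_singleton] at h1 h2
      rcases ha with rfl | rfl | rfl <;> rcases hb with rfl | rfl | rfl <;>
        rcases hc with rfl | rfl | rfl <;> first
          | (exfalso; revert h1; decide)
          | (rcases hd with rfl | rfl | rfl <;> first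
              | (exfalso; revert h2; decide)
              | simp)
    · exact Or.inl (key d h2 (Or.inr rfl))
  · exact Or.inl (key c h1 (Or.inl rfl))

lemma Prs_pull {g : Fin 4 → Fin 4} {u v : Fin 4} {q : Fin 4 × Fin 4} (h : q ∈ Prs (g u) (g v)) :
    ∃ q' ∈ Prs u v, Prod.map g g q' = q := by
  simp only [Prs, Finset.mem_insert, Finset.mem_singleton] at h
  rcases h with rfl | rfl | rfl
  · exact ⟨(u, v), by simp [Prs], rfl⟩
  · exact ⟨(u, u), by simp [Prs], rfl⟩
  · exact ⟨(v, v), by simp [Prs], rfl⟩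

lemma Prs_le {u v : Fin 4} {q : Fin 4 × Fin 4} (huv : u ≤ v) (h : q ∈ Prs u v) : q.1 ≤ q.2 := by
  simp only [Prs, Finset.mem_insert, Finset.mem_singleton] at h
  rcases h with rfl | rfl | rfl
  · exact huv
  · exact le_rfl
  · exact le_rfl

lemma comb (i j k l : Fin 4) (hP : Pm i j k l) (a) (ha : a ∈ Prs j l) (b) (hb : b ∈ Prs i k)
    (c) (hc : c ∈ Prs j k) (d) (hd : d ∈ Prs i l) :
    5 ≤ (({(i, j), (k, l), a, b, c, d} : Finset (Fin 4 × Fin 4)).image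
      (fun q => Evec q.1 + Evec q.2)).card ∨
    ((i, i) ∈ ({a, b, c, d} : Finset (Fin 4 × Fin 4)) ∧
      (j, j) ∈ ({a, b, c, d} : Finset (Fin 4 × Fin 4))) ∨
    ((k, k) ∈ ({a, b, c, d} : Finset (Fin 4 × Fin 4)) ∧
      (l, l) ∈ ({a, b, c, d} : Finset (Fin 4 × Fin 4))) := by
  let g : Fin 4 → Fin 4 := ![i, j, k, l]
  have hg : Function.Injective g := by
    apply Finite.injective_iff_surjective.2
    intro c
    rcases hP.cover c with rfl | rfl | rfl | rfl
    · exact ⟨0, rfl⟩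
    · exact ⟨1, rfl⟩
    · exact ⟨2, rfl⟩
    · exact ⟨3, rfl⟩
  obtain ⟨a, ha0, rfl⟩ := Prs_pull (g := g) (u := 1) (v := 3) ha
  obtain ⟨b, hb0, rfl⟩ := Prs_pull (g := g) (u := 0) (v := 2) hb
  obtain ⟨c, hc0, rfl⟩ := Prs_pull (g := g) (u := 1) (v := 2) hc
  obtain ⟨d, hd0, rfl⟩ := Prs_pull (g := g) (u := 0) (v := 3) hd
  have hi : ∀ u, (u, u) ∈ ({a, b, c, d} : Finset (Fin 4 × Fin 4)) → (g u, g u) ∈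
      ({Prod.map g g a, Prod.map g g b, Prod.map g g c, Prod.map g g d} :
        Finset (Fin 4 × Fin 4)) := by
    intro u hu
    simp only [Finset.mem_insert, Finset.mem_singleton] at hu ⊢
    rcases hu with h | h | h | h <;> simp [← h]
  rcases comb0 a ha0 b hb0 c hc0 d hd0 with h | ⟨h1, h2⟩ | ⟨h1, h2⟩
  · left
    have e : (({(i, j), (k, l), Prod.map g g a, Prod.map g g b, Prod.map g g c, Prod.map g g d} :
        Finset (Fin 4 × Fin 4))) =
        ({(0, 1), (2, 3), a, b, c, d} : Finset (Fin 4 × Fin 4)).image (Prod.map g g) := by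
      simp only [Finset.image_insert, Finset.image_singleton]; rfl
    rw [e, Finset.image_image, Finset.card_image_of_injOn]
    · exact h
    · have hle : ∀ q ∈ ({(0, 1), (2, 3), a, b, c, d} : Finset (Fin 4 × Fin 4)), q.1 ≤ q.2 := by
        intro q hq
        simp only [Finset.mem_insert, Finset.mem_singleton] at hq
        rcases hq with rfl | rfl | rfl | rfl | rfl | rfl
        · decide
        · decide
        · exact Prs_le (u := 1) (v := 3) (by decide) ha0
        · exact Prs_le (u := 0) (v := 2) (by decide) hb0
        · exact Prs_le (u := 1) (v := 2) (by decide) hc0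
        · exact Prs_le (u := 0) (v := 3) (by decide) hd0
      intro q hq q' hq' heq
      have h1 := hle q hq
      have h2 := hle q' hq'
      rcases Evec_inj _ _ _ _ heq with ⟨x, y⟩ | ⟨x, y⟩
      · exact Prod.ext (hg x) (hg y)
      · have x' : q.1 = q'.2 := hg x
        have y' : q.2 = q'.1 := hg y
        have z : q'.1 = q'.2 := le_antisymm h2 (by rw [← x', ← y']; exact h1)
        exact Prod.ext (x'.trans z.symm) (y'.trans z)
  · exact Or.inr (Or.inl ⟨hi 0 h1, hi 1 h2⟩)
  · exact Or.inr (Or.inr ⟨hi 2 h1, hi 3 h2⟩)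

lemma no_five {lam : (Fin 3 → ℤ) → ℝ} {p : V3}
    (h : AffineIndependent ℝ (fun a : Sarg 2 lam p => zToR a.1)) (T : Finset (Fin 3 → ℤ))
    (hT : ∀ t ∈ T, t ∈ Sarg 2 lam p) : T.card ≤ 4 := by
  have hinj : Function.Injective (fun t : T => (⟨t.1, hT t.1 t.2⟩ : Sarg 2 lam p)) := by
    intro a b e
    exact Subtype.ext (congrArg (fun z : Sarg 2 lam p => z.1) e)
  have h2 := h.comp_embedding ⟨_, hinj⟩
  have h3 := h2.card_le_finrank_succ
  have h4 := Submodule.finrank_le (vectorSpan ℝ (Set.range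
    ((fun a : Sarg 2 lam p => zToR a.1) ∘
      (⟨_, hinj⟩ : T ↪ Sarg 2 lam p))))
  have h5 : Module.finrank ℝ V3 = 3 := by simp
  have h6 := h4.trans (le_of_eq h5)
  simp only [Fintype.card_coe] at h3
  omega

lemma no_mid {lam : (Fin 3 → ℤ) → ℝ} {p : V3}
    (h : AffineIndependent ℝ (fun a : Sarg 2 lam p => zToR a.1)) {i j : Fin 4} (hij : i ≠ j)
    (h1 : Mx lam i i p) (h2 : Mx lam j j p) (h3 : Mx lam i j p) : False := by
  have n1 : Evec i + Evec i ≠ Evec i + Evec j := fun e => by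
    rcases Evec_inj _ _ _ _ e with e | e
    · exact hij e.2
    · exact hij e.1
  have n2 : Evec i + Evec i ≠ Evec j + Evec j := fun e => by
    rcases Evec_inj _ _ _ _ e with e | e <;> exact hij e.2
  have n3 : Evec i + Evec j ≠ Evec j + Evec j := fun e => by
    rcases Evec_inj _ _ _ _ e with e | e <;> exact hij e.1
  let f : Fin 3 → Sarg 2 lam p := ![⟨_, (Mx_iff ..).2 h1⟩, ⟨_, (Mx_iff ..).2 h3⟩,
    ⟨_, (Mx_iff ..).2 h2⟩]
  have hf : Function.Injective f := by
    intro a b e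
    have e' := congrArg Subtype.val e
    fin_cases a <;> fin_cases b <;>
      first
      | rfl
      | exact absurd e' n1
      | exact absurd e' n2
      | exact absurd e' n3
      | exact absurd e'.symm n1
      | exact absurd e'.symm n2
      | exact absurd e'.symm n3
  have h4 := h.comp_embedding ⟨f, hf⟩
  rw [affineIndependent_iff] at h4
  have h5 := h4 Finset.univ ![1, -2, 1] (by simp [Fin.sum_univ_three]; norm_num) (by
    funext r
    simp [Fin.sum_univ_three, f, zToR]
    ring) 0 (by simp)
  simp at h5

lemma main_aux {lam : (Fin 3 → ℤ) → ℝ} (hsm : TropSmooth 2 lam) {i j k l : Fin 4} {p : V3}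
    (hP : Pm i j k l) (h1 : Evec i + Evec j ∈ Sarg 2 lam p)
    (h2 : Evec k + Evec l ∈ Sarg 2 lam p) :
    ∃ L₁ L₂ : Set V3, L₁ ≠ L₂ ∧ IsTropicalLine L₁ ∧ IsTropicalLine L₂ ∧
      L₁ ⊆ Vtrop 2 lam ∧ L₂ ⊆ Vtrop 2 lam ∧ p ∈ L₁ ∧ p ∈ L₂ := by
  rw [Mx_iff] at h1 h2
  obtain ⟨s, s', -, -, a1, a2, a3, ⟨qa, hqa, a4⟩, ⟨qb, hqb, a5⟩⟩ := line hP h1 h2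
  obtain ⟨r, r', -, -, b1, b2, b3, ⟨qc, hqc, b4⟩, ⟨qd, hqd, b5⟩⟩ := line hP.swap2 h1 h2.symm
  refine ⟨_, _, ?_, a1, b1, a2, b2, a3, b3⟩
  intro e
  obtain ⟨rfl, rfl⟩ := degen hP e
  obtain ⟨rfl, rfl⟩ := degen hP.swap2 e.symm
  simp only [zero_smul, add_zero] at a4 a5 b4 b5
  have hA := (hsm p).1
  have hall : ∀ q ∈ ({qa, qb, qc, qd} : Finset (Fin 4 × Fin 4)), Mx lam q.1 q.2 p := by
    intro q hq
    simp only [Finset.mem_insert, Finset.mem_singleton] at hq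
    rcases hq with rfl | rfl | rfl | rfl <;> assumption
  obtain ⟨n1, n2, n3, n4, n5, n6⟩ := hP.ne
  rcases comb i j k l hP qa hqa qb hqb qc hqc qd hqd with h | ⟨u, v⟩ | ⟨u, v⟩
  · have := no_five hA (({(i, j), (k, l), qa, qb, qc, qd} : Finset (Fin 4 × Fin 4)).image
      (fun q => Evec q.1 + Evec q.2)) (fun t ht => by
      obtain ⟨q, hq, rfl⟩ := Finset.mem_image.1 ht
      rw [Mx_iff]
      rw [Finset.mem_insert, Finset.mem_insert] at hq
      rcases hq with rfl | rfl | hq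
      · exact h1
      · exact h2
      · exact hall q hq)
    exact absurd (h.trans this) (by norm_num)
  · exact no_mid hA n1 (hall _ u) (hall _ v) h1
  · exact no_mid hA n6 (hall _ u) (hall _ v) h2

/-- Through every point of the compact 2-cell of a smooth tropical quadric surface pass
two distinct tropical lines contained in the surface. -/
theorem two_lines_through_each_point_of_quadric (lam : (Fin 3 → ℤ) → ℝ)
    (hsm : TropSmooth 2 lam) (k : Fin 3) (x₀ : V3)
    (hx₀ : (diag k).1 ∈ Sarg 2 lam x₀ ∧ (diag k).2 ∈ Sarg 2 lam x₀)
    (p : V3) (hp : p ∈ {x : V3 | (diag k).1 ∈ Sarg 2 lam x ∧ (diag k).2 ∈ Sarg 2 lam x}) :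
    ∃ L₁ L₂ : Set V3, L₁ ≠ L₂ ∧ IsTropicalLine L₁ ∧ IsTropicalLine L₂ ∧
      L₁ ⊆ Vtrop 2 lam ∧ L₂ ⊆ Vtrop 2 lam ∧ p ∈ L₁ ∧ p ∈ L₂ := by
  obtain ⟨h1, h2⟩ := hp
  fin_cases k
  · exact main_aux hsm (i := 0) (j := 3) (k := 1) (l := 2) (by decide)
      (by convert h1 using 1; simp [diag, Evec]) (by convert h2 using 1; simp [diag, Evec])
  · exact main_aux hsm (i := 0) (j := 2) (k := 1) (l := 3) (by decide)
      (by convert h1 using 1; simp [diag, Evec]) (by convert h2 using 1; simp [diag, Evec])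
  · exact main_aux hsm (i := 2) (j := 3) (k := 0) (l := 1) (by decide)
      (by convert h1 using 1; simp [diag, Evec]) (by convert h2 using 1; simp [diag, Evec])
end
end

section
/- For every integer δ ≥ 1 there exists a smooth λ : A_δ → ℝ such that the tropical surface V(λ) contains infinitely many tropical lines; moreover these lines can be chosen to form a two-point family: there exist two distinct points P, Q ∈ ℝ³ such that infinitely many distinct tropical lines L with L ⊆ V(λ) contain both P and Q. -/
open scoped BigOperators

noncomputable section

/-! ### Smoothness criterion through integral dual functionals -/

theorem smooth_of_dual (S : Set (Fin 3 → ℤ))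
    (H : ∀ a ∈ S, ∃ (c : ℤ) (g : Fin 3 → ℤ), c + ∑ i, g i * a i = 1 ∧
      ∀ b ∈ S, b ≠ a → c + ∑ i, g i * b i = 0) :
    AffineIndependent ℝ (fun a : S => zToR a.1) ∧
    ∀ a₀ a₁ a₂ a₃ : Fin 3 → ℤ,
      S = {a₀, a₁, a₂, a₃} → S.ncard = 4 →
      |detZ (a₁ - a₀) (a₂ - a₀) (a₃ - a₀)| = 1 := by
  classical
  constructor
  · rw [affineIndependent_iff]
    intro s w hw hs a ha
    obtain ⟨c, g, h1, h0⟩ := H a.1 a.2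
    have key : ∑ b ∈ s, w b * ((c + ∑ i, g i * b.1 i : ℤ) : ℝ) = w a := by
      rw [Finset.sum_eq_single a]
      · rw [h1]; simp
      · intro b _ hba
        rw [h0 b.1 b.2 (fun h => hba (Subtype.ext h))]; simp
      · intro h; exact absurd ha h
    have hc : ∀ i, ∑ b ∈ s, w b * ((b.1 i : ℤ) : ℝ) = 0 := by
      intro i
      have := congrFun hs i
      simpa [Finset.sum_apply, zToR] using this
    rw [← key]
    have e : ∀ b ∈ s, w b * ((c + ∑ i, g i * b.1 i : ℤ) : ℝ) =
        c * w b + g 0 * (w b * (b.1 0 : ℝ)) + g 1 * (w b * (b.1 1 : ℝ))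
          + g 2 * (w b * (b.1 2 : ℝ)) := by
      intro b _
      rw [Fin.sum_univ_three]; push_cast; ring
    rw [Finset.sum_congr rfl e]
    simp only [Finset.sum_add_distrib, ← Finset.mul_sum]
    rw [hc 0, hc 1, hc 2, hw]; simp
  · intro a₀ a₁ a₂ a₃ hS hcard
    have hne : a₁ ≠ a₀ ∧ a₂ ≠ a₀ ∧ a₃ ≠ a₀ ∧ a₂ ≠ a₁ ∧ a₃ ≠ a₁ ∧ a₃ ≠ a₂ := by
      have hS' : S = (({a₀, a₁, a₂, a₃} : Finset (Fin 3 → ℤ)) : Set (Fin 3 → ℤ)) := by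
        rw [hS]; simp
      rw [hS', Set.ncard_coe_finset] at hcard
      have t3 : ∀ x y z : Fin 3 → ℤ, ({x, y, z} : Finset (Fin 3 → ℤ)).card ≤ 3 :=
        fun x y z => Finset.card_le_three
      refine ⟨?_, ?_, ?_, ?_, ?_, ?_⟩
      · rintro rfl
        have : ({a₁, a₁, a₂, a₃} : Finset (Fin 3 → ℤ)) = {a₁, a₂, a₃} := by ext; simp
        rw [this] at hcard; have := t3 a₁ a₂ a₃; omega
      · rintro rfl
        have : ({a₂, a₁, a₂, a₃} : Finset (Fin 3 → ℤ)) = {a₁, a₂, a₃} := by ext; simp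
        rw [this] at hcard; have := t3 a₁ a₂ a₃; omega
      · rintro rfl
        have : ({a₃, a₁, a₂, a₃} : Finset (Fin 3 → ℤ)) = {a₁, a₂, a₃} := by ext; simp
        rw [this] at hcard; have := t3 a₁ a₂ a₃; omega
      · rintro rfl
        have : ({a₀, a₂, a₂, a₃} : Finset (Fin 3 → ℤ)) = {a₀, a₂, a₃} := by ext; simp
        rw [this] at hcard; have := t3 a₀ a₂ a₃; omega
      · rintro rfl
        have : ({a₀, a₃, a₂, a₃} : Finset (Fin 3 → ℤ)) = {a₀, a₂, a₃} := by ext; simp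
        rw [this] at hcard; have := t3 a₀ a₂ a₃; omega
      · rintro rfl
        have : ({a₀, a₁, a₃, a₃} : Finset (Fin 3 → ℤ)) = {a₀, a₁, a₃} := by ext; simp
        rw [this] at hcard; have := t3 a₀ a₁ a₃; omega
    obtain ⟨n10, n20, n30, n21, n31, n32⟩ := hne
    have m0 : a₀ ∈ S := by rw [hS]; simp
    have m1 : a₁ ∈ S := by rw [hS]; simp
    have m2 : a₂ ∈ S := by rw [hS]; simp
    have m3 : a₃ ∈ S := by rw [hS]; simp
    obtain ⟨c1, g1, e1, z1⟩ := H a₁ m1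
    obtain ⟨c2, g2, e2, z2⟩ := H a₂ m2
    obtain ⟨c3, g3, e3, z3⟩ := H a₃ m3
    have z10 := z1 a₀ m0 n10.symm
    have z12 := z1 a₂ m2 n21
    have z13 := z1 a₃ m3 n31
    have z20 := z2 a₀ m0 n20.symm
    have z21 := z2 a₁ m1 n21.symm
    have z23 := z2 a₃ m3 n32
    have z30 := z3 a₀ m0 n30.symm
    have z31 := z3 a₁ m1 n31.symm
    have z32 := z3 a₂ m2 n32.symm
    simp only [Fin.sum_univ_three] at *
    have hmul : Matrix.of ![a₁ - a₀, a₂ - a₀, a₃ - a₀] *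
        (Matrix.of ![g1, g2, g3]).transpose = 1 := by
      ext i j
      fin_cases i <;> fin_cases j <;>
        simp [Matrix.mul_apply, Fin.sum_univ_three] <;> linarith
    have hdet := congrArg Matrix.det hmul
    rw [Matrix.det_mul, Matrix.det_one] at hdet
    exact Int.isUnit_iff_abs_eq.mp (IsUnit.of_mul_eq_one _ hdet)

/-! ### A finite fact about the root system `A₂` -/

/-- The vectors `(i,j)` with `i, j, i+j ∈ {-1,0,1}`, i.e. zero and the six roots. -/
def SmallV (d : ℤ × ℤ) : Prop :=
  -1 ≤ d.1 ∧ d.1 ≤ 1 ∧ -1 ≤ d.2 ∧ d.2 ≤ 1 ∧ -1 ≤ d.1 + d.2 ∧ d.1 + d.2 ≤ 1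

/-- The six roots. -/
def rootsA : Finset (ℤ × ℤ) := {(1, 0), (-1, 0), (0, 1), (0, -1), (1, -1), (-1, 1)}

instance : DecidablePred SmallV := fun d => by unfold SmallV; infer_instance

theorem mem_rootsA {d : ℤ × ℤ} (h : SmallV d) (h0 : d ≠ 0) : d ∈ rootsA := by
  obtain ⟨i, j⟩ := d
  simp only [SmallV, rootsA, ne_eq, Prod.mk_eq_zero, Finset.mem_insert, Finset.mem_singleton,
    Prod.mk.injEq] at *
  omega

/-- The planar determinant. -/
def det2 (d f : ℤ × ℤ) : ℤ := d.1 * f.2 - d.2 * f.1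

theorem roots_fact_edge : ∀ f ∈ rootsA, ∀ d ∈ rootsA, ∀ e ∈ rootsA, SmallV (e - d) →
    d ≠ f → d ≠ -f → e ≠ f → e ≠ -f → (e = d ∨ (e - d ≠ f ∧ d - e ≠ f)) →
    det2 d f * det2 e f = 1 := by decide

theorem roots_fact_other : ∀ d ∈ rootsA, ∀ f ∈ rootsA, ∀ g ∈ rootsA, SmallV (f - g) →
    d ≠ f → d ≠ -f → d ≠ g → d ≠ -g → d ≠ f - g → d ≠ g - f → det2 g f = 0 := by decide

theorem roots_fact_triangle : ∀ d ∈ rootsA, ∀ e ∈ rootsA, ∀ g ∈ rootsA, e ≠ d → SmallV (e - d) →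
    SmallV (g - d) → SmallV (g - e) → det2 d (e - d) * det2 g (e - d) = 1 := by decide

theorem roots_fact_single : ∀ d ∈ rootsA, d.1 * d.1 + (1 - d.1 * d.1) * d.2 * d.2 = 1 := by decide

theorem exists_functional (D D' : ℤ × ℤ → Prop)
    (hD : ∀ d, D d → SmallV d ∧ d ≠ 0)
    (hDD : ∀ d e, D d → D e → SmallV (d - e))
    (hD' : ∀ f, D' f → SmallV f)
    (hDD' : ∀ f g, D' f → D' g → SmallV (f - g))
    (h3 : ∀ d f g, D d → D' f → D' g → d ≠ f - g)
    (h1 : ∀ d f, D d → D' f → d ≠ f ∧ d ≠ -f)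
    (h2 : ∀ d e f, D d → D e → D' f → d ≠ e → d - e ≠ f) :
    ∃ u v : ℤ, (∀ d, D d → u * d.1 + v * d.2 = 1) ∧ (∀ f, D' f → u * f.1 + v * f.2 = 0) := by
  by_cases hd : ∃ d, D d
  swap
  · push Not at hd
    exact ⟨0, 0, fun d h => absurd h (hd d), fun f _ => by simp⟩
  obtain ⟨d, hd⟩ := hd
  have rt : ∀ e, D e → e ∈ rootsA := fun e he => mem_rootsA (hD e he).1 (hD e he).2
  by_cases hf : ∃ f, D' f ∧ f ≠ 0
  · obtain ⟨f, hf, hf0⟩ := hf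
    refine ⟨det2 d f * f.2, -(det2 d f * f.1), fun e he => ?_, fun g hg => ?_⟩
    · have := roots_fact_edge f (mem_rootsA (hD' f hf) hf0) d (rt d hd) e (rt e he) (hDD e d he hd)
        (h1 d f hd hf).1 (h1 d f hd hf).2 (h1 e f he hf).1 (h1 e f he hf).2 (by
          by_cases h : e = d
          · exact Or.inl h
          · exact Or.inr ⟨h2 e d f he hd hf h, h2 d e f hd he hf (Ne.symm h)⟩)
      rw [← this]
      simp only [det2]; ring
    · have : det2 g f = 0 := by
        by_cases hg0 : g = 0
        · rw [hg0]; simp [det2]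
        · exact roots_fact_other d (rt d hd) f (mem_rootsA (hD' f hf) hf0) g
            (mem_rootsA (hD' g hg) hg0) (hDD' f g hf hg) (h1 d f hd hf).1 (h1 d f hd hf).2
            (h1 d g hd hg).1 (h1 d g hd hg).2 (h3 d f g hd hf hg) (h3 d g f hd hg hf)
      have e : det2 d f * f.2 * g.1 + -(det2 d f * f.1) * g.2 = det2 d f * det2 g f := by
        simp only [det2]; ring
      rw [e, this, mul_zero]
  · push Not at hf
    have hz : ∀ u v : ℤ, ∀ f, D' f → u * f.1 + v * f.2 = 0 := by
      intro u v f h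
      rw [hf f h]; simp
    by_cases he : ∃ e, D e ∧ e ≠ d
    · obtain ⟨e, he, hed⟩ := he
      refine ⟨det2 d (e - d) * (e - d).2, -(det2 d (e - d) * (e - d).1), fun g hg => ?_, hz _ _⟩
      rw [← roots_fact_triangle d (rt d hd) e (rt e he) g (rt g hg) hed (hDD e d he hd) (hDD g d hg hd)
        (hDD g e hg he)]
      simp only [det2]; ring
    · push Not at he
      refine ⟨d.1, (1 - d.1 * d.1) * d.2, fun e h => ?_, hz _ _⟩
      rw [he e h]
      exact roots_fact_single d (rt d hd)

/-! ### The surface -/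

/-- The non-leading part of the (negated) weights. -/
def Rw (M p q k : ℤ) : ℤ :=
  3 * (p ^ 2 + q ^ 2 + (p + q) ^ 2) + (if k % 2 = 0 then M * q else M * p + 12 * q)

/-- The integral weights. -/
def Lw (M N p q k : ℤ) : ℤ := - N * k ^ 2 - Rw M p q k

/-- The weights as a function on lattice points. -/
def lamW (M N : ℤ) (a : Fin 3 → ℤ) : ℝ := (Lw M N (a 0) (a 1) (a 2) : ℤ)

theorem dot3 (a : Fin 3 → ℤ) (x : V3) : dotZR a x = a 0 * x 0 + a 1 * x 1 + a 2 * x 2 := by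
  simp [dotZR, Fin.sum_univ_three]

theorem exchange {δ : ℕ} {M N : ℤ} {x : V3} {a b : Fin 3 → ℤ}
    (ha : a ∈ Sarg δ (lamW M N) x) (hb : b ∈ Sarg δ (lamW M N) x) (u v w : ℤ)
    (h1 : 0 ≤ a 0 - u) (h2 : 0 ≤ a 1 - v) (h3 : 0 ≤ a 2 - w)
    (h4 : a 0 - u + (a 1 - v) + (a 2 - w) ≤ δ)
    (h5 : 0 ≤ b 0 + u) (h6 : 0 ≤ b 1 + v) (h7 : 0 ≤ b 2 + w)
    (h8 : b 0 + u + (b 1 + v) + (b 2 + w) ≤ δ) :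
    Lw M N (a 0 - u) (a 1 - v) (a 2 - w) + Lw M N (b 0 + u) (b 1 + v) (b 2 + w) ≤
      Lw M N (a 0) (a 1) (a 2) + Lw M N (b 0) (b 1) (b 2) := by
  have e1 := ha.2 ![a 0 - u, a 1 - v, a 2 - w] (by
    refine ⟨fun i => ?_, ?_⟩
    · fin_cases i <;> simp <;> linarith
    · simpa using h4)
  have e2 := hb.2 ![b 0 + u, b 1 + v, b 2 + w] (by
    refine ⟨fun i => ?_, ?_⟩
    · fin_cases i <;> simp <;> linarith
    · simpa using h8)
  simp only [dot3, lamW] at e1 e2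
  simp at e1 e2
  have : ((Lw M N (a 0 - u) (a 1 - v) (a 2 - w) + Lw M N (b 0 + u) (b 1 + v) (b 2 + w) : ℤ) : ℝ) ≤
      ((Lw M N (a 0) (a 1) (a 2) + Lw M N (b 0) (b 1) (b 2) : ℤ) : ℝ) := by
    push_cast
    linarith
  exact_mod_cast this

theorem Rw_bound {δ p q k M : ℤ} (hM : 12 ≤ M) (hp : 0 ≤ p) (hq : 0 ≤ q) (h : p + q ≤ δ) :
    0 ≤ Rw M p q k ∧ Rw M p q k ≤ 6 * δ ^ 2 + M * δ := by
  have h1 : (p + q) ^ 2 ≤ δ ^ 2 := by nlinarith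
  have h2 : 0 ≤ p * q := mul_nonneg hp hq
  have h3 : 0 ≤ M * p := by positivity
  have h4 : 0 ≤ M * q := by positivity
  have h5 : M * (p + q) ≤ M * δ := by nlinarith
  have h6 : 12 * q ≤ M * q := by nlinarith
  unfold Rw
  split_ifs <;> constructor <;> nlinarith

theorem level_diff {δ : ℕ} {M N : ℤ} (hM : 12 ≤ M) (hN : 6 * (δ : ℤ) ^ 2 + M * δ < N) {x : V3}
    {a b : Fin 3 → ℤ} (ha : a ∈ Sarg δ (lamW M N) x) (hb : b ∈ Sarg δ (lamW M N) x) :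
    b 2 ≤ a 2 + 1 := by
  by_contra hlt
  push Not at hlt
  have a0 := ha.1.1 0
  have a1 := ha.1.1 1
  have a2 := ha.1.1 2
  have as := ha.1.2
  have b0 := hb.1.1 0
  have b1 := hb.1.1 1
  have b2 := hb.1.1 2
  have bs := hb.1.2
  have hN0 : 0 < N := by nlinarith
  have main : ∀ u v : ℤ, 0 ≤ a 0 - u → 0 ≤ a 1 - v → 0 ≤ b 0 + u → 0 ≤ b 1 + v →
      a 0 - u + (a 1 - v) + (a 2 - (-1)) ≤ δ → b 0 + u + (b 1 + v) + (b 2 + (-1)) ≤ δ →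
      False := by
    intro u v g1 g2 g3 g4 g5 g6
    have e := exchange ha hb u v (-1) g1 g2 (by linarith) g5 g3 g4 (by linarith) g6
    have r1 := Rw_bound (k := a 2) (δ := δ) hM a0 a1 (by linarith)
    have r2 := Rw_bound (k := b 2) (δ := δ) hM b0 b1 (by linarith)
    have r3 := Rw_bound (k := a 2 - (-1)) (δ := δ) hM g1 g2 (by linarith)
    have r4 := Rw_bound (k := b 2 + (-1)) (δ := δ) hM g3 g4 (by linarith)
    unfold Lw at e
    have : N * 2 ≤ N * (2 * (b 2 - a 2) - 2) := by
      apply mul_le_mul_of_nonneg_left _ hN0.le; linarith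
    nlinarith
  by_cases h : a 0 + a 1 + a 2 < δ
  · exact main 0 0 (by linarith) (by linarith) (by linarith) (by linarith) (by linarith)
      (by linarith)
  · by_cases h0 : 0 < a 0
    · exact main 1 0 (by linarith) (by linarith) (by linarith) (by linarith) (by linarith)
        (by linarith)
    · exact main 0 1 (by linarith) (by omega) (by linarith) (by linarith) (by linarith)
        (by linarith)

/-- The planar part of the difference of two lattice points. -/
def pd (a b : Fin 3 → ℤ) : ℤ × ℤ := (a 0 - b 0, a 1 - b 1)

theorem same_level_aux {δ : ℕ} {M N : ℤ} {x : V3}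
    {a b : Fin 3 → ℤ} (ha : a ∈ Sarg δ (lamW M N) x) (hb : b ∈ Sarg δ (lamW M N) x)
    (hk : a 2 = b 2) : a 0 - b 0 ≤ 1 ∧ a 1 - b 1 ≤ 1 ∧ a 0 - b 0 + (a 1 - b 1) ≤ 1 := by
  have a0 := ha.1.1 0
  have a1 := ha.1.1 1
  have a2 := ha.1.1 2
  have as := ha.1.2
  have b0 := hb.1.1 0
  have b1 := hb.1.1 1
  have b2 := hb.1.1 2
  have bs := hb.1.2
  have main : ∀ u v : ℤ, 0 ≤ a 0 - u → 0 ≤ a 1 - v → 0 ≤ b 0 + u → 0 ≤ b 1 + v →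
      a 0 - u + (a 1 - v) + (a 2 - 0) ≤ δ → b 0 + u + (b 1 + v) + (b 2 + 0) ≤ δ →
      u * (a 0 - b 0) + v * (a 1 - b 1) + (u + v) * (a 0 - b 0 + (a 1 - b 1))
        ≤ u ^ 2 + v ^ 2 + (u + v) ^ 2 := by
    intro u v g1 g2 g3 g4 g5 g6
    have e := exchange ha hb u v 0 g1 g2 (by linarith) g5 g3 g4 (by linarith) g6
    unfold Lw Rw at e
    rw [hk] at e
    simp only [sub_zero, add_zero] at e
    split_ifs at e <;> nlinarith
  refine ⟨?_, ?_, ?_⟩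
  · by_contra h
    push Not at h
    by_cases h' : a 1 - b 1 < 0
    · have := main 1 (-1) (by linarith) (by linarith) (by linarith) (by linarith)
        (by linarith) (by linarith)
      linarith
    · have := main 1 0 (by linarith) (by linarith) (by linarith) (by linarith)
        (by linarith) (by linarith)
      linarith
  · by_contra h
    push Not at h
    by_cases h' : a 0 - b 0 < 0
    · have := main (-1) 1 (by linarith) (by linarith) (by linarith) (by linarith)
        (by linarith) (by linarith)
      linarith
    · have := main 0 1 (by linarith) (by linarith) (by linarith) (by linarith)
        (by linarith) (by linarith)
      linarith
  · by_contra h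
    push Not at h
    by_cases h' : 0 < a 0 - b 0
    · have := main 1 0 (by linarith) (by linarith) (by linarith) (by linarith)
        (by linarith) (by linarith)
      linarith
    · have := main 0 1 (by linarith) (by linarith) (by linarith) (by linarith)
        (by linarith) (by linarith)
      linarith

theorem same_level {δ : ℕ} {M N : ℤ} {x : V3}
    {a b : Fin 3 → ℤ} (ha : a ∈ Sarg δ (lamW M N) x) (hb : b ∈ Sarg δ (lamW M N) x)
    (hk : a 2 = b 2) : SmallV (pd a b) := by
  obtain ⟨h1, h2, h3⟩ := same_level_aux ha hb hk
  obtain ⟨h4, h5, h6⟩ := same_level_aux hb ha hk.symm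
  simp only [SmallV, pd]
  omega

theorem not_parallel {δ : ℕ} {M N : ℤ} (hM : M % 3 = 1) {x : V3}
    {a a' b b' : Fin 3 → ℤ} (ha : a ∈ Sarg δ (lamW M N) x) (ha' : a' ∈ Sarg δ (lamW M N) x)
    (hb : b ∈ Sarg δ (lamW M N) x) (hb' : b' ∈ Sarg δ (lamW M N) x)
    (hk : a 2 = a' 2) (hk' : b 2 = b' 2) (hkk : a 2 % 2 ≠ b 2 % 2)
    (hne : pd a a' ≠ 0) : pd a a' ≠ pd b b' := by
  intro h
  have hs := same_level ha ha' hk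
  simp only [pd, Prod.mk.injEq] at h
  obtain ⟨h0, h1⟩ := h
  have e1 := ha.2 a' ha'.1
  have e2 := ha'.2 a ha.1
  have e3 := hb.2 b' hb'.1
  have e4 := hb'.2 b hb.1
  simp only [dot3, lamW] at e1 e2 e3 e4
  have h0' : (a 0 : ℝ) - a' 0 = b 0 - b' 0 := by exact_mod_cast h0
  have h1' : (a 1 : ℝ) - a' 1 = b 1 - b' 1 := by exact_mod_cast h1
  have hkR : (a 2 : ℝ) = a' 2 := by exact_mod_cast hk
  have hkR' : (b 2 : ℝ) = b' 2 := by exact_mod_cast hk'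
  have t0 : ((a 0 : ℝ) - a' 0) * x 0 = (b 0 - b' 0) * x 0 := by rw [h0']
  have t1 : ((a 1 : ℝ) - a' 1) * x 1 = (b 1 - b' 1) * x 1 := by rw [h1']
  rw [hk] at e1 e2
  rw [hk'] at e3 e4
  have eq : Lw M N (a 0) (a 1) (a' 2) - Lw M N (a' 0) (a' 1) (a' 2) =
      Lw M N (b 0) (b 1) (b' 2) - Lw M N (b' 0) (b' 1) (b' 2) := by
    have : ((Lw M N (a 0) (a 1) (a' 2) - Lw M N (a' 0) (a' 1) (a' 2) : ℤ) : ℝ) =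
      ((Lw M N (b 0) (b 1) (b' 2) - Lw M N (b' 0) (b' 1) (b' 2) : ℤ) : ℝ) := by
      push_cast
      linarith
    exact_mod_cast this
  obtain ⟨m, hm⟩ : ∃ m, M = 3 * m + 1 := ⟨M / 3, by omega⟩
  subst hm
  obtain ⟨d0, hd0⟩ : ∃ d0, d0 = a 0 - a' 0 := ⟨_, rfl⟩
  obtain ⟨d1, hd1⟩ : ∃ d1, d1 = a 1 - a' 1 := ⟨_, rfl⟩
  have A0 : a 0 = a' 0 + d0 := by omega
  have A1 : a 1 = a' 1 + d1 := by omega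
  have B0 : b 0 = b' 0 + d0 := by omega
  have B1 : b 1 = b' 1 + d1 := by omega
  have key : (3 : ℤ) ∣ d0 - d1 := by
    rw [A0, A1, B0, B1] at eq
    unfold Lw Rw at eq
    rw [hk, hk'] at hkk
    split_ifs at eq with c1 c2 c2
    · omega
    · refine ⟨-(m * d0 - m * d1 + 4 * d1 +
        (2 * b' 0 * d0 + 2 * b' 1 * d1 + 2 * (b' 0 + b' 1) * (d0 + d1))
        - (2 * a' 0 * d0 + 2 * a' 1 * d1 + 2 * (a' 0 + a' 1) * (d0 + d1))), ?_⟩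
      linarith
    · refine ⟨-(m * d0 - m * d1 + 4 * d1 -
        (2 * b' 0 * d0 + 2 * b' 1 * d1 + 2 * (b' 0 + b' 1) * (d0 + d1))
        + (2 * a' 0 * d0 + 2 * a' 1 * d1 + 2 * (a' 0 + a' 1) * (d0 + d1))), ?_⟩
      linarith
    · omega
  simp only [SmallV, pd, ← hd0, ← hd1] at hs
  apply hne
  simp only [pd, ← hd0, ← hd1, Prod.mk_eq_zero]
  omega

theorem smoothW {δ : ℕ} {M N : ℤ} (hM3 : M % 3 = 1) (hM : 12 ≤ M)
    (hN : 6 * (δ : ℤ) ^ 2 + M * δ < N) : TropSmooth δ (lamW M N) := by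
  intro x
  apply smooth_of_dual
  intro a ha
  -- the other level
  obtain ⟨ε, hε, hlev⟩ : ∃ ε : ℤ, (ε = 1 ∨ ε = -1) ∧
      ∀ b ∈ Sarg δ (lamW M N) x, b 2 = a 2 ∨ b 2 = a 2 + ε := by
    by_cases h : ∃ b ∈ Sarg δ (lamW M N) x, b 2 = a 2 - 1
    · obtain ⟨b, hb, hb2⟩ := h
      refine ⟨-1, Or.inr rfl, fun c hc => ?_⟩
      have := level_diff hM hN hc ha
      have := level_diff hM hN hb hc
      omega
    · push Not at h
      refine ⟨1, Or.inl rfl, fun c hc => ?_⟩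
      have := level_diff hM hN hc ha
      have := level_diff hM hN ha hc
      have := h c hc
      omega
  have pdne : ∀ b c : Fin 3 → ℤ, b 2 = c 2 → b ≠ c → pd b c ≠ 0 := by
    intro b c h2 hne h0
    apply hne
    simp only [pd, Prod.mk_eq_zero] at h0
    funext i
    fin_cases i
    · simp; omega
    · simp; omega
    · simpa using h2
  obtain ⟨t, htt⟩ : ∃ t : Fin 3 → ℤ, ∀ s ∈ Sarg δ (lamW M N) x, s 2 = a 2 + ε →
      t ∈ Sarg δ (lamW M N) x ∧ t 2 = a 2 + ε := by
    by_cases h : ∃ t ∈ Sarg δ (lamW M N) x, t 2 = a 2 + ε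
    · obtain ⟨t, ht⟩ := h
      exact ⟨t, fun _ _ _ => ht⟩
    · push Not at h
      exact ⟨0, fun s hs hs2 => absurd hs2 (h s hs)⟩
  obtain ⟨u, v, hu, hv⟩ := exists_functional
    (fun d => ∃ b ∈ Sarg δ (lamW M N) x, b 2 = a 2 ∧ b ≠ a ∧ d = pd a b)
    (fun f => ∃ s ∈ Sarg δ (lamW M N) x, s 2 = a 2 + ε ∧ f = pd s t)
    (by
      rintro d ⟨b, hb, hb2, hne, rfl⟩
      exact ⟨same_level ha hb hb2.symm, pdne _ _ hb2.symm hne.symm⟩)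
    (by
      rintro d e ⟨b, hb, hb2, hne, rfl⟩ ⟨c, hc, hc2, hne', rfl⟩
      have e : pd a b - pd a c = pd c b := by simp [pd]
      rw [e]
      exact same_level hc hb (by omega))
    (by
      rintro f ⟨s, hs, hs2, rfl⟩
      obtain ⟨ht, ht2⟩ := htt s hs hs2
      exact same_level hs ht (by omega))
    (by
      rintro f g ⟨s, hs, hs2, rfl⟩ ⟨r, hr, hr2, rfl⟩
      have e : pd s t - pd r t = pd s r := by simp [pd]
      rw [e]
      exact same_level hs hr (by omega))
    (by
      rintro d f g ⟨b, hb, hb2, hne, rfl⟩ ⟨s, hs, hs2, rfl⟩ ⟨r, hr, hr2, rfl⟩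
      have e : pd s t - pd r t = pd s r := by simp [pd]
      rw [e]
      exact not_parallel hM3 ha hb hs hr (by omega) (by omega) (by omega)
        (pdne _ _ hb2.symm hne.symm))
    (by
      rintro d f ⟨b, hb, hb2, hne, rfl⟩ ⟨s, hs, hs2, rfl⟩
      obtain ⟨ht, ht2⟩ := htt s hs hs2
      refine ⟨not_parallel hM3 ha hb hs ht (by omega) (by omega) (by omega)
        (pdne _ _ hb2.symm hne.symm), ?_⟩
      have e : - pd s t = pd t s := by simp [pd]
      rw [e]
      exact not_parallel hM3 ha hb ht hs (by omega) (by omega) (by omega)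
        (pdne _ _ hb2.symm hne.symm))
    (by
      rintro d e f ⟨b, hb, hb2, hne, rfl⟩ ⟨c, hc, hc2, hne', rfl⟩ ⟨s, hs, hs2, rfl⟩ hde
      obtain ⟨ht, ht2⟩ := htt s hs hs2
      have e : pd a b - pd a c = pd c b := by simp [pd]
      rw [e]
      refine not_parallel hM3 hc hb hs ht (by omega) (by omega) (by omega) ?_
      rw [← e]
      exact sub_ne_zero.mpr hde)
  -- value at the other level
  obtain ⟨z, hz⟩ : ∃ z : ℤ, ∀ s ∈ Sarg δ (lamW M N) x, s 2 = a 2 + ε →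
      u * s 0 + v * s 1 = z := by
    refine ⟨u * t 0 + v * t 1, fun s hs hs2 => ?_⟩
    have := hv _ ⟨s, hs, hs2, rfl⟩
    simp only [pd] at this
    linarith
  -- g(y) = 1 + u (y0 - a0) + v (y1 - a1) + m (y2 - a2)
  obtain ⟨m, hm⟩ : ∃ m : ℤ, m * ε = -(1 + z - u * a 0 - v * a 1) := by
    rcases hε with rfl | rfl
    · exact ⟨-(1 + z - u * a 0 - v * a 1), by ring⟩
    · exact ⟨(1 + z - u * a 0 - v * a 1), by ring⟩
  refine ⟨1 - u * a 0 - v * a 1 - m * a 2, ![u, v, m], ?_, ?_⟩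
  · simp [Fin.sum_univ_three]
  · intro b hb hne
    simp only [Fin.sum_univ_three, Matrix.cons_val_zero, Matrix.cons_val_one, Matrix.cons_val]
    rcases hlev b hb with h | h
    · have := hu _ ⟨b, hb, h, hne, rfl⟩
      simp only [pd] at this
      rw [h]; linarith
    · have := hz b hb h
      rw [h]; linarith

/-! ### The lines -/

theorem key_bound {δ : ℕ} {M N : ℤ} (hM : 6 * (δ : ℤ) + 12 ≤ M)
    (hN : 6 * (δ : ℤ) ^ 2 + M * δ < N) {p q k : ℤ} (hp : 0 ≤ p) (hq : 0 ≤ q) (hk : 0 ≤ k)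
    (hs : p + q + k ≤ δ) :
    Lw M N p q k + 6 * p + 6 * q + N * k ≤ - 6 * (p + q + k) ^ 2 + 6 * (p + q + k) := by
  have hδ : (0 : ℤ) ≤ δ := by positivity
  rcases (by omega : k = 0 ∨ k = 1 ∨ 2 ≤ k) with rfl | rfl | h
  · simp only [Lw, Rw]
    norm_num
    nlinarith [mul_nonneg hq hp, mul_nonneg hq (by linarith : 0 ≤ M - 6 * p)]
  · simp only [Lw, Rw]
    norm_num
    nlinarith [mul_nonneg hq hp, mul_nonneg hp (by linarith : 0 ≤ M - 6 * q - 12)]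
  · have r := (Rw_bound (k := k) (M := M) (δ := δ) (by linarith) hp hq (by linarith)).1
    have h1 : (p + q + k) ^ 2 ≤ (δ : ℤ) ^ 2 := by nlinarith
    have h2 : 0 ≤ M * (δ : ℤ) := by apply mul_nonneg <;> linarith
    have h3 : N * 2 ≤ N * (k * (k - 1)) := by
      apply mul_le_mul_of_nonneg_left
      · nlinarith
      · nlinarith
    unfold Lw
    nlinarith

theorem key_boundR {δ : ℕ} {M N : ℤ} (hM : 6 * (δ : ℤ) + 12 ≤ M)
    (hN : 6 * (δ : ℤ) ^ 2 + M * δ < N) {b : Fin 3 → ℤ} (hb : b ∈ Adelta δ) :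
    lamW M N b + 6 * b 0 + 6 * b 1 + N * b 2 ≤
      - 6 * (b 0 + b 1 + b 2 : ℝ) ^ 2 + 6 * (b 0 + b 1 + b 2 : ℝ) := by
  have := key_bound hM hN (hb.1 0) (hb.1 1) (hb.1 2) hb.2
  unfold lamW
  exact_mod_cast this

theorem key_nonpos {δ : ℕ} {M N : ℤ} (hM : 6 * (δ : ℤ) + 12 ≤ M)
    (hN : 6 * (δ : ℤ) ^ 2 + M * δ < N) {b : Fin 3 → ℤ} (hb : b ∈ Adelta δ) :
    lamW M N b + 6 * b 0 + 6 * b 1 + N * b 2 ≤ 0 := by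
  have h := key_bound hM hN (hb.1 0) (hb.1 1) (hb.1 2) hb.2
  have hs : 0 ≤ b 0 + b 1 + b 2 := by
    have := hb.1 0
    have := hb.1 1
    have := hb.1 2
    linarith
  have : Lw M N (b 0) (b 1) (b 2) + 6 * b 0 + 6 * b 1 + N * b 2 ≤ 0 := by
    rcases hs.eq_or_lt with h0 | h0
    · rw [← h0] at h; linarith
    · nlinarith
  unfold lamW
  exact_mod_cast this

theorem cone_mem {δ : ℕ} (hδ : 1 ≤ δ) {M N : ℤ} (hM : 6 * (δ : ℤ) + 12 ≤ M)
    (hN : 6 * (δ : ℤ) ^ 2 + M * δ < N) {x : V3} (h0 : x 0 ≤ 6) (h1 : x 1 ≤ 6)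
    (h2 : x 2 = N) : x ∈ Vtrop δ (lamW M N) := by
  have hδ' : (1 : ℤ) ≤ δ := by exact_mod_cast hδ
  have gen : ∀ b ∈ Adelta δ, lamW M N b + dotZR b x ≤ 0 := by
    intro b hb
    have := key_nonpos hM hN hb
    have c0 : (0 : ℝ) ≤ b 0 := by exact_mod_cast hb.1 0
    have c1 : (0 : ℝ) ≤ b 1 := by exact_mod_cast hb.1 1
    rw [dot3, h2]
    nlinarith
  refine ⟨![0, 0, 0], ⟨⟨?_, ?_⟩, ?_⟩, ![0, 0, 1], ⟨⟨?_, ?_⟩, ?_⟩, ?_⟩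
  · intro i; fin_cases i <;> simp
  · simp
  · intro b hb
    refine (gen b hb).trans ?_
    simp [dot3, lamW, Lw, Rw]
  · intro i; fin_cases i <;> simp
  · simpa using hδ'
  · intro b hb
    refine (gen b hb).trans ?_
    simp [dot3, lamW, Lw, Rw, h2]
  · intro h; have := congrFun h 2; simp at this

theorem down_mem {δ : ℕ} (hδ : 1 ≤ δ) {M N : ℤ} (hM : 6 * (δ : ℤ) + 12 ≤ M)
    (hN : 6 * (δ : ℤ) ^ 2 + M * δ < N) {x : V3} (h0 : x 0 = 6) (h1 : x 1 = 6)
    (h2 : x 2 ≤ N) : x ∈ Vtrop δ (lamW M N) := by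
  have hδ' : (1 : ℤ) ≤ δ := by exact_mod_cast hδ
  have gen : ∀ b ∈ Adelta δ, lamW M N b + dotZR b x ≤ 0 := by
    intro b hb
    have := key_nonpos hM hN hb
    have c2 : (0 : ℝ) ≤ b 2 := by exact_mod_cast hb.1 2
    rw [dot3, h0, h1]
    nlinarith
  refine ⟨![0, 0, 0], ⟨⟨?_, ?_⟩, ?_⟩, ![1, 0, 0], ⟨⟨?_, ?_⟩, ?_⟩, ?_⟩
  · intro i; fin_cases i <;> simp
  · simp
  · intro b hb
    refine (gen b hb).trans ?_
    simp [dot3, lamW, Lw, Rw]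
  · intro i; fin_cases i <;> simp
  · simpa using hδ'
  · intro b hb
    refine (gen b hb).trans ?_
    simp [dot3, lamW, Lw, Rw, h0]; try norm_num
  · intro h; have := congrFun h 0; simp at this

theorem diag_mem {δ : ℕ} (hδ : 1 ≤ δ) {M N : ℤ} (hM : 6 * (δ : ℤ) + 12 ≤ M)
    (hN : 6 * (δ : ℤ) ^ 2 + M * δ < N) {x : V3} {t : ℝ} (ht : 0 ≤ t) (h0 : x 0 = 6 + t)
    (h1 : x 1 = 6 + t) (h2 : x 2 = N + t) : x ∈ Vtrop δ (lamW M N) := by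
  have hδ' : (1 : ℤ) ≤ δ := by exact_mod_cast hδ
  -- the index `i` of the maximal monomial
  obtain ⟨i, hi1, hiδ, hlo, hhi⟩ : ∃ i : ℤ, 1 ≤ i ∧ i ≤ δ ∧ 12 * ((i : ℝ) - 1) ≤ t ∧
      (i = δ ∨ t ≤ 12 * i) := by
    have hf0 : 0 ≤ ⌊t / 12⌋ := Int.floor_nonneg.mpr (by positivity)
    have hf1 := Int.floor_le (t / 12)
    have hf2 := Int.lt_floor_add_one (t / 12)
    by_cases h : ⌊t / 12⌋ + 1 ≤ (δ : ℤ)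
    · refine ⟨⌊t / 12⌋ + 1, by linarith, h, ?_, Or.inr ?_⟩ <;> push_cast <;> linarith
    · refine ⟨δ, hδ', le_rfl, ?_, Or.inl rfl⟩
      have : ((δ : ℤ) : ℝ) ≤ (⌊t / 12⌋ : ℝ) := by exact_mod_cast (by linarith)
      linarith
  have gen : ∀ b ∈ Adelta δ, lamW M N b + dotZR b x ≤ -6 * (i : ℝ) ^ 2 + i * (6 + t) := by
    intro b hb
    have k1 := key_boundR hM hN hb
    obtain ⟨n, hn⟩ : ∃ n : ℤ, n = b 0 + b 1 + b 2 := ⟨_, rfl⟩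
    have hnR : (b 0 + b 1 + b 2 : ℝ) = n := by rw [hn]; push_cast; ring
    have hnδ : n ≤ δ := by rw [hn]; exact hb.2
    have e : lamW M N b + dotZR b x =
        lamW M N b + 6 * b 0 + 6 * b 1 + N * b 2 + t * (b 0 + b 1 + b 2 : ℝ) := by
      rw [dot3, h0, h1, h2]; ring
    rw [e]
    rw [hnR] at k1 ⊢
    suffices hh : ((n : ℝ) - i) * (6 + t - 6 * (n + i)) ≤ 0 by nlinarith
    rcases lt_trichotomy n i with hlt | heq | hgt
    · have : (n : ℝ) + 1 ≤ i := by exact_mod_cast hlt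
      apply mul_nonpos_of_nonpos_of_nonneg <;> linarith
    · rw [heq]; simp
    · have : (i : ℝ) + 1 ≤ n := by exact_mod_cast hgt
      rcases hhi with hh | hh
      · omega
      · apply mul_nonpos_of_nonneg_of_nonpos <;> linarith
  refine ⟨![i, 0, 0], ⟨⟨?_, ?_⟩, ?_⟩, ![0, i - 1, 1], ⟨⟨?_, ?_⟩, ?_⟩, ?_⟩
  · intro j; fin_cases j <;> simp; linarith
  · simpa using hiδ
  · intro b hb
    refine (gen b hb).trans (le_of_eq ?_)
    simp [dot3, lamW, Lw, Rw, h0]; ring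
  · intro j; fin_cases j <;> simp; linarith
  · simpa using hiδ
  · intro b hb
    refine (gen b hb).trans (le_of_eq ?_)
    simp [dot3, lamW, Lw, Rw, h1, h2]; ring
  · intro h; have := congrFun h 2; simp at this

/-- The lines of the family. -/
def famLine (N : ℤ) (s : ℝ) : Set V3 := TLine ![6 - s, 6 - s, N] ![6, 6, N] 0 1 2 3

theorem famLine_isLine (N : ℤ) {s : ℝ} (hs : 0 ≤ s) : IsTropicalLine (famLine N s) := by
  refine ⟨![6 - s, 6 - s, N], ![6, 6, N], 0, 1, 2, 3, ⟨by decide, s, hs, ?_⟩, rfl⟩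
  funext i
  fin_cases i <;> simp [ωdir]

theorem seg_coord {N : ℤ} {s : ℝ} (hs : 0 ≤ s) {x : V3}
    (hx : x ∈ segment ℝ (![6 - s, 6 - s, (N : ℝ)] : V3) ![6, 6, (N : ℝ)]) :
    6 - s ≤ x 0 ∧ x 0 ≤ 6 ∧ x 1 ≤ 6 ∧ x 2 = N := by
  obtain ⟨a, b, ha, hb, hab, rfl⟩ := hx
  have hb' : b = 1 - a := by linarith
  subst hb'
  refine ⟨?_, ?_, ?_, ?_⟩ <;> simp only [Pi.add_apply, Pi.smul_apply, smul_eq_mul,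
    Matrix.cons_val_zero, Matrix.cons_val_one, Matrix.cons_val]
  · nlinarith
  · nlinarith
  · nlinarith
  · ring

theorem famLine_subset {δ : ℕ} (hδ : 1 ≤ δ) {M N : ℤ} (hM : 6 * (δ : ℤ) + 12 ≤ M)
    (hN : 6 * (δ : ℤ) ^ 2 + M * δ < N) {s : ℝ} (hs : 0 ≤ s) :
    famLine N s ⊆ Vtrop δ (lamW M N) := by
  rintro x ((((⟨t, ht, rfl⟩ | ⟨t, ht, rfl⟩) | hx) | ⟨t, ht, rfl⟩) | ⟨t, ht, rfl⟩)
  · apply cone_mem hδ hM hN <;> simp [ωdir] <;> linarith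
  · apply cone_mem hδ hM hN <;> simp [ωdir] <;> linarith
  · obtain ⟨-, h0, h1, h2⟩ := seg_coord hs hx
    exact cone_mem hδ hM hN h0 h1 h2
  · apply down_mem hδ hM hN <;> simp [ωdir] <;> linarith
  · apply diag_mem hδ hM hN ht <;> simp [ωdir]

theorem famLine_coord {N : ℤ} {s : ℝ} (hs : 0 ≤ s) {x : V3} (hx : x ∈ famLine N s) :
    6 - s ≤ x 0 ∨ 6 - s ≤ x 1 := by
  rcases hx with ((((⟨t, ht, rfl⟩ | ⟨t, ht, rfl⟩) | hx) | ⟨t, ht, rfl⟩) | ⟨t, ht, rfl⟩)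
  · right; simp [ωdir]
  · left; simp [ωdir]
  · exact Or.inl (seg_coord hs hx).1
  · left; simp [ωdir]; linarith
  · left; simp [ωdir]; linarith

theorem famLine_vertex (N : ℤ) (s : ℝ) : (![6 - s, 6 - s, (N : ℝ)] : V3) ∈ famLine N s :=
  Or.inl (Or.inl (Or.inr (left_mem_segment ℝ _ _)))

theorem famLine_le {N : ℤ} {s s' : ℝ} (hs : 0 ≤ s) (h : famLine N s = famLine N s') :
    s' ≤ s := by
  have := famLine_vertex N s'
  rw [← h] at this
  rcases famLine_coord hs this with h | h <;> simp at h <;> linarith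

theorem famLine_inj (N : ℤ) : Set.InjOn (famLine N) (Set.Ici 0) := fun _ hs _ hs' h =>
  le_antisymm (famLine_le hs' h.symm) (famLine_le hs h)

/-- For every degree `δ ≥ 1` there is a smooth tropical surface of degree `δ` containing
infinitely many tropical lines; moreover these lines can be chosen to form a two-point
family: infinitely many of them pass through two common points `P ≠ Q`. -/
theorem exists_smooth_surface_with_infinitely_many_lines (δ : ℕ) (hδ : 1 ≤ δ) :
    ∃ lam : (Fin 3 → ℤ) → ℝ, TropSmooth δ lam ∧
      {L : Set V3 | IsTropicalLine L ∧ L ⊆ Vtrop δ lam}.Infinite ∧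
      ∃ P Q : V3, P ≠ Q ∧
        {L : Set V3 | IsTropicalLine L ∧ L ⊆ Vtrop δ lam ∧ P ∈ L ∧ Q ∈ L}.Infinite := by
  obtain ⟨M, hM'⟩ : ∃ M : ℤ, M = 6 * (δ : ℤ) + 13 := ⟨_, rfl⟩
  obtain ⟨N, hN'⟩ : ∃ N : ℤ, N = 6 * (δ : ℤ) ^ 2 + M * δ + 1 := ⟨_, rfl⟩
  have hM : 6 * (δ : ℤ) + 12 ≤ M := by linarith
  have hN : 6 * (δ : ℤ) ^ 2 + M * δ < N := by linarith
  have hinf : {L : Set V3 | IsTropicalLine L ∧ L ⊆ Vtrop δ (lamW M N) ∧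
      (![6, 6, (N : ℝ)] : V3) ∈ L ∧ (![6, 6, (N : ℝ)] + ωdir 2 : V3) ∈ L}.Infinite := by
    refine ((Set.Ici_infinite (0 : ℝ)).image (famLine_inj N)).mono ?_
    rintro L ⟨s, hs, rfl⟩
    refine ⟨famLine_isLine N hs, famLine_subset hδ hM hN hs, ?_, ?_⟩
    · exact Or.inl (Or.inr ⟨0, le_rfl, by simp⟩)
    · exact Or.inl (Or.inr ⟨1, zero_le_one, by simp⟩)
  refine ⟨lamW M N, smoothW (by omega) (by linarith) hN, ?_, _, _, ?_, hinf⟩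
  · exact hinf.mono fun L hL => ⟨hL.1, hL.2.1⟩
  · intro h
    have := congrFun h 2
    simp [ωdir] at this
end
end
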